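/- arXiv:1909.02874 — 8 statements merged into one kernel-verified Lean document; each statement's English description precedes it below -/
import Mathlib

section
/- Let e_m denote the infimum of η(P) over all convex polyhedra P inscribed in the unit sphere S² in ℝ³ having exactly m faces, all of which are triangles. Then e_m ≥ sin(36°)/sin(30°·(m+4)/m) for every such m, and consequently liminf_{m→∞} e_m ≥ 2·sin(36°) (angles: 36° = π/5, 30° = π/6). -/
open scoped Real
open Filter

noncomputable section

abbrev E3 := EuclideanSpace ℝ (Fin 3)

/-- `F` is a face of dimension `d` of the convex body `P`:
a nonempty convex extreme subset whose affine hull has dimension `d`. -/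
def IsFaceDim (P F : Set E3) (d : ℕ) : Prop :=
  F.Nonempty ∧ Convex ℝ F ∧ IsExtreme ℝ P F ∧ Module.finrank ℝ (vectorSpan ℝ F) = d

/-- A convex polyhedron inscribed in the unit sphere `S²` in `ℝ³`, given as the convex hull
of a finite vertex set `V ⊆ S²` each point of which is an extreme point of the hull,
which is three-dimensional, all of whose 2-dimensional faces are triangles,
and which has exactly `m` faces (2-dimensional faces). -/
structure InscribedTriPoly (m : ℕ) where
  V : Finset E3
  on_sphere : ∀ v ∈ V, ‖v‖ = 1
  is_vertex : ∀ v ∈ V, v ∈ Set.extremePoints ℝ (convexHull ℝ (V : Set E3))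
  full_dim : affineSpan ℝ (V : Set E3) = ⊤
  faces_triangles : ∀ F : Set E3, IsFaceDim (convexHull ℝ (V : Set E3)) F 2 →
      ∃ a b c : E3, a ∈ V ∧ b ∈ V ∧ c ∈ V ∧ AffineIndependent ℝ ![a, b, c] ∧
        F = convexHull ℝ ({a, b, c} : Set E3)
  card_faces : {F : Set E3 | IsFaceDim (convexHull ℝ (V : Set E3)) F 2}.ncard = m

/-- The set of lengths of the edges (1-dimensional faces) of the polytope `conv V`. -/
def edgeLengths (V : Finset E3) : Set ℝ :=
  {d : ℝ | ∃ p q : E3, p ≠ q ∧ IsFaceDim (convexHull ℝ (V : Set E3)) (segment ℝ p q) 1 ∧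
    d = dist p q}

/-- `η` : quotient of the longest edge length by the shortest edge length. -/
def eta (V : Finset E3) : ℝ := sSup (edgeLengths V) / sInf (edgeLengths V)

/-- `e m` : the infimum of `η P` over all convex polyhedra `P` inscribed in the unit
sphere with exactly `m` faces, all triangles. -/
def e (m : ℕ) : ℝ := sInf {x : ℝ | ∃ P : InscribedTriPoly m, x = eta P.V}

open scoped RealInnerProductSpace

open Set in
theorem isExtreme_levelSet {E : Type*} [AddCommGroup E] [Module ℝ E] {A : Set E} (f : E →ₗ[ℝ] ℝ)
    {M : ℝ} (h : ∀ x ∈ A, f x ≤ M) : IsExtreme ℝ A {x ∈ A | f x = M} := by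
  refine ⟨fun x hx => hx.1, ?_⟩
  rintro x hx y hy z ⟨-, hz⟩ ⟨a, b, ha, hb, hab, rfl⟩
  refine ⟨hx, le_antisymm (h x hx) ?_⟩
  simp only [map_add, map_smul, smul_eq_mul] at hz
  have h1 := h y hy
  have hb' : b = 1 - a := by linarith
  subst hb'
  nlinarith [mul_le_mul_of_nonneg_left h1 hb.le]

theorem convex_levelSet {E : Type*} [AddCommGroup E] [Module ℝ E] {A : Set E} (hA : Convex ℝ A)
    (f : E →ₗ[ℝ] ℝ) (M : ℝ) : Convex ℝ {x ∈ A | f x = M} :=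
  hA.inter (convex_hyperplane f.isLinear M)

/-- If a convex combination of points of `A` lies in an extreme subset of `A`, then so do all
points that occur with positive weight. -/
theorem IsExtreme.mem_of_sum_smul_mem {E : Type*} [AddCommGroup E] [Module ℝ E] {A F : Set E}
    (hA : Convex ℝ A) (hF : IsExtreme ℝ A F) {t : Finset E} (ht : (t : Set E) ⊆ A) {w : E → ℝ}
    (hw : ∀ y ∈ t, 0 ≤ w y) (hw1 : ∑ y ∈ t, w y = 1) (hx : ∑ y ∈ t, w y • y ∈ F)
    {y : E} (hy : y ∈ t) (hwy : 0 < w y) : y ∈ F := by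
  classical
  have h1 := Finset.add_sum_erase t w hy
  have h2 := Finset.add_sum_erase t (fun y => w y • y) hy
  have hnn : 0 ≤ ∑ x ∈ t.erase y, w x :=
    Finset.sum_nonneg fun x hx => hw x (Finset.mem_of_mem_erase hx)
  rcases hnn.eq_or_lt with h0 | h0
  · have h3 : ∑ x ∈ t.erase y, w x • x = 0 := by
      refine Finset.sum_eq_zero fun x hx => ?_
      rw [(Finset.sum_eq_zero_iff_of_nonneg
        (fun x hx => hw x (Finset.mem_of_mem_erase hx))).1 h0.symm x hx, zero_smul]
    have h4 : w y = 1 := by linarith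
    simp only [h3, h4, one_smul, add_zero] at h2
    rwa [← h2] at hx
  · have hz : (t.erase y).centerMass w id ∈ A :=
      hA.centerMass_mem (fun x hx => hw x (Finset.mem_of_mem_erase hx)) h0
        fun x hx => ht (Finset.mem_of_mem_erase hx)
    refine hF.left_mem_of_mem_openSegment (ht hy) hz hx
      ⟨w y, ∑ x ∈ t.erase y, w x, hwy, h0, by linarith, ?_⟩
    rw [Finset.centerMass, smul_smul, mul_inv_cancel₀ h0.ne', one_smul, ← h2]
    rfl

theorem IsExtreme.eq_convexHull_filter {E : Type*} [AddCommGroup E] [Module ℝ E] {V : Finset E}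
    {F : Set E} [DecidablePred (· ∈ F)]
    (hF : IsExtreme ℝ (convexHull ℝ (V : Set E)) F) (hc : Convex ℝ F) :
    F = convexHull ℝ ((V.filter (· ∈ F) : Finset E) : Set E) := by
  refine subset_antisymm (fun x hx => ?_) (convexHull_min (fun x hx => ?_) hc)
  · obtain ⟨w, hw, hw1, rfl⟩ := Finset.mem_convexHull'.1 (hF.subset hx)
    have key : ∀ y ∈ V, y ∉ F → w y = 0 := fun y hy hyF => by
      by_contra h
      exact hyF (hF.mem_of_sum_smul_mem (convex_convexHull ℝ _) (subset_convexHull ℝ _) hw hw1 hx hy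
        ((hw y hy).lt_of_ne' h))
    refine Finset.mem_convexHull'.2 ⟨w, fun y hy => hw y (Finset.mem_filter.1 hy).1, ?_, ?_⟩
    · rw [← hw1]
      refine Finset.sum_subset (Finset.filter_subset _ _) fun y hy hyF => key y hy fun h => ?_
      exact hyF (Finset.mem_filter.2 ⟨hy, h⟩)
    · refine Finset.sum_subset (Finset.filter_subset _ _) fun y hy hyF => ?_
      rw [key y hy fun h => hyF (Finset.mem_filter.2 ⟨hy, h⟩), zero_smul]
  · simp only [Finset.coe_filter, Set.mem_ofPred_eq] at hx
    exact hx.2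

theorem vectorSpan_convexHull {E : Type*} [AddCommGroup E] [Module ℝ E] (s : Set E) :
    vectorSpan ℝ (convexHull ℝ s) = vectorSpan ℝ s := by
  rw [← direction_affineSpan, affineSpan_convexHull, direction_affineSpan]

theorem finrank_vectorSpan_segment {p q : E3} (h : p ≠ q) :
    Module.finrank ℝ (vectorSpan ℝ (segment ℝ p q)) = 1 := by
  rw [← convexHull_pair, vectorSpan_convexHull, vectorSpan_pair]
  exact finrank_span_singleton (by simpa [sub_eq_zero] using h)

/-- A proper extreme subset contains no interior point. -/
theorem IsExtreme.notMem_interior {P F : Set E3} (hF : IsExtreme ℝ P F)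
    (hd : Module.finrank ℝ (vectorSpan ℝ F) < 3) {z : E3} (hz : z ∈ F) : z ∉ interior P := by
  intro hzi
  have hPF : P ⊆ F := by
    intro y hy
    have hlim : Tendsto (fun δ : ℝ => z + δ • (z - y)) (nhdsWithin 0 (Set.Ioi 0)) (nhds z) := by
      have : Continuous (fun δ : ℝ => z + δ • (z - y)) := by fun_prop
      simpa using (this.tendsto 0).mono_left nhdsWithin_le_nhds
    obtain ⟨δ, hδ, hδ0⟩ := ((hlim.eventually (mem_interior_iff_mem_nhds.1 hzi)).and
      self_mem_nhdsWithin).exists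
    have hδ0 : 0 < δ := hδ0
    refine hF.left_mem_of_mem_openSegment hy hδ hz
      ⟨δ / (1 + δ), 1 / (1 + δ), by positivity, by positivity, by field_simp; ring, ?_⟩
    have : (1 + δ) ≠ 0 := by positivity
    match_scalars
    · field_simp
      ring
    · field_simp
  have htop : vectorSpan ℝ F = ⊤ := by
    have : affineSpan ℝ (interior P) = ⊤ := isOpen_interior.affineSpan_eq_top ⟨z, hzi⟩
    have h2 : affineSpan ℝ F = ⊤ :=
      top_unique (this ▸ affineSpan_mono ℝ (interior_subset.trans hPF))
    rw [← direction_affineSpan, h2, AffineSubspace.direction_top]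
  rw [htop, finrank_top] at hd
  simp at hd

theorem isFaceDim_one_endpoint {V : Finset E3} {p q : E3}
    (h : IsFaceDim (convexHull ℝ (V : Set E3)) (segment ℝ p q) 1) : p ∈ V := by
  have hext : p ∈ (convexHull ℝ (V : Set E3)).extremePoints ℝ := by
    refine ⟨h.2.2.1.subset (left_mem_segment ℝ p q), fun x hx y hy hp => ?_⟩
    have hx' := h.2.2.1.left_mem_of_mem_openSegment hx hy (left_mem_segment ℝ p q) hp
    have hy' := h.2.2.1.right_mem_of_mem_openSegment hx hy (left_mem_segment ℝ p q) hp
    rw [segment_eq_image_lineMap] at hx' hy'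
    obtain ⟨s, hs, rfl⟩ := hx'
    obtain ⟨t, ht, rfl⟩ := hy'
    obtain ⟨a, b, ha, hb, hab, hp⟩ := hp
    have h0 : (a * s + b * t) • (q - p) = 0 := by
      have hb' : b = 1 - a := by linarith
      subst hb'
      simp only [AffineMap.lineMap_apply, vsub_eq_sub, vadd_eq_add] at hp
      rw [← sub_eq_zero] at hp
      rw [← hp]
      module
    rcases smul_eq_zero.1 h0 with h0 | h0
    · have : s = 0 := by
        have := mul_nonneg ha.le hs.1
        have := mul_nonneg hb.le ht.1
        have : a * s = 0 := by linarith
        rcases mul_eq_zero.1 this with h | h <;> linarith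
      simp [this]
    · rw [sub_eq_zero] at h0
      simp [h0]
  exact extremePoints_convexHull_subset hext

theorem inner_eq_one_sub_dist_sq {a b : E3} (ha : ‖a‖ = 1) (hb : ‖b‖ = 1) :
    ⟪a, b⟫ = 1 - dist a b ^ 2 / 2 := by
  rw [dist_eq_norm, norm_sub_sq_real, ha, hb]
  ring

theorem linearMap_le_of_mem_convexHull {E : Type*} [AddCommGroup E] [Module ℝ E] {s : Set E}
    (f : E →ₗ[ℝ] ℝ) {M : ℝ} (h : ∀ x ∈ s, f x ≤ M) : ∀ x ∈ convexHull ℝ s, f x ≤ M :=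
  convexHull_min h (convex_halfSpace_le f.isLinear M)

/-- A face that contains exactly two vertices is an edge. -/
theorem IsExtreme.isFaceDim_segment {V : Finset E3} {F : Set E3}
    (hF : IsExtreme ℝ (convexHull ℝ (V : Set E3)) F) (hc : Convex ℝ F) {p q : E3}
    (hpq : p ≠ q) (hVF : ∀ v, v ∈ V ∧ v ∈ F ↔ v = p ∨ v = q) :
    IsFaceDim (convexHull ℝ (V : Set E3)) (segment ℝ p q) 1 := by
  classical
  have h1 : F = segment ℝ p q := by
    rw [hF.eq_convexHull_filter hc, ← convexHull_pair]
    congr 1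
    ext v
    simpa using hVF v
  rw [← h1]
  exact ⟨⟨p, ((hVF p).2 (Or.inl rfl)).2⟩, hc, hF, by rw [h1, finrank_vectorSpan_segment hpq]⟩

theorem isFaceDim_segment_of_closest {V : Finset E3} (hs : ∀ v ∈ V, ‖v‖ = 1) {p q : E3}
    (hp : p ∈ V) (hq : q ∈ V) (hpq : p ≠ q)
    (h : ∀ u ∈ V, ∀ v ∈ V, u ≠ v → dist p q ≤ dist u v) :
    IsFaceDim (convexHull ℝ (V : Set E3)) (segment ℝ p q) 1 := by
  have hle : ∀ u ∈ V, ∀ v ∈ V, u ≠ v → ⟪u, v⟫ ≤ ⟪p, q⟫ := fun u hu v hv huv => by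
    rw [inner_eq_one_sub_dist_sq (hs u hu) (hs v hv), inner_eq_one_sub_dist_sq (hs p hp) (hs q hq)]
    have := h u hu v hv huv
    have : dist p q ^ 2 ≤ dist u v ^ 2 := by gcongr
    linarith
  have hlt : ⟪p, q⟫ < 1 := by
    rw [inner_eq_one_sub_dist_sq (hs p hp) (hs q hq)]
    have := dist_pos.2 hpq
    nlinarith
  have hpp : ⟪p, p⟫ = (1 : ℝ) := by simp [hs p hp]
  have hqq : ⟪q, q⟫ = (1 : ℝ) := by simp [hs q hq]
  have hval : ∀ v ∈ V, v ≠ p → v ≠ q → ⟪p + q, v⟫ < 1 + ⟪p, q⟫ := fun v hv hvp hvq => by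
    rw [inner_add_left]
    linarith [hle p hp v hv hvp.symm, hle q hq v hv hvq.symm]
  have hfp : ⟪p + q, p⟫ = 1 + ⟪p, q⟫ := by rw [inner_add_left, hpp, real_inner_comm]
  have hfq : ⟪p + q, q⟫ = 1 + ⟪p, q⟫ := by rw [inner_add_left, hqq, add_comm]
  have hmax : ∀ x ∈ convexHull ℝ (V : Set E3), (innerₗ E3 (p + q)) x ≤ 1 + ⟪p, q⟫ := by
    refine linearMap_le_of_mem_convexHull _ fun v hv => ?_
    simp only [innerₗ_apply_apply]
    by_cases hvp : v = p
    · rw [hvp, hfp]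
    by_cases hvq : v = q
    · rw [hvq, hfq]
    exact (hval v hv hvp hvq).le
  refine (isExtreme_levelSet _ hmax).isFaceDim_segment
    (convex_levelSet (convex_convexHull ℝ _) _ _) hpq fun v => ⟨?_, ?_⟩
  · rintro ⟨hv, -, hv2⟩
    by_contra! hne
    exact (hval v hv hne.1 hne.2).ne hv2
  · rintro (rfl | rfl)
    · exact ⟨hp, subset_convexHull ℝ _ hp, hfp⟩
    · exact ⟨hq, subset_convexHull ℝ _ hq, hfq⟩

theorem exists_closest_pair {V : Finset E3} (hV : 2 ≤ V.card) :
    ∃ p ∈ V, ∃ q ∈ V, p ≠ q ∧ ∀ u ∈ V, ∀ v ∈ V, u ≠ v → dist p q ≤ dist u v := by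
  have hne : V.offDiag.Nonempty := by
    obtain ⟨a, ha, b, hb, hab⟩ := Finset.one_lt_card.1 hV
    exact ⟨(a, b), by simp [ha, hb, hab]⟩
  obtain ⟨⟨p, q⟩, hpq, hmin⟩ := Finset.exists_min_image _ (fun x : E3 × E3 => dist x.1 x.2) hne
  simp only [Finset.mem_offDiag] at hpq
  exact ⟨p, hpq.1, q, hpq.2.1, hpq.2.2, fun u hu v hv huv => hmin (u, v) (by simp [hu, hv, huv])⟩

/-- The sides of a triangular face are edges. -/
theorem isFaceDim_segment_of_triangle {P : Set E3} {a b c : E3}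
    (hT : IsFaceDim P (convexHull ℝ {a, b, c}) 2) (hi : AffineIndependent ℝ ![a, b, c]) :
    IsFaceDim P (segment ℝ a b) 1 := by
  have hab : a ≠ b := hi.injective.ne (show (0 : Fin 3) ≠ 1 by decide)
  have hli := (affineIndependent_iff_linearIndependent_vsub ℝ _ (0 : Fin 3)).1 hi
  have hc : c - a ∉ Submodule.span ℝ {b - a} := fun hmem => by
    obtain ⟨r, hr⟩ := Submodule.mem_span_singleton.1 hmem
    have hnot := affineIndependent_iff_not_collinear_set.1 hi
    refine hnot ((collinear_iff_of_mem (p₀ := a) (by simp)).2 ⟨b - a, ?_⟩)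
    rintro p (rfl | rfl | rfl)
    · exact ⟨0, by simp⟩
    · exact ⟨1, by simp⟩
    · exact ⟨r, by simp [hr]⟩
  obtain ⟨f, hfc, hfb⟩ := Submodule.exists_dual_map_eq_bot_of_notMem hc inferInstance
  have hb : f (b - a) = 0 := by
    have : f (b - a) ∈ Submodule.map f (Submodule.span ℝ {b - a}) :=
      Submodule.mem_map_of_mem (Submodule.mem_span_singleton_self _)
    rwa [hfb, Submodule.mem_bot] at this
  clear hfb hli
  wlog hneg : f (c - a) < 0 generalizing f
  · exact this (-f) (by rw [LinearMap.neg_apply]; exact neg_ne_zero.2 hfc) (by simp [hb]) (by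
      simp only [LinearMap.neg_apply]
      have := lt_of_le_of_ne (not_lt.1 hneg) hfc.symm
      linarith)
  rw [map_sub] at hb hneg
  classical
  have hV : convexHull ℝ (({a, b, c} : Finset E3) : Set E3) = convexHull ℝ {a, b, c} := by simp
  have hmax : ∀ x ∈ convexHull ℝ (({a, b, c} : Finset E3) : Set E3), f x ≤ f a := by
    refine linearMap_le_of_mem_convexHull _ fun v hv => ?_
    simp only [Finset.coe_insert, Finset.coe_singleton, Set.mem_insert_iff,
      Set.mem_singleton_iff] at hv
    rcases hv with rfl | rfl | rfl <;> linarith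
  have h1 := (isExtreme_levelSet f hmax).isFaceDim_segment
    (convex_levelSet (convex_convexHull ℝ _) f (f a)) hab fun v => ⟨?_, ?_⟩
  · exact ⟨h1.1, h1.2.1, hT.2.2.1.trans (hV ▸ h1.2.2.1), h1.2.2.2⟩
  · rintro ⟨hv, -, hv2⟩
    simp only [Finset.mem_insert, Finset.mem_singleton] at hv
    rcases hv with rfl | rfl | rfl
    · simp
    · simp
    · linarith
  · rintro (rfl | rfl)
    · exact ⟨by simp, subset_convexHull ℝ _ (by simp), rfl⟩
    · exact ⟨by simp, subset_convexHull ℝ _ (by simp), by linarith⟩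

/-- If the center of a circle is a convex combination of at most three points of the circle,
then some two of these points are far apart. -/
theorem exists_dist_sq_ge_of_center_mem {t : Finset E3} (ht : t.card ≤ 3) {q : E3} {r : ℝ}
    (hr : 0 < r) (hq : q ∈ convexHull ℝ (t : Set E3)) (hd : ∀ x ∈ t, ‖x - q‖ ^ 2 = r) :
    ∃ x ∈ t, ∃ y ∈ t, x ≠ y ∧ 3 * r ≤ dist x y ^ 2 := by
  obtain ⟨w, hw, hw1, hwq⟩ := Finset.mem_convexHull'.1 hq
  have hne : t.Nonempty := by
    by_contra h
    rw [Finset.not_nonempty_iff_eq_empty] at h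
    simp [h] at hw1
  obtain ⟨x, hx, hmax⟩ := t.exists_max_image w hne
  have hwx : 1 ≤ 3 * w x := by
    calc (1 : ℝ) = ∑ y ∈ t, w y := hw1.symm
      _ ≤ t.card • w x := Finset.sum_le_card_nsmul _ _ _ hmax
      _ = t.card * w x := nsmul_eq_mul _ _
      _ ≤ 3 * w x := by gcongr; exacts [hw x hx, by exact_mod_cast ht]
  have hsum : ∑ y ∈ t, w y * ⟪x - q, y - q⟫ = 0 := by
    have : ∑ y ∈ t, w y • (y - q) = 0 := by
      simp only [smul_sub, Finset.sum_sub_distrib, hwq, ← Finset.sum_smul, hw1, one_smul, sub_self]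
    have h2 := congrArg (fun z => ⟪x - q, z⟫) this
    simpa [inner_sum, inner_smul_right] using h2
  classical
  rw [← Finset.add_sum_erase t _ hx, real_inner_self_eq_norm_sq, hd x hx] at hsum
  rw [← Finset.add_sum_erase t _ hx] at hw1
  by_contra! hcon
  have hlt : ∀ y ∈ t.erase x, -(r / 2) < ⟪x - q, y - q⟫ := fun y hy => by
    have h1 := hcon x hx y (Finset.mem_of_mem_erase hy) (Finset.ne_of_mem_erase hy).symm
    have h2 : dist x y ^ 2 = r - 2 * ⟪x - q, y - q⟫ + r := by
      rw [dist_eq_norm, show x - y = (x - q) - (y - q) by abel, norm_sub_sq_real, hd x hx,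
        hd y (Finset.mem_of_mem_erase hy)]
    linarith
  have hge : ∑ y ∈ t.erase x, w y * -(r / 2) ≤ ∑ y ∈ t.erase x, w y * ⟪x - q, y - q⟫ :=
    Finset.sum_le_sum fun y hy =>
      mul_le_mul_of_nonneg_left (hlt y hy).le (hw y (Finset.mem_of_mem_erase hy))
  rcases (Finset.sum_nonneg fun y hy => hw y (Finset.mem_of_mem_erase hy) :
    0 ≤ ∑ y ∈ t.erase x, w y).eq_or_lt with h0 | h0
  · rw [← Finset.sum_mul, ← h0] at hge
    nlinarith
  · have hgt : ∑ y ∈ t.erase x, w y * -(r / 2) < ∑ y ∈ t.erase x, w y * ⟪x - q, y - q⟫ := by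
      obtain ⟨y, hy, hwy⟩ : ∃ y ∈ t.erase x, 0 < w y := by
        by_contra! h
        exact absurd (Finset.sum_nonpos h) (not_le.2 h0)
      exact Finset.sum_lt_sum
        (fun y hy => mul_le_mul_of_nonneg_left (hlt y hy).le (hw y (Finset.mem_of_mem_erase hy)))
        ⟨y, hy, mul_lt_mul_of_pos_left (hlt y hy) hwy⟩
    rw [← Finset.sum_mul] at hgt
    nlinarith

theorem card_le_three_of_inner_lt {V : Finset E3} {n : E3} (hn : ‖n‖ = 1)
    (h : ∀ u ∈ V, ∀ v ∈ V, u ≠ v → ⟪u, v⟫ < ⟪n, u⟫ * ⟪n, v⟫) : V.card ≤ 3 := by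
  classical
  by_contra! hcard
  obtain ⟨t, htV, ht⟩ := Finset.exists_subset_card_eq hcard
  obtain ⟨z, hz⟩ : t.Nonempty := Finset.card_pos.1 (by omega)
  set y : E3 → E3 := fun v => v - ⟪n, v⟫ • n with hy
  have hnn : ⟪n, n⟫ = (1 : ℝ) := by simp [hn]
  have hny : ∀ v, ⟪n, y v⟫ = 0 := fun v => by
    simp only [hy, inner_sub_right, inner_smul_right, hnn]; ring
  have hyy : ∀ u v, ⟪y u, y v⟫ = ⟪u, v⟫ - ⟪n, u⟫ * ⟪n, v⟫ := fun u v => by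
    have := hny v
    simp only [hy, inner_sub_right, inner_sub_left, inner_smul_right, inner_smul_left, hnn,
      real_inner_comm n u] at this ⊢
    simp
  have hneg : ∀ u ∈ t, ∀ v ∈ t, u ≠ v → ⟪y u, y v⟫ < 0 := fun u hu v hv huv => by
    rw [hyy]; linarith [h u (htV hu) v (htV hv) huv]
  set t' := t.erase z
  have ht' : t'.card = 3 := by rw [Finset.card_erase_of_mem hz, ht]
  obtain ⟨g, hg0, hg1⟩ : ∃ g : E3 → ℝ, ∑ v ∈ t', g v • y v = 0 ∧ ∃ v ∈ t', g v ≠ 0 := by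
    have hdep : ¬ LinearIndependent ℝ (fun o : Option t' => o.elim n fun v => y v) := fun hli => by
      have := hli.fintype_card_le_finrank
      simp [ht'] at this
    rw [Fintype.not_linearIndependent_iff] at hdep
    obtain ⟨g, hg, i, hi⟩ := hdep
    rw [Fintype.sum_option] at hg
    simp only [Option.elim_none, Option.elim_some] at hg
    have hgn : g none = 0 := by
      have h2 := congrArg (fun z => ⟪n, z⟫) hg
      simpa [inner_add_right, inner_sum, inner_smul_right, hny, hn] using h2
    rw [hgn, zero_smul, zero_add] at hg
    refine ⟨fun v => if hv : v ∈ t' then g (some ⟨v, hv⟩) else 0, ?_, ?_⟩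
    · rw [← Finset.sum_coe_sort, ← hg]
      refine Finset.sum_congr rfl fun v _ => ?_
      simp
    · cases i with
      | none => exact absurd hgn hi
      | some v => exact ⟨v, v.2, by simpa using hi⟩
  have hsame : (∀ v ∈ t', 0 ≤ g v) ∨ ∀ v ∈ t', g v ≤ 0 := by
    by_contra! hcon
    obtain ⟨⟨a, ha, hga⟩, b, hb, hgb⟩ := hcon
    set p := t'.filter (0 < g ·)
    set m := t'.filter (¬ 0 < g ·)
    have hsplit : ∑ v ∈ p, g v • y v + ∑ v ∈ m, g v • y v = 0 := by
      rw [Finset.sum_filter_add_sum_filter_not, hg0]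
    have hsq : 0 ≤ ⟪∑ v ∈ p, g v • y v, ∑ v ∈ p, g v • y v⟫ := real_inner_self_nonneg
    have h1 : ⟪∑ v ∈ p, g v • y v, ∑ v ∈ m, g v • y v⟫ ≤ 0 := by
      rw [eq_neg_of_add_eq_zero_right hsplit, inner_neg_right]; linarith
    rw [sum_inner] at h1
    have hterm : ∀ u ∈ p, ∀ v ∈ m, 0 ≤ ⟪g u • y u, g v • y v⟫ := fun u hu v hv => by
      obtain ⟨hu1, hu2⟩ := Finset.mem_filter.1 hu
      obtain ⟨hv1, hv2⟩ := Finset.mem_filter.1 hv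
      have huv : u ≠ v := fun h => hv2 (h ▸ hu2)
      rw [inner_smul_left, inner_smul_right]
      have := hneg u (Finset.mem_of_mem_erase hu1) v (Finset.mem_of_mem_erase hv1) huv
      simp only [conj_trivial]
      exact mul_nonneg hu2.le (mul_nonneg_of_nonpos_of_nonpos (not_lt.1 hv2) this.le)
    have hab : b ∈ p ∧ a ∈ m := by simp [p, m, ha, hb, hga.le, hgb]
    have hpos : 0 < ⟪g b • y b, g a • y a⟫ := by
      have := hneg b (Finset.mem_of_mem_erase hb) a (Finset.mem_of_mem_erase ha)
        (fun h => by rw [h] at hgb; linarith)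
      rw [inner_smul_left, inner_smul_right]
      simp only [conj_trivial]
      exact mul_pos hgb (mul_pos_of_neg_of_neg hga this)
    refine absurd h1 (not_le.2 (Finset.sum_pos' (fun u hu => ?_) ⟨b, hab.1, ?_⟩))
    · rw [inner_sum]; exact Finset.sum_nonneg (hterm u hu)
    · rw [inner_sum]; exact Finset.sum_pos' (hterm b hab.1) ⟨a, hab.2, hpos⟩
  have hz0 : ∑ v ∈ t', g v * ⟪y z, y v⟫ = 0 := by
    have h2 := congrArg (fun x => ⟪y z, x⟫) hg0
    simpa [inner_sum, inner_smul_right] using h2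
  have hzneg : ∀ v ∈ t', ⟪y z, y v⟫ < 0 := fun v hv =>
    hneg z hz v (Finset.mem_of_mem_erase hv) (Finset.ne_of_mem_erase hv).symm
  obtain ⟨v, hv, hgv⟩ := hg1
  rcases hsame with hs | hs
  · refine hgv ?_
    have := (Finset.sum_eq_zero_iff_of_nonpos fun u hu =>
      mul_nonpos_of_nonneg_of_nonpos (hs u hu) (hzneg u hu).le).1 hz0 v hv
    exact (mul_eq_zero.1 this).resolve_right (hzneg v hv).ne
  · refine hgv ?_
    have := (Finset.sum_eq_zero_iff_of_nonneg fun u hu =>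
      mul_nonneg_of_nonpos_of_nonpos (hs u hu) (hzneg u hu).le).1 hz0 v hv
    exact (mul_eq_zero.1 this).resolve_right (hzneg v hv).ne

theorem four_le_card_of_affineSpan_eq_top {V : Finset E3} (h : affineSpan ℝ (V : Set E3) = ⊤) :
    4 ≤ V.card := by
  classical
  by_contra! hc
  have hne : V.Nonempty := by
    by_contra hne
    rw [Finset.not_nonempty_iff_eq_empty] at hne
    rw [hne, Finset.coe_empty, AffineSubspace.span_empty] at h
    exact AffineSubspace.bot_ne_top ℝ E3 E3 h
  have h1 := finrank_vectorSpan_image_finset_le ℝ (id : E3 → E3) V (n := V.card - 1)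
    (by have := hne.card_pos; omega)
  rw [Finset.image_id, ← direction_affineSpan, h, AffineSubspace.direction_top, finrank_top] at h1
  simp at h1
  omega

theorem nonempty_of_affineSpan_eq_top {V : Finset E3} (h : affineSpan ℝ (V : Set E3) = ⊤) :
    V.Nonempty :=
  Finset.card_pos.1 (by have := four_le_card_of_affineSpan_eq_top h; omega)

theorem interior_convexHull_nonempty {V : Finset E3} (h : affineSpan ℝ (V : Set E3) = ⊤) :
    (interior (convexHull ℝ (V : Set E3))).Nonempty :=
  interior_convexHull_nonempty_iff_affineSpan_eq_top.2 h

theorem isClosed_convexHull_finset (V : Finset E3) : IsClosed (convexHull ℝ (V : Set E3)) :=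
  V.finite_toSet.isClosed_convexHull ℝ

/-- If the origin is not an interior point, then some affine half-space whose closest point to
the origin lies in the polytope contains the polytope. -/
theorem exists_support_of_zero_notMem_interior {V : Finset E3}
    (hV : affineSpan ℝ (V : Set E3) = ⊤)
    (h0 : (0 : E3) ∉ interior (convexHull ℝ (V : Set E3))) :
    ∃ (n : E3) (d : ℝ), ‖n‖ = 1 ∧ 0 ≤ d ∧ (∀ x ∈ convexHull ℝ (V : Set E3), d ≤ ⟪n, x⟫) ∧
      d • n ∈ convexHull ℝ (V : Set E3) := by
  by_cases hmem : (0 : E3) ∈ convexHull ℝ (V : Set E3)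
  · obtain ⟨f, hf0, hf⟩ := geometric_hahn_banach_of_nonempty_interior_point
      (convex_convexHull ℝ (V : Set E3)) h0 (interior_convexHull_nonempty hV)
    set y := (InnerProductSpace.toDual ℝ E3).symm f with hy
    have hy0 : ‖y‖ ≠ 0 := by
      rw [norm_ne_zero_iff, hy]
      simpa using hf0
    refine ⟨-(‖y‖⁻¹ • y), 0, ?_, le_rfl, fun x hx => ?_, by simpa using hmem⟩
    · rw [norm_neg, norm_smul, norm_inv, norm_norm, inv_mul_cancel₀ hy0]
    · rw [inner_neg_left, inner_smul_left, hy, InnerProductSpace.toDual_symm_apply]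
      have h1 := hf x hx
      rw [map_zero] at h1
      have : 0 ≤ ‖y‖⁻¹ := by positivity
      simp only [conj_trivial]
      nlinarith
  · obtain ⟨q, hq, hqmin⟩ := exists_norm_eq_iInf_of_complete_convex
      (interior_convexHull_nonempty hV |>.mono interior_subset)
      (isClosed_convexHull_finset V).isComplete (convex_convexHull ℝ (V : Set E3)) 0
    have hmin := (norm_eq_iInf_iff_real_inner_le_zero (convex_convexHull ℝ _) hq).1 hqmin
    have hq0 : ‖q‖ ≠ 0 := fun h => hmem (norm_eq_zero.1 h ▸ hq)
    refine ⟨‖q‖⁻¹ • q, ‖q‖, ?_, norm_nonneg q, fun x hx => ?_, ?_⟩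
    · rw [norm_smul, norm_inv, norm_norm, inv_mul_cancel₀ hq0]
    · have h1 := hmin x hx
      rw [zero_sub, inner_neg_left, inner_sub_right, real_inner_self_eq_norm_sq] at h1
      have h2 : ‖q‖ ^ 2 ≤ ⟪q, x⟫ := by linarith
      rw [inner_smul_left]
      simp only [conj_trivial]
      calc ‖q‖ = ‖q‖⁻¹ * ‖q‖ ^ 2 := by field_simp
        _ ≤ ‖q‖⁻¹ * ⟪q, x⟫ := by gcongr
    · rwa [smul_smul, mul_inv_cancel₀ hq0, one_smul]

theorem finrank_vectorSpan_lt_of_levelSet {F : Set E3} {f : E3 →ₗ[ℝ] ℝ} (hf : f ≠ 0) {M : ℝ}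
    (h : ∀ x ∈ F, f x = M) : Module.finrank ℝ (vectorSpan ℝ F) < 3 := by
  have hle : vectorSpan ℝ F ≤ LinearMap.ker f := by
    rw [vectorSpan_def, Submodule.span_le]
    rintro _ ⟨x, hx, y, hy, rfl⟩
    simp [h x hx, h y hy]
  have hlt : Module.finrank ℝ (LinearMap.ker f) < Module.finrank ℝ E3 :=
    Submodule.finrank_lt (by rwa [ne_eq, LinearMap.ker_eq_top])
  have := Submodule.finrank_mono hle
  simp at hlt
  omega

theorem affineIndependent_of_norm_eq_one {a b c : E3} (ha : ‖a‖ = 1) (hb : ‖b‖ = 1) (hc : ‖c‖ = 1)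
    (hab : a ≠ b) (hac : a ≠ c) (hbc : b ≠ c) : AffineIndependent ℝ ![a, b, c] := by
  refine EuclideanGeometry.Cospherical.affineIndependent_of_ne ⟨0, 1, ?_⟩ hab hac hbc
  rintro p (rfl | rfl | rfl) <;> simpa

theorem finrank_vectorSpan_triple {a b c : E3} (h : AffineIndependent ℝ ![a, b, c]) :
    Module.finrank ℝ (vectorSpan ℝ {a, b, c}) = 2 := by
  have := h.finrank_vectorSpan (n := 2) (by simp)
  have hr : Set.range ![a, b, c] = {a, b, c} := by
    rw [Matrix.range_cons, Matrix.range_cons_cons_empty, Set.singleton_union]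
  rwa [hr] at this

theorem InscribedTriPoly.exists_long_edge {m : ℕ} (P : InscribedTriPoly m)
    (h0 : (0 : E3) ∉ interior (convexHull ℝ (P.V : Set E3))) :
    ∃ p q : E3, p ≠ q ∧ IsFaceDim (convexHull ℝ (P.V : Set E3)) (segment ℝ p q) 1 ∧
      ∃ u ∈ P.V, ∃ v ∈ P.V, u ≠ v ∧ 3 * dist u v ^ 2 ≤ 2 * dist p q ^ 2 := by
  classical
  obtain ⟨n, d, hn, hd, hsup, hmem⟩ := exists_support_of_zero_notMem_interior P.full_dim h0
  have hcard := four_le_card_of_affineSpan_eq_top P.full_dim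
  have hnn : ⟪n, n⟫ = (1 : ℝ) := by simp [hn]
  obtain ⟨u, hu, v, hv, huv, hclose⟩ : ∃ u ∈ P.V, ∃ v ∈ P.V, u ≠ v ∧
      dist u v ^ 2 ≤ 2 * (1 - d ^ 2) := by
    by_contra! hcon
    have := card_le_three_of_inner_lt (V := P.V) hn fun u hu v hv huv => by
      rw [inner_eq_one_sub_dist_sq (P.on_sphere u hu) (P.on_sphere v hv)]
      have h1 := hsup u (subset_convexHull ℝ _ hu)
      have h2 := hsup v (subset_convexHull ℝ _ hv)
      nlinarith [hcon u hu v hv huv, mul_le_mul h1 h2 hd (hd.trans h1)]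
    omega
  suffices h : ∃ p q : E3, p ≠ q ∧ IsFaceDim (convexHull ℝ (P.V : Set E3)) (segment ℝ p q) 1 ∧
      3 * (1 - d ^ 2) ≤ dist p q ^ 2 by
    obtain ⟨p, q, hpq, hedge, hle⟩ := h
    exact ⟨p, q, hpq, hedge, u, hu, v, hv, huv, by linarith⟩
  have hd1 : 0 ≤ 1 - d ^ 2 := by nlinarith [dist_pos.2 huv]
  rcases hd1.eq_or_lt with hr | hr
  · obtain ⟨p, hp, q, hq, hpq, hmin⟩ := exists_closest_pair (V := P.V) (by omega)
    exact ⟨p, q, hpq, isFaceDim_segment_of_closest P.on_sphere hp hq hpq hmin, by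
      rw [← hr, mul_zero]; positivity⟩
  have hmax : ∀ x ∈ convexHull ℝ (P.V : Set E3), (-innerₗ E3 n) x ≤ -d := fun x hx => by
    simpa using hsup x hx
  set F := {x ∈ convexHull ℝ (P.V : Set E3) | (-innerₗ E3 n) x = -d} with hF
  have hFe : IsExtreme ℝ (convexHull ℝ (P.V : Set E3)) F := isExtreme_levelSet _ hmax
  have hFc : Convex ℝ F := convex_levelSet (convex_convexHull ℝ _) _ _
  have hqF : d • n ∈ F := ⟨hmem, by simp [hn]⟩
  have hrad : ∀ x ∈ P.V, x ∈ F → ‖x - d • n‖ ^ 2 = 1 - d ^ 2 := fun x hx hxF => by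
    have h1 : ⟪n, x⟫ = d := by simpa using hxF.2
    rw [norm_sub_sq_real, P.on_sphere x hx, inner_smul_right, real_inner_comm, h1, norm_smul, hn]
    simp
    ring
  have hfin : Module.finrank ℝ (vectorSpan ℝ F) < 3 := by
    refine finrank_vectorSpan_lt_of_levelSet (f := -innerₗ E3 n) (M := -d) (fun h => ?_)
      fun x hx => hx.2
    have := congrArg (fun g => g n) h
    simp [hn] at this
  by_cases h2 : Module.finrank ℝ (vectorSpan ℝ F) = 2
  · obtain ⟨a, b, c, ha, hb, hc, hi, hFabc⟩ := P.faces_triangles F ⟨⟨_, hqF⟩, hFc, hFe, h2⟩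
    have hT : IsFaceDim (convexHull ℝ (P.V : Set E3)) (convexHull ℝ {a, b, c}) 2 :=
      hFabc ▸ ⟨⟨_, hqF⟩, hFc, hFe, h2⟩
    have hsubF : ∀ x ∈ ({a, b, c} : Finset E3), x ∈ P.V ∧ x ∈ F := by
      intro x hx
      have hxF : x ∈ F := hFabc ▸ subset_convexHull ℝ _ (by simpa using hx)
      simp only [Finset.mem_insert, Finset.mem_singleton] at hx
      rcases hx with rfl | rfl | rfl <;> exact ⟨by assumption, hxF⟩
    obtain ⟨x, hx, y, hy, hxy, hle⟩ := exists_dist_sq_ge_of_center_mem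
      (t := {a, b, c}) Finset.card_le_three hr (by simpa [← hFabc] using hqF)
      fun x hx => hrad x (hsubF x hx).1 (hsubF x hx).2
    refine ⟨x, y, hxy, ?_, hle⟩
    have hN := fun z hz => P.on_sphere z (hsubF z hz).1
    have hab : a ≠ b := hi.injective.ne (show (0 : Fin 3) ≠ 1 by decide)
    have hac : a ≠ c := hi.injective.ne (show (0 : Fin 3) ≠ 2 by decide)
    have hbc : b ≠ c := hi.injective.ne (show (1 : Fin 3) ≠ 2 by decide)
    obtain ⟨z, hxz, hyz, hset⟩ : ∃ z, x ≠ z ∧ y ≠ z ∧ ({a, b, c} : Finset E3) = {x, y, z} := by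
      simp only [Finset.mem_insert, Finset.mem_singleton] at hx hy
      have hz : ∀ z, z ∈ ({a, b, c} : Finset E3) → x ≠ z → y ≠ z →
          ∃ z, x ≠ z ∧ y ≠ z ∧ ({a, b, c} : Finset E3) = {x, y, z} := fun z hz h1 h2 =>
        ⟨z, h1, h2, (Finset.eq_of_subset_of_card_le (by
          intro w hw
          simp only [Finset.mem_insert, Finset.mem_singleton] at hw hz ⊢
          rcases hw with rfl | rfl | rfl <;> assumption) (by
          rw [Finset.card_eq_three.2 ⟨x, y, z, hxy, h1, h2, rfl⟩]
          exact Finset.card_le_three)).symm⟩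
      rcases hx with rfl | rfl | rfl <;> rcases hy with rfl | rfl | rfl <;>
        first
        | exact absurd rfl hxy
        | exact hz a (by simp) (by tauto) (by tauto)
        | exact hz b (by simp) (by tauto) (by tauto)
        | exact hz c (by simp) (by tauto) (by tauto)
    have hset' : ({a, b, c} : Set E3) = {x, y, z} := by
      have := congrArg (fun s : Finset E3 => (s : Set E3)) hset
      simpa using this
    refine isFaceDim_segment_of_triangle (c := z) (hset' ▸ hT) ?_
    exact affineIndependent_of_norm_eq_one (hN x hx) (hN y hy) (hN z (by simp [hset])) hxy hxz hyz
  · have hcoll : ∀ x ∈ P.V, x ∈ F → ∀ y ∈ P.V, y ∈ F → ∀ z ∈ P.V, z ∈ F →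
        x ≠ y → x ≠ z → y = z := by
      intro x hx hxF y hy hyF z hz hzF hxy hxz
      by_contra hyz
      have h3 := finrank_vectorSpan_triple (affineIndependent_of_norm_eq_one (P.on_sphere x hx)
        (P.on_sphere y hy) (P.on_sphere z hz) hxy hxz hyz)
      have h4 := Submodule.finrank_mono (vectorSpan_mono ℝ (s₂ := F)
        (show {x, y, z} ⊆ F by rintro w (rfl | rfl | rfl) <;> assumption))
      omega
    have ht : (P.V.filter (· ∈ F)).card ≤ 3 := by
      by_contra! h
      obtain ⟨x, hx, y, hy, z, hz, hxy, hxz, hyz⟩ := Finset.two_lt_card.1 (by omega :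
        2 < (P.V.filter (· ∈ F)).card)
      simp only [Finset.mem_filter] at hx hy hz
      exact hyz (hcoll x hx.1 hx.2 y hy.1 hy.2 z hz.1 hz.2 hxy hxz)
    obtain ⟨x, hx, y, hy, hxy, hle⟩ := exists_dist_sq_ge_of_center_mem ht hr
      ((hFe.eq_convexHull_filter hFc).subset hqF)
      fun x hx => hrad x (Finset.mem_filter.1 hx).1 (Finset.mem_filter.1 hx).2
    simp only [Finset.mem_filter] at hx hy
    refine ⟨x, y, hxy, hFe.isFaceDim_segment hFc hxy fun w => ⟨fun hw => ?_, ?_⟩, hle⟩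
    · by_contra! hne
      exact hne.2 (hcoll x hx.1 hx.2 y hy.1 hy.2 w hw.1 hw.2 hxy hne.1.symm).symm
    · rintro (rfl | rfl) <;> assumption

namespace InscribedTriPoly

variable {m : ℕ} (P : InscribedTriPoly m)

/-- The polytope itself. -/
def body : Set E3 := convexHull ℝ (P.V : Set E3)

theorem convex_body : Convex ℝ P.body := convex_convexHull ℝ _

theorem subset_body : (P.V : Set E3) ⊆ P.body := subset_convexHull ℝ _

theorem norm_le_one {x : E3} (hx : x ∈ P.body) : ‖x‖ ≤ 1 := by
  have h : (P.V : Set E3) ⊆ Metric.closedBall 0 1 := fun v hv => by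
    simpa using (P.on_sphere v hv).le
  simpa using convexHull_min h (convex_closedBall 0 1) hx

open Classical in
/-- The vertex sets of the faces. -/
def faces : Finset (Finset E3) :=
  (P.V.powersetCard 3).filter fun t => IsFaceDim P.body (convexHull ℝ (t : Set E3)) 2

variable {P}

theorem mem_faces {t : Finset E3} :
    t ∈ P.faces ↔ t ⊆ P.V ∧ t.card = 3 ∧ IsFaceDim P.body (convexHull ℝ (t : Set E3)) 2 := by
  simp [faces, and_assoc]

theorem mem_of_mem_convexHull {t : Finset E3} (ht : t ⊆ P.V) {v : E3} (hv : v ∈ P.V)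
    (h : v ∈ convexHull ℝ (t : Set E3)) : v ∈ t :=
  extremePoints_convexHull_subset <|
    inter_extremePoints_subset_extremePoints_of_subset (convexHull_mono (by exact_mod_cast ht))
      ⟨h, P.is_vertex v hv⟩

theorem card_eq_three_of_mem_faces {t : Finset E3} (ht : t ∈ P.faces) :
    ∃ a b c, a ≠ b ∧ a ≠ c ∧ b ≠ c ∧ t = {a, b, c} :=
  Finset.card_eq_three.1 (mem_faces.1 ht).2.1

theorem affineIndependent_of_mem_faces {a b c : E3} (ht : {a, b, c} ∈ P.faces) (hab : a ≠ b)
    (hac : a ≠ c) (hbc : b ≠ c) : AffineIndependent ℝ ![a, b, c] := by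
  have h := (mem_faces.1 ht).1
  exact affineIndependent_of_norm_eq_one (P.on_sphere a (h (by simp))) (P.on_sphere b (h (by simp)))
    (P.on_sphere c (h (by simp))) hab hac hbc

theorem exists_mem_faces_of_isFaceDim {F : Set E3} (hF : IsFaceDim P.body F 2) :
    ∃ t ∈ P.faces, F = convexHull ℝ (t : Set E3) := by
  classical
  obtain ⟨a, b, c, ha, hb, hc, hi, hFabc⟩ := P.faces_triangles F hF
  have hF' : F = convexHull ℝ (({a, b, c} : Finset E3) : Set E3) := by simpa using hFabc
  refine ⟨{a, b, c}, mem_faces.2 ⟨?_, ?_, hF' ▸ hF⟩, hF'⟩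
  · intro x hx
    simp only [Finset.mem_insert, Finset.mem_singleton] at hx
    rcases hx with rfl | rfl | rfl <;> assumption
  · exact Finset.card_eq_three.2 ⟨a, b, c, hi.injective.ne (show (0 : Fin 3) ≠ 1 by decide),
      hi.injective.ne (show (0 : Fin 3) ≠ 2 by decide),
      hi.injective.ne (show (1 : Fin 3) ≠ 2 by decide), rfl⟩

variable (P) in
theorem faces_card : P.faces.card = m := by
  have h : {F : Set E3 | IsFaceDim (convexHull ℝ (P.V : Set E3)) F 2} =
      (fun t : Finset E3 => convexHull ℝ (t : Set E3)) '' (P.faces : Set (Finset E3)) := by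
    ext F
    constructor
    · intro hF
      obtain ⟨t, ht, rfl⟩ := exists_mem_faces_of_isFaceDim hF
      exact ⟨t, ht, rfl⟩
    · rintro ⟨t, ht, rfl⟩
      exact (mem_faces.1 ht).2.2
  have h2 := P.card_faces
  rw [h, Set.InjOn.ncard_image, Set.ncard_coe_finset] at h2
  · exact h2
  · intro s hs t ht hst
    have hst : convexHull ℝ (s : Set E3) = convexHull ℝ (t : Set E3) := hst
    obtain ⟨hs1, hs2, -⟩ := mem_faces.1 hs
    obtain ⟨ht1, ht2, -⟩ := mem_faces.1 ht
    refine Finset.eq_of_subset_of_card_le (fun x hx => ?_) (by omega)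
    exact mem_of_mem_convexHull ht1 (hs1 hx) (hst ▸ subset_convexHull ℝ _ hx)

theorem smul_mem_interior (h0 : (0 : E3) ∈ interior P.body) {y : E3} (hy : y ∈ P.body) {r : ℝ}
    (hr0 : 0 < r) (hr1 : r < 1) : r • y ∈ interior P.body :=
  P.convex_body.openSegment_interior_self_subset_interior h0 hy
    ⟨1 - r, r, by linarith, hr0, by ring, by simp⟩

theorem notMem_interior_of_mem_face {t : Finset E3} (ht : t ∈ P.faces) {y : E3}
    (hy : y ∈ convexHull ℝ (t : Set E3)) : y ∉ interior P.body := by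
  obtain ⟨-, -, -, -, he, hd⟩ := mem_faces.1 ht
  exact he.notMem_interior (by omega) hy

theorem exists_support (h0 : (0 : E3) ∈ interior P.body) {y : E3} (hy : y ∉ interior P.body) :
    ∃ f : StrongDual ℝ E3, f ≠ 0 ∧ 0 < f y ∧ ∀ x ∈ P.body, f x ≤ f y := by
  obtain ⟨f, hf0, hf⟩ := geometric_hahn_banach_of_nonempty_interior_point P.convex_body hy ⟨0, h0⟩
  refine ⟨f, hf0, ?_, hf⟩
  by_contra! hneg
  refine hf0 (ContinuousLinearMap.ext fun x => ?_)
  have key : ∀ x, f x ≤ 0 := fun x => by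
    have hlim : Tendsto (fun δ : ℝ => δ • x) (nhdsWithin 0 (Set.Ioi 0)) (nhds 0) := by
      have : Continuous (fun δ : ℝ => δ • x) := by fun_prop
      simpa using (this.tendsto 0).mono_left nhdsWithin_le_nhds
    obtain ⟨δ, hδ, hδ0⟩ := ((hlim.eventually (mem_interior_iff_mem_nhds.1 h0)).and
      self_mem_nhdsWithin).exists
    have h1 := hf _ hδ
    rw [map_smul, smul_eq_mul] at h1
    have hδ0 : 0 < δ := hδ0
    by_contra! hx
    nlinarith [mul_pos hδ0 hx]
  have h1 := key x
  have h2 := key (-x)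
  rw [map_neg] at h2
  simp only [zero_apply]
  linarith

theorem linearIndependent_of_mem_faces (h0 : (0 : E3) ∈ interior P.body) {a b c : E3}
    (ht : {a, b, c} ∈ P.faces) (hab : a ≠ b) (hac : a ≠ c) (hbc : b ≠ c) :
    LinearIndependent ℝ ![a, b, c] := by
  have hi := affineIndependent_of_mem_faces ht hab hac hbc
  obtain ⟨hsub, -, hface⟩ := mem_faces.1 ht
  have hmem : ∀ x ∈ ({a, b, c} : Finset E3), x ∈ P.body := fun x hx => P.subset_body (hsub hx)
  set p : E3 := (1 / 3 : ℝ) • a + (1 / 3 : ℝ) • b + (1 / 3 : ℝ) • c with hp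
  have hpT : p ∈ convexHull ℝ (({a, b, c} : Finset E3) : Set E3) := by
    refine Finset.mem_convexHull'.2 ⟨fun _ => 1 / 3, fun _ _ => by norm_num, ?_, ?_⟩
    · rw [Finset.sum_insert (by simp [hab, hac]), Finset.sum_pair hbc]; norm_num
    · rw [Finset.sum_insert (by simp [hab, hac]), Finset.sum_pair hbc, hp, add_assoc]
  obtain ⟨f, -, hfp, hf⟩ := exists_support h0 (notMem_interior_of_mem_face ht hpT)
  have hfp' : f p = 1 / 3 * f a + 1 / 3 * f b + 1 / 3 * f c := by simp [hp]
  have ha := hf a (hmem a (by simp))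
  have hb := hf b (hmem b (by simp))
  have hc := hf c (hmem c (by simp))
  have ha' : f a = f p := by linarith
  have hb' : f b = f p := by linarith
  have hc' : f c = f p := by linarith
  rw [Fintype.linearIndependent_iff]
  intro g hg
  have hsum : ∑ i, g i = 0 := by
    have h1 := congrArg f hg
    simp only [Fin.sum_univ_three, map_add, map_smul, smul_eq_mul, map_zero, Matrix.cons_val_zero,
      Matrix.cons_val_one, Matrix.cons_val, ha', hb', hc'] at h1 ⊢
    have h2 : (g 0 + g 1 + g 2) * f p = 0 := by linarith
    exact (mul_eq_zero.1 h2).resolve_right hfp.ne'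
  exact fun i => affineIndependent_iff.1 hi Finset.univ g hsum hg i (Finset.mem_univ i)

/-- Coefficients with respect to the vertices of a face. -/
theorem exists_coord (h0 : (0 : E3) ∈ interior P.body) {t : Finset E3} (ht : t ∈ P.faces) :
    ∃ φ : E3 → (E3 →ₗ[ℝ] ℝ), (∀ N, ∑ x ∈ t, φ x N • x = N) ∧
      ∀ w : E3 → ℝ, ∀ y ∈ t, φ y (∑ x ∈ t, w x • x) = w y := by
  obtain ⟨a, b, c, hab, hac, hbc, rfl⟩ := card_eq_three_of_mem_faces ht
  have hli := linearIndependent_of_mem_faces h0 ht hab hac hbc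
  set B := basisOfLinearIndependentOfCardEqFinrank hli (by simp) with hB
  have hB0 : B 0 = a := by simp [hB]
  have hB1 : B 1 = b := by simp [hB]
  have hB2 : B 2 = c := by simp [hB]
  set φ : E3 → (E3 →ₗ[ℝ] ℝ) := fun x =>
    if x = a then B.coord 0 else if x = b then B.coord 1 else B.coord 2
  have hφa : φ a = B.coord 0 := by simp [φ]
  have hφb : φ b = B.coord 1 := by simp [φ, hab.symm]
  have hφc : φ c = B.coord 2 := by simp [φ, hac.symm, hbc.symm]
  have hs : ∀ w : E3 → ℝ, ∑ x ∈ ({a, b, c} : Finset E3), w x • x = w a • a + (w b • b + w c • c) :=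
    fun w => by rw [Finset.sum_insert (by simp [hab, hac]), Finset.sum_pair hbc]
  refine ⟨φ, fun N => ?_, fun w y hy => ?_⟩
  · have := B.sum_repr N
    rw [Fin.sum_univ_three, hB0, hB1, hB2] at this
    rw [hs fun x => φ x N, hφa, hφb, hφc, ← add_assoc]
    exact this
  · rw [hs w]
    have ha : B.repr a = Finsupp.single 0 1 := by rw [← hB0, B.repr_self]
    have hb : B.repr b = Finsupp.single 1 1 := by rw [← hB1, B.repr_self]
    have hc : B.repr c = Finsupp.single 2 1 := by rw [← hB2, B.repr_self]
    simp only [Finset.mem_insert, Finset.mem_singleton] at hy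
    rcases hy with rfl | rfl | rfl
    · simp [hφa, Module.Basis.coord_apply, ha, hb, hc]
    · simp [hφb, Module.Basis.coord_apply, ha, hb, hc]
    · simp [hφc, Module.Basis.coord_apply, ha, hb, hc]

end InscribedTriPoly

/-- `N` lies in the open cone spanned by `t`. -/
def InCone (t : Finset E3) (N : E3) : Prop :=
  ∃ w : E3 → ℝ, (∀ x ∈ t, 0 < w x) ∧ ∑ x ∈ t, w x • x = N

/-- `N` lies in the open wedge spanned by `t` with edge along the line through `v`. -/
def InWedge (v : E3) (t : Finset E3) (N : E3) : Prop :=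
  ∃ w : E3 → ℝ, (∀ x ∈ t, x ≠ v → 0 < w x) ∧ ∑ x ∈ t, w x • x = N

namespace InscribedTriPoly

variable {m : ℕ} {P : InscribedTriPoly m}

theorem smul_sum_mem_convexHull {t : Finset E3} {w : E3 → ℝ} (hw : ∀ x ∈ t, 0 ≤ w x)
    (hpos : 0 < ∑ x ∈ t, w x) : (∑ x ∈ t, w x)⁻¹ • ∑ x ∈ t, w x • x ∈ convexHull ℝ (t : Set E3) :=
  Finset.centerMass_mem_convexHull t hw hpos (z := id) fun _ hi => hi

theorem sum_pos_of_pos {t : Finset E3} (ht : t ∈ P.faces) {w : E3 → ℝ} (hw : ∀ x ∈ t, 0 < w x) :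
    0 < ∑ x ∈ t, w x :=
  Finset.sum_pos hw (Finset.card_pos.1 (by have := (mem_faces.1 ht).2.1; omega))

theorem inCone_unique (h0 : (0 : E3) ∈ interior P.body) {s t : Finset E3} (hs : s ∈ P.faces)
    (ht : t ∈ P.faces) {N : E3} (hsN : InCone s N) (htN : InCone t N) : s = t := by
  obtain ⟨w, hw, hwN⟩ := hsN
  obtain ⟨u, hu, huN⟩ := htN
  have hσ := sum_pos_of_pos hs hw
  have hτ := sum_pos_of_pos ht hu
  have hp := smul_sum_mem_convexHull (fun x hx => (hw x hx).le) hσ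
  have hq := smul_sum_mem_convexHull (fun x hx => (hu x hx).le) hτ
  rw [hwN] at hp
  rw [huN] at hq
  set σ := ∑ x ∈ s, w x
  set τ := ∑ x ∈ t, u x
  obtain ⟨hs1, hs2, hs3⟩ := mem_faces.1 hs
  obtain ⟨ht1, ht2, ht3⟩ := mem_faces.1 ht
  have hστ : σ = τ := by
    rcases lt_trichotomy σ τ with h | h | h
    · refine absurd ?_ (notMem_interior_of_mem_face ht hq)
      have := smul_mem_interior h0 (hs3.2.2.1.subset hp) (r := σ / τ) (by positivity)
        ((div_lt_one hτ).2 h)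
      rwa [smul_smul, show σ / τ * σ⁻¹ = τ⁻¹ by field_simp] at this
    · exact h
    · refine absurd ?_ (notMem_interior_of_mem_face hs hp)
      have := smul_mem_interior h0 (ht3.2.2.1.subset hq) (r := τ / σ) (by positivity)
        ((div_lt_one hσ).2 h)
      rwa [smul_smul, show τ / σ * τ⁻¹ = σ⁻¹ by field_simp] at this
  refine Finset.eq_of_subset_of_card_le (fun x hx => ?_) (by omega)
  refine mem_of_mem_convexHull ht1 (hs1 hx) ?_
  refine ht3.2.2.1.mem_of_sum_smul_mem (t := s) (w := fun x => σ⁻¹ * w x) P.convex_body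
    (fun x hx => P.subset_body (hs1 hx)) (fun y hy => mul_nonneg (by positivity) (hw y hy).le)
    ?_ ?_ hx (mul_pos (by positivity) (hw x hx))
  · rw [← Finset.mul_sum]; exact inv_mul_cancel₀ hσ.ne'
  · simp only [mul_smul]
    rw [← Finset.smul_sum, hwN, hστ]
    exact hq

theorem isCompact_body : IsCompact P.body := P.V.finite_toSet.isCompact_convexHull ℝ

theorem exists_inCone (h0 : (0 : E3) ∈ interior P.body) {N : E3}
    (hN : ∀ x ∈ P.V, ∀ y ∈ P.V, N ∉ Submodule.span ℝ {x, y}) : ∃ t ∈ P.faces, InCone t N := by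
  classical
  obtain ⟨v, hv⟩ := nonempty_of_affineSpan_eq_top P.full_dim
  have hN0 : N ≠ 0 := fun h => hN v hv v hv (h ▸ Submodule.zero_mem _)
  have hnhds := mem_interior_iff_mem_nhds.1 h0
  have hγ : 0 < gauge P.body N :=
    (gauge_pos (absorbent_nhds_zero hnhds)
      (NormedSpace.isVonNBounded_of_isBounded ℝ isCompact_body.isBounded)).2 hN0
  set γ := gauge P.body N
  set p := γ⁻¹ • N with hp
  have hgp : gauge P.body p = 1 := by
    rw [hp, gauge_smul_of_nonneg (by positivity), smul_eq_mul]
    exact inv_mul_cancel₀ hγ.ne'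
  have hpP : p ∈ P.body :=
    isCompact_body.isClosed.closure_eq ▸
      (gauge_le_one_iff_mem_closure P.convex_body hnhds).1 hgp.le
  have hpi : p ∉ interior P.body := fun h =>
    ((gauge_lt_one_iff_mem_interior P.convex_body hnhds).2 h).ne hgp
  have hNp : N = γ • p := by rw [hp, smul_smul, mul_inv_cancel₀ hγ.ne', one_smul]
  have hpspan : ∀ x ∈ P.V, ∀ y ∈ P.V, p ∉ Submodule.span ℝ {x, y} := fun x hx y hy h =>
    hN x hx y hy (hNp ▸ Submodule.smul_mem _ _ h)
  obtain ⟨f, hf0, hfp, hf⟩ := exists_support h0 hpi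
  set F := {x ∈ P.body | (f : E3 →ₗ[ℝ] ℝ) x = f p}
  have hFe : IsExtreme ℝ P.body F := isExtreme_levelSet _ hf
  have hFc : Convex ℝ F := convex_levelSet P.convex_body _ _
  have hpF : p ∈ F := ⟨hpP, rfl⟩
  have hlt : Module.finrank ℝ (vectorSpan ℝ F) < 3 :=
    finrank_vectorSpan_lt_of_levelSet (f := (f : E3 →ₗ[ℝ] ℝ))
      (fun h => hf0 (ContinuousLinearMap.coe_injective h)) fun x hx => hx.2
  have hge : 2 ≤ Module.finrank ℝ (vectorSpan ℝ F) := by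
    have hpV := (hFe.eq_convexHull_filter hFc).subset hpF
    obtain ⟨x, hx⟩ : (P.V.filter (· ∈ F)).Nonempty := by
      by_contra h
      rw [Finset.not_nonempty_iff_eq_empty] at h
      simp [h] at hpV
    rw [Finset.mem_filter] at hx
    obtain ⟨y, hy, hxy⟩ : ∃ y ∈ P.V.filter (· ∈ F), y ≠ x := by
      by_contra! h
      have : convexHull ℝ ((P.V.filter (· ∈ F) : Finset E3) : Set E3) ⊆ {x} :=
        convexHull_min (fun y hy => h y hy) (convex_singleton x)
      have := this hpV
      rw [Set.mem_singleton_iff] at this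
      exact hpspan x hx.1 x hx.1 (this ▸ Submodule.subset_span (by simp))
    rw [Finset.mem_filter] at hy
    by_contra! h
    have hle : Submodule.span ℝ {y - x} ≤ vectorSpan ℝ F := by
      rw [Submodule.span_singleton_le_iff_mem]
      exact vsub_mem_vectorSpan ℝ hy.2 hx.2
    have heq := Submodule.eq_of_le_of_finrank_le hle (by
      rw [finrank_span_singleton (sub_ne_zero.2 hxy)]; omega)
    have hpx : p - x ∈ vectorSpan ℝ F := vsub_mem_vectorSpan ℝ hpF hx.2
    rw [← heq] at hpx
    obtain ⟨r, hr⟩ := Submodule.mem_span_singleton.1 hpx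
    refine hpspan x hx.1 y hy.1 (Submodule.mem_span_pair.2 ⟨1 - r, r, ?_⟩)
    rw [eq_sub_iff_add_eq] at hr
    rw [← hr]
    module
  obtain ⟨t, ht, hFt⟩ := exists_mem_faces_of_isFaceDim
    (⟨⟨p, hpF⟩, hFc, hFe, by omega⟩ : IsFaceDim P.body F 2)
  refine ⟨t, ht, ?_⟩
  have hpt : p ∈ convexHull ℝ (t : Set E3) := hFt ▸ hpF
  obtain ⟨w, hw, hw1, hwp⟩ := Finset.mem_convexHull'.1 hpt
  refine ⟨fun x => γ * w x, fun x hx => mul_pos hγ ((hw x hx).lt_of_ne' fun hwx => ?_), ?_⟩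
  · obtain ⟨htV, htc, -⟩ := mem_faces.1 ht
    obtain ⟨y, z, hyz, he⟩ := Finset.card_eq_two.1
      (show (t.erase x).card = 2 by rw [Finset.card_erase_of_mem hx]; omega)
    rw [← Finset.add_sum_erase t _ hx, hwx, zero_smul, zero_add, he, Finset.sum_pair hyz] at hwp
    have hy : y ∈ t.erase x := by simp [he]
    have hz : z ∈ t.erase x := by simp [he]
    exact hpspan y (htV (Finset.mem_of_mem_erase hy)) z (htV (Finset.mem_of_mem_erase hz))
      (Submodule.mem_span_pair.2 ⟨_, _, hwp⟩)
  · simp only [mul_smul]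
    rw [← Finset.smul_sum, hwp, ← hNp]

theorem mem_of_nonneg_combination (h0 : (0 : E3) ∈ interior P.body) {v : E3} (hv : v ∈ P.V)
    {t : Finset E3} (ht : t ∈ P.faces) {w : E3 → ℝ} (hw : ∀ x ∈ t, 0 ≤ w x)
    (hwv : ∑ x ∈ t, w x • x = v) : v ∈ t := by
  have hv1 := P.on_sphere v hv
  have hσ : 0 < ∑ x ∈ t, w x := by
    refine (Finset.sum_nonneg hw).lt_of_ne' fun h => ?_
    have : v = 0 := by
      rw [← hwv]
      refine Finset.sum_eq_zero fun x hx => ?_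
      rw [(Finset.sum_eq_zero_iff_of_nonneg hw).1 h x hx, zero_smul]
    simp [this] at hv1
  have hq := smul_sum_mem_convexHull hw hσ
  rw [hwv] at hq
  set σ := ∑ x ∈ t, w x
  obtain ⟨ht1, ht2, ht3⟩ := mem_faces.1 ht
  have h1 : σ ≤ 1 := by
    by_contra! h
    exact notMem_interior_of_mem_face ht hq (smul_mem_interior h0 (P.subset_body hv)
      (by positivity) (inv_lt_one_of_one_lt₀ h))
  have h2 : 1 ≤ σ := by
    have := P.norm_le_one (ht3.2.2.1.subset hq)
    rw [norm_smul, hv1, mul_one, norm_inv, Real.norm_of_nonneg hσ.le] at this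
    exact (inv_le_one₀ hσ).1 this
  rw [le_antisymm h1 h2, inv_one, one_smul] at hq
  exact mem_of_mem_convexHull ht1 hv hq

theorem inCone_iff {t : Finset E3} {φ : E3 → (E3 →ₗ[ℝ] ℝ)} (hφ : ∀ N, ∑ x ∈ t, φ x N • x = N)
    (hφ' : ∀ w : E3 → ℝ, ∀ y ∈ t, φ y (∑ x ∈ t, w x • x) = w y) {N : E3} :
    InCone t N ↔ ∀ x ∈ t, 0 < φ x N := by
  refine ⟨?_, fun h => ⟨fun x => φ x N, h, hφ N⟩⟩
  rintro ⟨w, hw, rfl⟩ x hx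
  rw [hφ' w x hx]
  exact hw x hx

theorem inWedge_iff {t : Finset E3} {φ : E3 → (E3 →ₗ[ℝ] ℝ)} (hφ : ∀ N, ∑ x ∈ t, φ x N • x = N)
    (hφ' : ∀ w : E3 → ℝ, ∀ y ∈ t, φ y (∑ x ∈ t, w x • x) = w y) {v N : E3} :
    InWedge v t N ↔ ∀ x ∈ t, x ≠ v → 0 < φ x N := by
  refine ⟨?_, fun h => ⟨fun x => φ x N, h, hφ N⟩⟩
  rintro ⟨w, hw, rfl⟩ x hx hxv
  rw [hφ' w x hx]
  exact hw x hx hxv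

theorem coord_vertex {t : Finset E3} {φ : E3 → (E3 →ₗ[ℝ] ℝ)}
    (hφ' : ∀ w : E3 → ℝ, ∀ y ∈ t, φ y (∑ x ∈ t, w x • x) = w y) {v : E3} (hv : v ∈ t) :
    ∀ x ∈ t, φ x v = if x = v then 1 else 0 := fun x hx => by
  have := hφ' (fun x => if x = v then 1 else 0) x hx
  simpa [ite_smul, Finset.sum_ite_eq', hv] using this

theorem eventually_notMem_span {v N : E3} (hv : v ≠ 0)
    (hN : ∀ x ∈ P.V, N ∉ Submodule.span ℝ {x, v}) :
    ∀ᶠ ε : ℝ in nhdsWithin 0 (Set.Ioi 0),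
      ∀ x ∈ P.V, ∀ y ∈ P.V, v + ε • N ∉ Submodule.span ℝ {x, y} := by
  refine (P.V.eventually_all).2 fun x hx => (P.V.eventually_all).2 fun y hy => ?_
  by_cases hvs : v ∈ Submodule.span ℝ {x, y}
  · filter_upwards [self_mem_nhdsWithin] with ε hε hmem
    have hε : ε ≠ 0 := (Set.mem_Ioi.1 hε).ne'
    have hNs : N ∈ Submodule.span ℝ {x, y} := by
      have := Submodule.smul_mem _ ε⁻¹ (Submodule.sub_mem _ hmem hvs)
      rwa [add_sub_cancel_left, smul_smul, inv_mul_cancel₀ hε, one_smul] at this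
    obtain ⟨α, β, hαβ⟩ := Submodule.mem_span_pair.1 hvs
    obtain ⟨γ, δ, hγδ⟩ := Submodule.mem_span_pair.1 hNs
    by_cases hα : α = 0
    · have hβ : β ≠ 0 := by
        rintro rfl
        exact hv (by rw [← hαβ, hα]; simp)
      refine hN x hx (Submodule.mem_span_pair.2 ⟨γ - δ * α / β, δ / β, ?_⟩)
      rw [← hαβ, ← hγδ]
      match_scalars <;> field_simp
      ring
    · refine hN y hy (Submodule.mem_span_pair.2 ⟨δ - γ * β / α, γ / α, ?_⟩)
      rw [← hαβ, ← hγδ]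
      match_scalars <;> field_simp
      ring
  · have hc : Continuous fun ε : ℝ => v + ε • N := by fun_prop
    have ho : IsOpen ((Submodule.span ℝ {x, y} : Submodule ℝ E3) : Set E3)ᶜ :=
      (Submodule.closed_of_finiteDimensional _).isOpen_compl
    have := (hc.tendsto 0).eventually (ho.mem_nhds (by simpa using hvs))
    exact this.filter_mono nhdsWithin_le_nhds

theorem tendsto_affine (a b : ℝ) :
    Tendsto (fun ε : ℝ => a + ε * b) (nhdsWithin 0 (Set.Ioi 0)) (nhds a) := by
  have : Continuous fun ε : ℝ => a + ε * b := by fun_prop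
  simpa using (this.tendsto 0).mono_left nhdsWithin_le_nhds

theorem exists_inWedge (h0 : (0 : E3) ∈ interior P.body) {v : E3} (hv : v ∈ P.V) {N : E3}
    (hN : ∀ x ∈ P.V, N ∉ Submodule.span ℝ {x, v}) : ∃ t ∈ P.faces, v ∈ t ∧ InWedge v t N := by
  have hv0 : v ≠ 0 := fun h => by simpa [h] using P.on_sphere v hv
  obtain ⟨t, ht, hfreq⟩ : ∃ t ∈ P.faces, ∃ᶠ ε : ℝ in nhdsWithin 0 (Set.Ioi 0),
      InCone t (v + ε • N) := by
    by_contra! h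
    have h' := (P.faces.eventually_all (l := nhdsWithin (0 : ℝ) (Set.Ioi 0))).2
      h
    obtain ⟨ε, h1, h2⟩ := (h'.and (eventually_notMem_span hv0 hN)).exists
    obtain ⟨t, ht, hc⟩ := exists_inCone h0 h2
    exact h1 t ht hc
  obtain ⟨φ, hφ, hφ'⟩ := exists_coord h0 ht
  simp only [inCone_iff hφ hφ', map_add, map_smul, smul_eq_mul] at hfreq
  have hnn : ∀ x ∈ t, 0 ≤ φ x v := fun x hx => by
    by_contra! hneg
    have := (tendsto_affine (φ x v) (φ x N)).eventually (gt_mem_nhds hneg)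
    obtain ⟨ε, h1, h2⟩ := (hfreq.and_eventually this).exists
    exact lt_asymm (h1 x hx) h2
  have hvt := mem_of_nonneg_combination h0 hv ht hnn (hφ v)
  refine ⟨t, ht, hvt, (inWedge_iff hφ hφ').2 fun x hx hxv => ?_⟩
  obtain ⟨ε, h1, h2⟩ := (hfreq.and_eventually self_mem_nhdsWithin).exists
  have h3 := h1 x hx
  rw [coord_vertex hφ' hvt x hx, if_neg hxv, zero_add] at h3
  exact pos_of_mul_pos_right h3 (le_of_lt h2)

theorem eventually_inCone (h0 : (0 : E3) ∈ interior P.body) {v N : E3} {t : Finset E3}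
    (ht : t ∈ P.faces) (hvt : v ∈ t) (h : InWedge v t N) :
    ∀ᶠ ε : ℝ in nhdsWithin 0 (Set.Ioi 0), InCone t (v + ε • N) := by
  obtain ⟨φ, hφ, hφ'⟩ := exists_coord h0 ht
  rw [inWedge_iff hφ hφ'] at h
  simp only [inCone_iff hφ hφ', map_add, map_smul, smul_eq_mul]
  filter_upwards [self_mem_nhdsWithin,
    (tendsto_affine 1 (φ v N)).eventually (lt_mem_nhds one_pos)] with ε hε h1 x hx
  rw [coord_vertex hφ' hvt x hx]
  split_ifs with hxv
  · rwa [hxv]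
  · rw [zero_add]
    exact mul_pos hε (h x hx hxv)

theorem inWedge_unique (h0 : (0 : E3) ∈ interior P.body) {v N : E3} {s t : Finset E3}
    (hs : s ∈ P.faces) (ht : t ∈ P.faces) (hvs : v ∈ s) (hvt : v ∈ t) (hsN : InWedge v s N)
    (htN : InWedge v t N) : s = t := by
  obtain ⟨ε, h1, h2⟩ :=
    ((eventually_inCone h0 hs hvs hsN).and (eventually_inCone h0 ht hvt htN)).exists
  exact inCone_unique h0 hs ht h1 h2

/-- The faces around a vertex. -/
def star (P : InscribedTriPoly m) (v : E3) : Finset (Finset E3) :=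
  open Classical in P.faces.filter (v ∈ ·)

theorem mem_star {v : E3} {t : Finset E3} : t ∈ P.star v ↔ t ∈ P.faces ∧ v ∈ t := by
  simp [star]

open Classical in
theorem card_filter_inWedge (h0 : (0 : E3) ∈ interior P.body) {v : E3} (hv : v ∈ P.V) {N : E3}
    (hN : ∀ x ∈ P.V, N ∉ Submodule.span ℝ {x, v}) :
    ((P.star v).filter fun t => InWedge v t N).card = 1 := by
  obtain ⟨t, ht, hvt, htN⟩ := exists_inWedge h0 hv hN
  refine Finset.card_eq_one.2 ⟨t, ?_⟩
  ext s
  simp only [Finset.mem_filter, mem_star, Finset.mem_singleton]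
  constructor
  · rintro ⟨⟨hs, hvs⟩, hsN⟩
    exact inWedge_unique h0 hs ht hvs hvt hsN htN
  · rintro rfl
    exact ⟨⟨ht, hvt⟩, htN⟩

theorem exists_notMem_span (V : Finset E3) :
    ∃ N : E3, ∀ x ∈ V, ∀ y ∈ V, N ∉ Submodule.span ℝ {x, y} := by
  by_contra! h
  refine Subspace.biUnion_ne_univ_of_top_notMem (k := ℝ) (E := E3)
    (s := (V ×ˢ V).image fun p => Submodule.span ℝ {p.1, p.2}) ?_ ?_
  · intro htop
    obtain ⟨p, -, hp⟩ := Finset.mem_image.1 htop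
    have h1 := finrank_span_le_card (R := ℝ) ({p.1, p.2} : Set E3)
    rw [hp, finrank_top, finrank_euclideanSpace_fin] at h1
    have h2 : ({p.1, p.2} : Set E3).toFinset.card ≤ 2 := by
      classical
      rw [Set.toFinset_insert, Set.toFinset_singleton]
      exact Finset.card_le_two
    omega
  · refine Set.eq_univ_of_forall fun N => ?_
    obtain ⟨x, hx, y, hy, hN⟩ := h N
    exact Set.mem_biUnion (x := Submodule.span ℝ {x, y})
      (Finset.mem_image.2 ⟨(x, y), Finset.mem_product.2 ⟨hx, hy⟩, rfl⟩) hN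

open Classical in
theorem card_inWedge_add (h0 : (0 : E3) ∈ interior P.body) {t : Finset E3} (ht : t ∈ P.faces)
    {N : E3} (hN : ∀ x ∈ P.V, ∀ y ∈ P.V, N ∉ Submodule.span ℝ {x, y}) :
    (t.filter fun v => InWedge v t N).card + (t.filter fun v => InWedge v t (-N)).card =
      1 + 2 * (if InCone t N then 1 else 0) + 2 * (if InCone t (-N) then 1 else 0) := by
  obtain ⟨φ, hφ, hφ'⟩ := exists_coord h0 ht
  have hne : ∀ x ∈ t, φ x N ≠ 0 := fun x hx h => by
    obtain ⟨htV, htc, -⟩ := mem_faces.1 ht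
    obtain ⟨y, z, hyz, he⟩ := Finset.card_eq_two.1
      (show (t.erase x).card = 2 by rw [Finset.card_erase_of_mem hx]; omega)
    have hsum := hφ N
    rw [← Finset.add_sum_erase t _ hx, h, zero_smul, zero_add, he, Finset.sum_pair hyz] at hsum
    have hy : y ∈ t.erase x := by simp [he]
    have hz : z ∈ t.erase x := by simp [he]
    exact hN y (htV (Finset.mem_of_mem_erase hy)) z (htV (Finset.mem_of_mem_erase hz))
      (Submodule.mem_span_pair.2 ⟨_, _, hsum⟩)
  simp only [inWedge_iff hφ hφ', inCone_iff hφ hφ', map_neg, neg_pos]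
  obtain ⟨a, b, c, hab, hac, hbc, rfl⟩ := card_eq_three_of_mem_faces ht
  have ha := (hne a (by simp)).lt_or_gt
  have hb := (hne b (by simp)).lt_or_gt
  have hc := (hne c (by simp)).lt_or_gt
  simp only [Finset.card_filter]
  simp only [Finset.sum_insert (show a ∉ ({b, c} : Finset E3) by simp [hab, hac]),
    Finset.sum_pair hbc]
  simp only [Finset.mem_insert, Finset.mem_singleton, forall_eq_or_imp, forall_eq, hab, hac, hbc,
    hab.symm, hac.symm, hbc.symm, ne_eq, not_true_eq_false, not_false_eq_true, false_imp_iff,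
    true_imp_iff, true_and, and_true]
  rcases ha with ha | ha <;> rcases hb with hb | hb <;> rcases hc with hc | hc <;>
    simp [ha, hb, hc, ha.not_gt, hb.not_gt, hc.not_gt]

theorem two_mul_card (h0 : (0 : E3) ∈ interior P.body) : 2 * P.V.card = m + 4 := by
  classical
  obtain ⟨N, hN⟩ := exists_notMem_span P.V
  have hN' : ∀ x ∈ P.V, ∀ y ∈ P.V, -N ∉ Submodule.span ℝ {x, y} := fun x hx y hy h =>
    hN x hx y hy ((Submodule.neg_mem_iff _).1 h)
  have key : ∀ M : E3, (∀ x ∈ P.V, ∀ y ∈ P.V, M ∉ Submodule.span ℝ {x, y}) →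
      ∑ t ∈ P.faces, (t.filter fun v => InWedge v t M).card = P.V.card := fun M hM => by
    calc ∑ t ∈ P.faces, (t.filter fun v => InWedge v t M).card
        = ∑ t ∈ P.faces, (P.V.filter fun v => v ∈ t ∧ InWedge v t M).card := by
          refine Finset.sum_congr rfl fun t ht => congrArg _ ?_
          ext v
          simp only [Finset.mem_filter]
          exact ⟨fun h => ⟨(mem_faces.1 ht).1 h.1, h⟩, fun h => h.2⟩
      _ = ∑ v ∈ P.V, (P.faces.filter fun t => v ∈ t ∧ InWedge v t M).card :=
          Finset.sum_card_bipartiteAbove_eq_sum_card_bipartiteBelow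
            (r := fun t v => v ∈ t ∧ InWedge v t M)
      _ = ∑ v ∈ P.V, 1 := by
          refine Finset.sum_congr rfl fun v hv => ?_
          rw [← card_filter_inWedge h0 hv fun x hx => hM x hx v hv]
          congr 1
          ext t
          simp [mem_star, and_assoc]
      _ = P.V.card := by simp
  have cone : ∀ M : E3, (∀ x ∈ P.V, ∀ y ∈ P.V, M ∉ Submodule.span ℝ {x, y}) →
      ∑ t ∈ P.faces, (if InCone t M then 1 else 0) = 1 := fun M hM => by
    obtain ⟨t, ht, htM⟩ := exists_inCone h0 hM
    rw [Finset.sum_eq_single_of_mem t ht fun s hs hst =>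
      if_neg fun h => hst (inCone_unique h0 hs ht h htM), if_pos htM]
  have h := Finset.sum_congr rfl fun t ht => card_inWedge_add h0 (t := t) ht hN
  simp only [Finset.sum_add_distrib, ← Finset.mul_sum, key N hN, key _ hN', cone N hN,
    cone _ hN', Finset.sum_const, P.faces_card] at h
  simp at h
  omega

theorem star_nonempty (h0 : (0 : E3) ∈ interior P.body) {v : E3} (hv : v ∈ P.V) :
    (P.star v).Nonempty := by
  obtain ⟨N, hN⟩ := exists_notMem_span P.V
  obtain ⟨t, ht, hvt, -⟩ := exists_inWedge h0 hv fun x hx => hN x hx v hv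
  exact ⟨t, mem_star.2 ⟨ht, hvt⟩⟩

theorem sum_card_star : ∑ v ∈ P.V, (P.star v).card = 3 * m := by
  classical
  have h : ∑ t ∈ P.faces, (P.V.filter fun v => v ∈ t).card =
      ∑ v ∈ P.V, (P.faces.filter fun t => v ∈ t).card :=
    Finset.sum_card_bipartiteAbove_eq_sum_card_bipartiteBelow (r := fun t v => v ∈ t)
  calc ∑ v ∈ P.V, (P.star v).card = ∑ t ∈ P.faces, (P.V.filter fun v => v ∈ t).card := by
        rw [h]
        refine Finset.sum_congr rfl fun v _ => congrArg _ ?_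
        ext t
        simp [mem_star]
    _ = ∑ t ∈ P.faces, 3 := by
        refine Finset.sum_congr rfl fun t ht => ?_
        refine Eq.trans (congrArg Finset.card ?_) (mem_faces.1 ht).2.1
        ext v
        simp only [Finset.mem_filter]
        exact ⟨fun h => h.2, fun h => ⟨(mem_faces.1 ht).1 h, h⟩⟩
    _ = 3 * m := by rw [Finset.sum_const, P.faces_card, smul_eq_mul, mul_comm]

end InscribedTriPoly

/-- The angle opposite to the side with cosine `z` in a spherical triangle with sides whose
cosines are `x`, `y`, `z`. -/
def cornerAngle (x y z : ℝ) : ℝ :=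
  Real.arccos ((z - x * y) / (√(1 - x ^ 2) * √(1 - y ^ 2)))

/-- The point at angle `θ` on the unit circle with axes `e₁`, `e₂`. -/
def circlePoint (e₁ e₂ : E3) (θ : ℝ) : E3 := Real.cos θ • e₁ + Real.sin θ • e₂

theorem intervalIntegrable_wedge (β A a b : ℝ) :
    IntervalIntegrable (fun θ => open Classical in
      if 0 < Real.sin (θ - β) ∧ 0 < Real.sin (β + A - θ) then (1 : ℝ) else 0)
      MeasureTheory.volume a b := by
  classical
  have hm : MeasurableSet {θ : ℝ | 0 < Real.sin (θ - β) ∧ 0 < Real.sin (β + A - θ)} :=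
    MeasurableSet.inter (s₁ := {θ | 0 < Real.sin (θ - β)}) (s₂ := {θ | 0 < Real.sin (β + A - θ)})
      (measurableSet_lt measurable_const (by fun_prop))
      (measurableSet_lt measurable_const (by fun_prop))
  refine (intervalIntegrable_const (c := (1 : ℝ))).mono_fun
    (Measurable.ite hm measurable_const measurable_const).aestronglyMeasurable
    (Eventually.of_forall fun θ => ?_)
  dsimp only
  split_ifs <;> simp

theorem integral_wedge {A : ℝ} (β : ℝ) (hA : 0 < A) (hAπ : A < π) :
    ∫ θ in (0 : ℝ)..(2 * π), (open Classical in
      if 0 < Real.sin (θ - β) ∧ 0 < Real.sin (β + A - θ) then (1 : ℝ) else 0) = A := by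
  classical
  set f : ℝ → ℝ := fun θ => if 0 < Real.sin (θ - β) ∧ 0 < Real.sin (β + A - θ) then (1 : ℝ) else 0
  have hper : Function.Periodic f (2 * π) := fun θ => by
    have h1 : θ + 2 * π - β = θ - β + 2 * π := by ring
    have h2 : β + A - (θ + 2 * π) = β + A - θ - 2 * π := by ring
    simp only [f, h1, h2, Real.sin_add_two_pi, Real.sin_sub_two_pi]
  have h1 := hper.intervalIntegral_add_eq 0 β
  rw [zero_add] at h1
  have h2 : ∫ θ in β..β + 2 * π, f θ = ∫ θ in β..β + 2 * π, (Set.Ioo β (β + A)).indicator 1 θ := by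
    refine intervalIntegral.integral_congr_uIoo fun θ hθ => ?_
    rw [Set.uIoo_of_le (by linarith), Set.mem_Ioo] at hθ
    by_cases h : θ < β + A
    · have hs1 : 0 < Real.sin (θ - β) := Real.sin_pos_of_pos_of_lt_pi (by linarith) (by linarith)
      have hs2 : 0 < Real.sin (β + A - θ) :=
        Real.sin_pos_of_pos_of_lt_pi (by linarith) (by linarith)
      have hmem : θ ∈ Set.Ioo β (β + A) := ⟨hθ.1, h⟩
      simp [f, hs1, hs2, hmem]
    · have hmem : θ ∉ Set.Ioo β (β + A) := fun h' => h h'.2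
      have : ¬(0 < Real.sin (θ - β) ∧ 0 < Real.sin (β + A - θ)) := by
        rintro ⟨hs1, hs2⟩
        have h3 : θ - β < π := by
          by_contra! h4
          have := Real.sin_nonpos_of_nonpos_of_neg_pi_le (x := θ - β - 2 * π) (by linarith)
            (by linarith)
          rw [Real.sin_sub_two_pi] at this
          linarith
        have := Real.sin_nonpos_of_nonpos_of_neg_pi_le (x := β + A - θ) (by linarith) (by linarith)
        linarith
      simp [f, this, hmem]
  rw [h1, h2, intervalIntegral.integral_of_le (by linarith [Real.pi_pos]),
    MeasureTheory.setIntegral_indicator measurableSet_Ioo]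
  have h3 : Set.Ioc β (β + 2 * π) ∩ Set.Ioo β (β + A) = Set.Ioo β (β + A) :=
    Set.inter_eq_right.2 fun x hx => ⟨hx.1, by linarith [hx.2, Real.pi_pos]⟩
  rw [h3]
  simp [hA.le]

/-- `v`, `e₁`, `e₂` are orthonormal. -/
structure IsFrame (v e₁ e₂ : E3) : Prop where
  norm_axis : ‖v‖ = 1
  norm_fst : ‖e₁‖ = 1
  norm_snd : ‖e₂‖ = 1
  inner_fst_snd : ⟪e₁, e₂⟫ = 0
  inner_axis_fst : ⟪v, e₁⟫ = 0
  inner_axis_snd : ⟪v, e₂⟫ = 0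
  sum_repr : ∀ x, x = ⟪v, x⟫ • v + ⟪e₁, x⟫ • e₁ + ⟪e₂, x⟫ • e₂

theorem exists_isFrame {v : E3} (hv : ‖v‖ = 1) : ∃ e₁ e₂ : E3, IsFrame v e₁ e₂ := by
  have hon : Orthonormal ℝ (({0} : Set (Fin 3)).domRestrict fun _ => v) :=
    ⟨fun _ => hv, fun i j hij => absurd (Subsingleton.elim i j) hij⟩
  obtain ⟨b, hb⟩ := hon.exists_orthonormalBasis_extension_of_card_eq (by simp)
  have hb0 : b 0 = v := hb 0 rfl
  refine ⟨b 1, b 2, hv, b.orthonormal.1 1, b.orthonormal.1 2, b.orthonormal.2 (by decide),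
    hb0 ▸ b.orthonormal.2 (by decide), hb0 ▸ b.orthonormal.2 (by decide), fun x => ?_⟩
  have := b.sum_repr' x
  rw [Fin.sum_univ_three, hb0] at this
  exact this.symm

namespace IsFrame

variable {v e₁ e₂ : E3}

theorem inner_circlePoint (hf : IsFrame v e₁ e₂) (β γ : ℝ) :
    ⟪circlePoint e₁ e₂ β, circlePoint e₁ e₂ γ⟫ = Real.cos (γ - β) := by
  have h₂₁ : ⟪e₂, e₁⟫ = 0 := by rw [real_inner_comm, hf.inner_fst_snd]
  simp only [circlePoint, inner_add_left, inner_add_right, real_inner_smul_left,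
    real_inner_smul_right, real_inner_self_eq_norm_sq, hf.norm_fst, hf.norm_snd, hf.inner_fst_snd,
    h₂₁, Real.cos_sub]
  ring

theorem inner_axis_circlePoint (hf : IsFrame v e₁ e₂) (β : ℝ) : ⟪v, circlePoint e₁ e₂ β⟫ = 0 := by
  simp only [circlePoint, inner_add_right, real_inner_smul_right, hf.inner_axis_fst,
    hf.inner_axis_snd]
  ring

theorem exists_eq_smul_circlePoint (hf : IsFrame v e₁ e₂) (b : E3) :
    ∃ r β : ℝ, 0 ≤ r ∧ b = ⟪v, b⟫ • v + r • circlePoint e₁ e₂ β := by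
  set z : ℂ := ⟨⟪e₁, b⟫, ⟪e₂, b⟫⟩
  refine ⟨‖z‖, z.arg, norm_nonneg _, ?_⟩
  conv_lhs => rw [hf.sum_repr b]
  rw [circlePoint, smul_add, smul_smul, smul_smul, Complex.norm_mul_cos_arg,
    Complex.norm_mul_sin_arg, add_assoc]

theorem inner_combination (hf : IsFrame v e₁ e₂) (p q r s β γ : ℝ) :
    ⟪p • v + r • circlePoint e₁ e₂ β, q • v + s • circlePoint e₁ e₂ γ⟫ =
      p * q + r * s * Real.cos (γ - β) := by
  have h := hf.inner_axis_circlePoint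
  have h' : ∀ β, ⟪circlePoint e₁ e₂ β, v⟫ = 0 := fun β => by rw [real_inner_comm, h]
  simp only [inner_add_left, inner_add_right, real_inner_smul_left, real_inner_smul_right,
    hf.inner_circlePoint, h, h', real_inner_self_eq_norm_sq, hf.norm_axis]
  ring

theorem combination_eq_zero (hf : IsFrame v e₁ e₂) {p q r : ℝ} (h : p • v + q • e₁ + r • e₂ = 0) :
    p = 0 ∧ q = 0 ∧ r = 0 := by
  have h₂₁ : ⟪e₂, e₁⟫ = 0 := by rw [real_inner_comm, hf.inner_fst_snd]
  have h₁v : ⟪e₁, v⟫ = 0 := by rw [real_inner_comm, hf.inner_axis_fst]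
  have h₂v : ⟪e₂, v⟫ = 0 := by rw [real_inner_comm, hf.inner_axis_snd]
  have key : ∀ x, ⟪x, p • v + q • e₁ + r • e₂⟫ = 0 := fun x => by rw [h, inner_zero_right]
  have k1 := key v
  have k2 := key e₁
  have k3 := key e₂
  simp only [inner_add_right, real_inner_smul_right, real_inner_self_eq_norm_sq, hf.norm_axis,
    hf.norm_fst, hf.norm_snd, hf.inner_axis_fst, hf.inner_axis_snd, hf.inner_fst_snd, h₂₁, h₁v, h₂v]
    at k1 k2 k3
  exact ⟨by linarith, by linarith, by linarith⟩

theorem exists_wedge_iff (hf : IsFrame v e₁ e₂) {p q r s β A : ℝ} (hr : 0 < r)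
    (hs : 0 < s) (hA : 0 < Real.sin A)
    (θ : ℝ) :
    (∃ α x y : ℝ, 0 < x ∧ 0 < y ∧ α • v + (x • (p • v + r • circlePoint e₁ e₂ β) +
      y • (q • v + s • circlePoint e₁ e₂ (β + A))) = circlePoint e₁ e₂ θ) ↔
    0 < Real.sin (θ - β) ∧ 0 < Real.sin (β + A - θ) := by
  have hcs := Real.sin_sq_add_cos_sq β
  have hcsA := Real.sin_sq_add_cos_sq A
  have e1 : Real.sin (β + A - θ) =
      Real.sin (β + A) * Real.cos θ - Real.cos (β + A) * Real.sin θ := Real.sin_sub _ _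
  have e2 : Real.sin (θ - β) = Real.sin θ * Real.cos β - Real.cos θ * Real.sin β := Real.sin_sub _ _
  have e3 : Real.sin A =
      Real.sin (β + A) * Real.cos β - Real.cos (β + A) * Real.sin β := by
    rw [← Real.sin_sub]; congr 1; ring
  constructor
  · rintro ⟨α, x, y, hx, hy, h⟩
    rw [← sub_eq_zero] at h
    obtain ⟨-, h1, h2⟩ := hf.combination_eq_zero (p := α + x * p + y * q)
      (q := x * r * Real.cos β + y * s * Real.cos (β + A) - Real.cos θ)
      (r := x * r * Real.sin β + y * s * Real.sin (β + A) - Real.sin θ) (by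
        rw [← h]
        simp only [circlePoint]
        module)
    rw [sub_eq_zero] at h1 h2
    have h3 : Real.sin (θ - β) = y * s * Real.sin A := by
      rw [e2, e3, ← h1, ← h2]; ring
    have h4 : Real.sin (β + A - θ) = x * r * Real.sin A := by
      rw [e1, e3, ← h1, ← h2]; ring
    rw [h3, h4]
    exact ⟨by positivity, by positivity⟩
  · rintro ⟨h1, h2⟩
    set x := Real.sin (β + A - θ) / (r * Real.sin A) with hx
    set y := Real.sin (θ - β) / (s * Real.sin A) with hy
    have hxr : x * r * Real.sin A = Real.sin (β + A - θ) := by rw [hx]; field_simp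
    have hys : y * s * Real.sin A = Real.sin (θ - β) := by rw [hy]; field_simp
    refine ⟨-(x * p) - y * q, x, y, by positivity, by positivity, ?_⟩
    have h3 : x * r * Real.cos β + y * s * Real.cos (β + A) = Real.cos θ := by
      refine mul_right_cancel₀ hA.ne' ?_
      calc _ = (x * r * Real.sin A) * Real.cos β + (y * s * Real.sin A) * Real.cos (β + A) := by
            ring
        _ = _ := by rw [hxr, hys, e1, e2, e3]; ring
    have h4 : x * r * Real.sin β + y * s * Real.sin (β + A) = Real.sin θ := by
      refine mul_right_cancel₀ hA.ne' ?_
      calc _ = (x * r * Real.sin A) * Real.sin β + (y * s * Real.sin A) * Real.sin (β + A) := by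
            ring
        _ = _ := by rw [hxr, hys, e1, e2, e3]; ring
    simp only [circlePoint]
    rw [← h3, ← h4]
    module

end IsFrame

theorem inWedge_triple {v b c N : E3} (hvb : v ≠ b) (hvc : v ≠ c) (hbc : b ≠ c) :
    InWedge v {v, b, c} N ↔
      ∃ α x y : ℝ, 0 < x ∧ 0 < y ∧ α • v + (x • b + y • c) = N := by
  have hs : ∀ w : E3 → ℝ, ∑ x ∈ ({v, b, c} : Finset E3), w x • x = w v • v + (w b • b + w c • c) :=
    fun w => by rw [Finset.sum_insert (by simp [hvb, hvc]), Finset.sum_pair hbc]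
  constructor
  · rintro ⟨w, hw, h⟩
    exact ⟨w v, w b, w c, hw b (by simp) hvb.symm, hw c (by simp) hvc.symm, by rw [← hs, h]⟩
  · rintro ⟨α, x, y, hx, hy, h⟩
    refine ⟨fun u => if u = v then α else if u = b then x else y, ?_, ?_⟩
    · intro u hu huv
      simp only [huv, if_false]
      split_ifs <;> assumption
    · rw [hs]
      simpa [hvb.symm, hvc.symm, hbc.symm] using h

namespace IsFrame

variable {v e₁ e₂ : E3}

theorem exists_wedge_angle (hf : IsFrame v e₁ e₂) {b c : E3} (hb : ‖b‖ = 1) (hc : ‖c‖ = 1)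
    (hli : LinearIndependent ℝ ![v, b, c]) :
    ∃ β, 0 < cornerAngle ⟪v, b⟫ ⟪v, c⟫ ⟪b, c⟫ ∧ cornerAngle ⟪v, b⟫ ⟪v, c⟫ ⟪b, c⟫ < π ∧
      ∀ θ, InWedge v {v, b, c} (circlePoint e₁ e₂ θ) ↔
        0 < Real.sin (θ - β) ∧
          0 < Real.sin (β + cornerAngle ⟪v, b⟫ ⟪v, c⟫ ⟪b, c⟫ - θ) := by
  have hvb : v ≠ b := hli.injective.ne (show (0 : Fin 3) ≠ 1 by decide)
  have hvc : v ≠ c := hli.injective.ne (show (0 : Fin 3) ≠ 2 by decide)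
  have hbc : b ≠ c := hli.injective.ne (show (1 : Fin 3) ≠ 2 by decide)
  have hli' : ∀ x y z : ℝ, x • v + y • b + z • c = 0 → x = 0 ∧ y = 0 ∧ z = 0 := fun x y z h => by
    have := Fintype.linearIndependent_iff.1 hli ![x, y, z] (by simpa [Fin.sum_univ_three] using h)
    exact ⟨this 0, this 1, this 2⟩
  obtain ⟨r, β, hr, hbr⟩ := hf.exists_eq_smul_circlePoint b
  obtain ⟨s, γ, hs, hcs⟩ := hf.exists_eq_smul_circlePoint c
  have hbb : ⟪b, b⟫ = 1 := by rw [real_inner_self_eq_norm_sq, hb]; norm_num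
  have hcc : ⟪c, c⟫ = 1 := by rw [real_inner_self_eq_norm_sq, hc]; norm_num
  have hz : ⟪b, c⟫ = ⟪v, b⟫ * ⟪v, c⟫ + r * s * Real.cos (γ - β) := by
    conv_lhs => rw [hbr, hcs]
    exact hf.inner_combination _ _ _ _ _ _
  have hb2 : 1 = ⟪v, b⟫ * ⟪v, b⟫ + r * r * Real.cos (β - β) := by
    rw [← hf.inner_combination, ← hbr, hbb]
  have hc2 : 1 = ⟪v, c⟫ * ⟪v, c⟫ + s * s * Real.cos (γ - γ) := by
    rw [← hf.inner_combination, ← hcs, hcc]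
  rw [sub_self, Real.cos_zero] at hb2 hc2
  rw [cornerAngle, hz]
  set p := ⟪v, b⟫
  set q := ⟪v, c⟫
  have hr' : √(1 - p ^ 2) = r := by
    rw [show 1 - p ^ 2 = r ^ 2 by linarith, Real.sqrt_sq hr]
  have hs' : √(1 - q ^ 2) = s := by
    rw [show 1 - q ^ 2 = s ^ 2 by linarith, Real.sqrt_sq hs]
  have hr0 : 0 < r := hr.lt_of_ne fun h => by
    have := (hli' p (-1) 0 (by rw [hbr, ← h]; module)).2.1
    norm_num at this
  have hs0 : 0 < s := hs.lt_of_ne fun h => by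
    have := (hli' q 0 (-1) (by rw [hcs, ← h]; module)).2.2
    norm_num at this
  have hsin : Real.sin (γ - β) ≠ 0 := fun h => by
    have e1 : Real.cos γ = Real.cos (γ - β) * Real.cos β := by
      have := Real.cos_add (γ - β) β
      rw [h] at this
      simpa using this
    have e2 : Real.sin γ = Real.cos (γ - β) * Real.sin β := by
      have := Real.sin_add (γ - β) β
      rw [h] at this
      simpa using this
    have := (hli' (s * Real.cos (γ - β) * p - r * q) (-(s * Real.cos (γ - β))) r (by
      rw [hbr, hcs, circlePoint, circlePoint, e1, e2]
      module)).2.2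
    exact hr0.ne' this
  rw [hr', hs', add_sub_cancel_left, mul_div_cancel_left₀ _ (by positivity)]
  set A := Real.arccos (Real.cos (γ - β))
  have hcosA : Real.cos A = Real.cos (γ - β) :=
    Real.cos_arccos (Real.neg_one_le_cos _) (Real.cos_le_one _)
  have hsinA : 0 < Real.sin A := by
    refine (Real.sin_nonneg_of_nonneg_of_le_pi (Real.arccos_nonneg _)
      (Real.arccos_le_pi _)).lt_of_ne' fun h => hsin ?_
    have h1 := Real.sin_sq_add_cos_sq A
    have h2 := Real.sin_sq_add_cos_sq (γ - β)
    rw [h, hcosA] at h1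
    exact pow_eq_zero_iff two_ne_zero |>.1 (by linarith)
  have hA0 : 0 < A := (Real.arccos_nonneg _).lt_of_ne fun h => by
    have : A = 0 := h.symm
    simp [this] at hsinA
  have hAπ : A < π := (Real.arccos_le_pi _).lt_of_ne fun h => by
    have : A = π := h
    simp [this] at hsinA
  have hperiod : ∀ (k : ℤ) (x : ℝ), circlePoint e₁ e₂ (2 * k * π + x) = circlePoint e₁ e₂ x := by
    intro k x
    rw [circlePoint, circlePoint, show 2 * k * π + x = x + k * (2 * π) by ring,
      Real.cos_add_int_mul_two_pi, Real.sin_add_int_mul_two_pi]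
  obtain ⟨k, hk | hk⟩ := Real.cos_eq_cos_iff.1 hcosA
  · refine ⟨β, hA0, hAπ, fun θ => ?_⟩
    rw [inWedge_triple hvb hvc hbc, hbr, hcs, show γ = 2 * k * π + (β + A) by linarith, hperiod]
    exact hf.exists_wedge_iff hr0 hs0 hsinA θ
  · refine ⟨β - A, hA0, hAπ, fun θ => ?_⟩
    rw [inWedge_triple hvb hvc hbc, hbr, hcs, show γ = 2 * k * π + (β - A) by linarith, hperiod,
      ← hf.exists_wedge_iff hs0 hr0 hsinA θ]
    simp only [sub_add_cancel]
    constructor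
    · rintro ⟨α, x, y, hx, hy, h⟩
      exact ⟨α, y, x, hy, hx, by rw [← h, add_comm (y • _)]⟩
    · rintro ⟨α, x, y, hx, hy, h⟩
      exact ⟨α, y, x, hy, hx, by rw [← h, add_comm (y • _)]⟩

theorem countable_circlePoint_mem_span (hf : IsFrame v e₁ e₂) (x : E3) :
    {θ | circlePoint e₁ e₂ θ ∈ Submodule.span ℝ {x, v}}.Countable := by
  obtain ⟨r, β, hr, hxr⟩ := hf.exists_eq_smul_circlePoint x
  refine (Set.countable_range fun n : ℤ => n * π + β).mono fun θ hθ => ?_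
  obtain ⟨a, b, hab⟩ := Submodule.mem_span_pair.1 hθ
  rw [hxr, ← sub_eq_zero] at hab
  obtain ⟨-, h1, h2⟩ := hf.combination_eq_zero (p := a * ⟪v, x⟫ + b)
    (q := a * r * Real.cos β - Real.cos θ) (r := a * r * Real.sin β - Real.sin θ) (by
      rw [← hab]
      simp only [circlePoint]
      module)
  have : Real.sin (θ - β) = 0 := by
    rw [Real.sin_sub, ← sub_eq_zero.1 h1, ← sub_eq_zero.1 h2]; ring
  obtain ⟨n, hn⟩ := Real.sin_eq_zero_iff.1 this
  exact ⟨n, by dsimp only; linarith⟩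

end IsFrame

namespace InscribedTriPoly

variable {m : ℕ} {P : InscribedTriPoly m}

theorem exists_eq_insert_of_mem {v : E3} {t : Finset E3} (ht : t ∈ P.faces) (hvt : v ∈ t) :
    ∃ b c, v ≠ b ∧ v ≠ c ∧ b ≠ c ∧ t = {v, b, c} := by
  classical
  obtain ⟨b, c, hbc, he⟩ := Finset.card_eq_two.1
    (show (t.erase v).card = 2 by rw [Finset.card_erase_of_mem hvt, (mem_faces.1 ht).2.1])
  have hb : b ∈ t.erase v := by simp [he]
  have hc : c ∈ t.erase v := by simp [he]
  exact ⟨b, c, (Finset.ne_of_mem_erase hb).symm, (Finset.ne_of_mem_erase hc).symm, hbc, by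
    rw [← Finset.insert_erase hvt, he]⟩

/-- The angles of the faces at a vertex add up to `2π`. -/
theorem exists_angle (h0 : (0 : E3) ∈ interior P.body) :
    ∃ A : E3 → Finset E3 → ℝ,
      (∀ v b c, v ≠ b → v ≠ c → b ≠ c → {v, b, c} ∈ P.faces →
        A v {v, b, c} = cornerAngle ⟪v, b⟫ ⟪v, c⟫ ⟪b, c⟫) ∧
      ∀ v ∈ P.V, ∑ t ∈ P.star v, A v t = 2 * π := by
  classical
  have hframe : ∀ v : E3, ∃ e₁ e₂ : E3, v ∈ P.V → IsFrame v e₁ e₂ := fun v => by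
    by_cases hv : v ∈ P.V
    · obtain ⟨e₁, e₂, h⟩ := exists_isFrame (P.on_sphere v hv)
      exact ⟨e₁, e₂, fun _ => h⟩
    · exact ⟨0, 0, fun h => absurd h hv⟩
  choose e₁ e₂ hf using hframe
  have hwedge : ∀ v b c, v ≠ b → v ≠ c → b ≠ c → {v, b, c} ∈ P.faces →
      ∃ β, 0 < cornerAngle ⟪v, b⟫ ⟪v, c⟫ ⟪b, c⟫ ∧ cornerAngle ⟪v, b⟫ ⟪v, c⟫ ⟪b, c⟫ < π ∧
      ∀ θ, InWedge v {v, b, c} (circlePoint (e₁ v) (e₂ v) θ) ↔ 0 < Real.sin (θ - β) ∧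
          0 < Real.sin (β + cornerAngle ⟪v, b⟫ ⟪v, c⟫ ⟪b, c⟫ - θ) := by
    intro v b c hvb hvc hbc ht
    have hsub := (mem_faces.1 ht).1
    exact (hf v (hsub (by simp))).exists_wedge_angle (P.on_sphere b (hsub (by simp)))
      (P.on_sphere c (hsub (by simp))) (linearIndependent_of_mem_faces h0 ht hvb hvc hbc)
  refine ⟨fun v t => ∫ θ in (0 : ℝ)..(2 * π),
    if InWedge v t (circlePoint (e₁ v) (e₂ v) θ) then (1 : ℝ) else 0, ?_, ?_⟩
  · intro v b c hvb hvc hbc ht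
    obtain ⟨β, hA0, hAπ, hβ⟩ := hwedge v b c hvb hvc hbc ht
    simp only [hβ]
    exact integral_wedge β hA0 hAπ
  · intro v hv
    have hint : ∀ t ∈ P.star v, IntervalIntegrable
        (fun θ => if InWedge v t (circlePoint (e₁ v) (e₂ v) θ) then (1 : ℝ) else 0)
        MeasureTheory.volume 0 (2 * π) := by
      intro t ht
      obtain ⟨htf, hvt⟩ := mem_star.1 ht
      obtain ⟨b, c, hvb, hvc, hbc, rfl⟩ := exists_eq_insert_of_mem htf hvt
      obtain ⟨β, -, -, hβ⟩ := hwedge v b c hvb hvc hbc htf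
      simp only [hβ]
      exact intervalIntegrable_wedge _ _ _ _
    rw [← intervalIntegral.integral_finsetSum hint]
    have hgen : (⋃ x ∈ P.V, {θ | circlePoint (e₁ v) (e₂ v) θ ∈
        Submodule.span ℝ {x, v}}).Countable :=
      P.V.countable_toSet.biUnion fun x _ => (hf v hv).countable_circlePoint_mem_span x
    have hae : ∀ᵐ θ : ℝ, θ ∉ ⋃ x ∈ P.V, {θ | circlePoint (e₁ v) (e₂ v) θ ∈
        Submodule.span ℝ {x, v}} := hgen.ae_notMem _
    rw [intervalIntegral.integral_congr_ae (g := fun _ => (1 : ℝ))]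
    · simp
    · filter_upwards [hae] with θ hθ _
      simp only [Set.mem_iUnion, not_exists] at hθ
      have := card_filter_inWedge h0 hv hθ
      rw [Finset.sum_boole]
      exact_mod_cast this

end InscribedTriPoly

section Trigonometry

variable {x y z D : ℝ}

theorem cos_sin_cornerAngle (hx : x ^ 2 < 1) (hy : y ^ 2 < 1) (hD : 0 ≤ D)
    (hD2 : D ^ 2 = 1 - x ^ 2 - y ^ 2 - z ^ 2 + 2 * x * y * z) :
    Real.cos (cornerAngle x y z) = (z - x * y) / (√(1 - x ^ 2) * √(1 - y ^ 2)) ∧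
      Real.sin (cornerAngle x y z) = D / (√(1 - x ^ 2) * √(1 - y ^ 2)) := by
  have ha : 0 < √(1 - x ^ 2) := Real.sqrt_pos.2 (by linarith)
  have hb : 0 < √(1 - y ^ 2) := Real.sqrt_pos.2 (by linarith)
  have ha2 : √(1 - x ^ 2) ^ 2 = 1 - x ^ 2 := Real.sq_sqrt (by linarith)
  have hb2 : √(1 - y ^ 2) ^ 2 = 1 - y ^ 2 := Real.sq_sqrt (by linarith)
  rw [cornerAngle]
  set a := √(1 - x ^ 2)
  set b := √(1 - y ^ 2)
  have h : 1 - ((z - x * y) / (a * b)) ^ 2 = (D / (a * b)) ^ 2 := by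
    rw [div_pow, div_pow, mul_pow, ha2, hb2, hD2]
    field_simp [show 1 - x ^ 2 ≠ 0 by linarith, show 1 - y ^ 2 ≠ 0 by linarith]
    ring
  have hle : ((z - x * y) / (a * b)) ^ 2 ≤ 1 := by nlinarith [sq_nonneg (D / (a * b))]
  rw [sq_le_one_iff_abs_le_one, abs_le] at hle
  exact ⟨Real.cos_arccos hle.1 hle.2, by rw [Real.sin_arccos, h, Real.sqrt_sq (by positivity)]⟩

/-- The area of a spherical triangle in terms of the cosines of its sides. -/
theorem sum_cornerAngle (hx : x ^ 2 < 1) (hy : y ^ 2 < 1) (hz : z ^ 2 < 1) (hD : 0 < D)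
    (hD2 : D ^ 2 = 1 - x ^ 2 - y ^ 2 - z ^ 2 + 2 * x * y * z) (hS : 0 < 1 + x + y + z) :
    cornerAngle x y z + cornerAngle x z y + cornerAngle y z x =
      π + 2 * Real.arctan (D / (1 + x + y + z)) := by
  obtain ⟨cA, sA⟩ := cos_sin_cornerAngle (z := z) hx hy hD.le hD2
  obtain ⟨cB, sB⟩ := cos_sin_cornerAngle (z := y) hx hz hD.le (by rw [hD2]; ring)
  obtain ⟨cC, sC⟩ := cos_sin_cornerAngle (z := x) hy hz hD.le (by rw [hD2]; ring)
  have hA0 := Real.arccos_nonneg ((z - x * y) / (√(1 - x ^ 2) * √(1 - y ^ 2)))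
  have hB0 := Real.arccos_nonneg ((y - x * z) / (√(1 - x ^ 2) * √(1 - z ^ 2)))
  have hC0 := Real.arccos_nonneg ((x - y * z) / (√(1 - y ^ 2) * √(1 - z ^ 2)))
  have hA1 := Real.arccos_le_pi ((z - x * y) / (√(1 - x ^ 2) * √(1 - y ^ 2)))
  have hB1 := Real.arccos_le_pi ((y - x * z) / (√(1 - x ^ 2) * √(1 - z ^ 2)))
  have hC1 := Real.arccos_le_pi ((x - y * z) / (√(1 - y ^ 2) * √(1 - z ^ 2)))
  rw [← cornerAngle] at hA0 hA1 hB0 hB1 hC0 hC1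
  have ha : 0 < √(1 - x ^ 2) := Real.sqrt_pos.2 (by linarith)
  have hb : 0 < √(1 - y ^ 2) := Real.sqrt_pos.2 (by linarith)
  have hc : 0 < √(1 - z ^ 2) := Real.sqrt_pos.2 (by linarith)
  have ha2 : √(1 - x ^ 2) ^ 2 = 1 - x ^ 2 := Real.sq_sqrt (by linarith)
  have hb2 : √(1 - y ^ 2) ^ 2 = 1 - y ^ 2 := Real.sq_sqrt (by linarith)
  have hc2 : √(1 - z ^ 2) ^ 2 = 1 - z ^ 2 := Real.sq_sqrt (by linarith)
  set A := cornerAngle x y z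
  set B := cornerAngle x z y
  set C := cornerAngle y z x
  set a := √(1 - x ^ 2)
  set b := √(1 - y ^ 2)
  set c := √(1 - z ^ 2)
  set S := 1 + x + y + z with hSdef
  set δ := Real.arctan (D / S)
  have hδ0 : 0 < δ := Real.arctan_pos.2 (by positivity)
  have hδ1 : δ < π / 2 := Real.arctan_lt_pi_div_two _
  have hcδ : 0 < Real.cos δ := Real.cos_arctan_pos _
  have htan : Real.sin δ / Real.cos δ = D / S := by
    rw [← Real.tan_eq_sin_div_cos, Real.tan_arctan]
  have hsδ : Real.sin δ = D / S * Real.cos δ := by rw [← htan]; field_simp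
  have hcc : Real.cos δ ^ 2 = S ^ 2 / (S ^ 2 + D ^ 2) := by
    have h1 := Real.sin_sq_add_cos_sq δ
    rw [hsδ] at h1
    field_simp at h1 ⊢
    linarith
  have hSD : S ^ 2 + D ^ 2 = 2 * (1 + x) * (1 + y) * (1 + z) := by rw [hD2, hSdef]; ring
  obtain ⟨hx1, hx2⟩ := abs_lt.1 ((sq_lt_one_iff_abs_lt_one x).1 hx)
  obtain ⟨hy1, hy2⟩ := abs_lt.1 ((sq_lt_one_iff_abs_lt_one y).1 hy)
  obtain ⟨hz1, hz2⟩ := abs_lt.1 ((sq_lt_one_iff_abs_lt_one z).1 hz)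
  have habc : a ^ 2 * b ^ 2 * c ^ 2 =
      (S ^ 2 + D ^ 2) * ((1 - x) * (1 - y) * (1 - z) / 2) := by
    rw [ha2, hb2, hc2, hSD]; ring
  have hQ : 0 < (1 - x) * (1 - y) * (1 - z) / 2 :=
    half_pos (mul_pos (mul_pos (sub_pos.2 hx2) (sub_pos.2 hy2)) (sub_pos.2 hz2))
  have cosS : Real.cos (A + B + C) = -((S ^ 2 - D ^ 2) / (S ^ 2 + D ^ 2)) := by
    rw [Real.cos_add, Real.cos_add, Real.sin_add, cA, sA, cB, sB, cC, sC]
    calc _ = ((z - x * y) * (y - x * z) * (x - y * z) -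
          D ^ 2 * (z - x * y + (y - x * z) + (x - y * z))) / (a ^ 2 * b ^ 2 * c ^ 2) := by
          field_simp; ring
      _ = (-(S ^ 2 - D ^ 2) * ((1 - x) * (1 - y) * (1 - z) / 2)) / (a ^ 2 * b ^ 2 * c ^ 2) := by
          congr 1
          rw [hD2, hSdef]; ring
      _ = _ := by
          rw [habc, mul_div_mul_right _ _ hQ.ne', neg_div]
  have sinS : Real.sin (A + B + C) = -(2 * S * D / (S ^ 2 + D ^ 2)) := by
    rw [Real.sin_add, Real.cos_add, Real.sin_add, cA, sA, cB, sB, cC, sC]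
    calc _ = (D * ((z - x * y) * (y - x * z) + (y - x * z) * (x - y * z) +
          (z - x * y) * (x - y * z) - D ^ 2)) / (a ^ 2 * b ^ 2 * c ^ 2) := by
          field_simp; ring
      _ = (-(2 * S * D) * ((1 - x) * (1 - y) * (1 - z) / 2)) / (a ^ 2 * b ^ 2 * c ^ 2) := by
          congr 1
          rw [hD2, hSdef]; ring
      _ = _ := by
          rw [habc, mul_div_mul_right _ _ hQ.ne', neg_div]
  have cos2 : Real.cos (2 * δ) = (S ^ 2 - D ^ 2) / (S ^ 2 + D ^ 2) := by
    rw [Real.cos_two_mul, hcc]; field_simp; ring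
  have sin2 : Real.sin (2 * δ) = 2 * S * D / (S ^ 2 + D ^ 2) := by
    rw [Real.sin_two_mul, hsδ, show 2 * (D / S * Real.cos δ) * Real.cos δ =
      2 * (D / S) * Real.cos δ ^ 2 by ring, hcc]
    field_simp
  have hone : Real.cos (A + B + C - (π + 2 * δ)) = 1 := by
    rw [Real.cos_sub, add_comm π, Real.cos_add_pi, Real.sin_add_pi, cosS, sinS, cos2, sin2]
    field_simp
    ring
  have := (Real.cos_eq_one_iff_of_lt_of_lt (by linarith) (by linarith)).1 hone
  linarith

/-- Shrinking cosines of the sides from a common value increases the area. -/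
theorem excess_mono {k : ℝ} (hk0 : 0 < k) (hk1 : k < 1) (hxk : x ≤ k) (hyk : y ≤ k) (hzk : z ≤ k)
    (hx : k - 0.382 * (1 - k) ≤ x) (hy : k - 0.382 * (1 - k) ≤ y)
    (hz : k - 0.382 * (1 - k) ≤ z) :
    (1 - k) ^ 2 * (1 + 2 * k) * (1 + x + y + z) ^ 2 ≤
      (1 - x ^ 2 - y ^ 2 - z ^ 2 + 2 * x * y * z) * (1 + 3 * k) ^ 2 := by
  have hd : 0 < 1 - k := by linarith
  have key : ∀ x, x ≤ k → k - 0.382 * (1 - k) ≤ x →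
      ∃ u, 0 ≤ u ∧ u ≤ 0.382 ∧ x = k - (1 - k) * u := fun x h1 h2 => by
    refine ⟨(k - x) / (1 - k), div_nonneg (by linarith) hd.le, ?_, by field_simp; ring⟩
    rw [div_le_iff₀ hd]; linarith
  obtain ⟨u, hu0, hu1, rfl⟩ := key x hxk hx
  obtain ⟨v, hv0, hv1, rfl⟩ := key y hyk hy
  obtain ⟨w, hw0, hw1, rfl⟩ := key z hzk hz
  set p := u + v + w with hp
  have hp0 : 0 ≤ p := by positivity
  have hsq : u ^ 2 + v ^ 2 + w ^ 2 ≤ 0.382 * p := by nlinarith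
  have he2 : 0 ≤ u * v + u * w + v * w := by positivity
  have he3 : u * v * w ≤ 0.05 * p := by
    have h1 : u * v ≤ 0.382 * 0.382 := mul_le_mul hu1 hv1 hv0 (by norm_num)
    have h2 : u * w ≤ 0.382 * 0.382 := mul_le_mul hu1 hw1 hw0 (by norm_num)
    have h3 : v * w ≤ 0.382 * 0.382 := mul_le_mul hv1 hw1 hw0 (by norm_num)
    nlinarith
  have hp2 : p ^ 2 ≤ 1.146 * p := by nlinarith
  have h1 : p * (2 * k - 0.382 - 0.1 * (1 - k)) ≤ 2 * k * p - (u ^ 2 + v ^ 2 + w ^ 2) +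
      2 * k * (u * v + u * w + v * w) - 2 * (1 - k) * (u * v * w) := by
    nlinarith [mul_nonneg hk0.le he2, mul_le_mul_of_nonneg_left he3 hd.le]
  have h2 : p * (2 * (1 + 3 * k) - 1.146 * (1 - k)) ≤
      2 * (1 + 3 * k) * p - (1 - k) * p ^ 2 := by
    nlinarith [mul_le_mul_of_nonneg_left hp2 hd.le]
  have h3 : 0 ≤ (1 + 3 * k) ^ 2 * (2 * k - 0.382 - 0.1 * (1 - k)) +
      (1 + 2 * k) * (1 - k) * (2 * (1 + 3 * k) - 1.146 * (1 - k)) := by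
    nlinarith [mul_pos hk0 hd, mul_pos (mul_pos hk0 hd) hk0, pow_pos hk0 2, pow_pos hk0 3]
  have h4 : 0 ≤ (1 + 3 * k) ^ 2 * (2 * k * p - (u ^ 2 + v ^ 2 + w ^ 2) +
      2 * k * (u * v + u * w + v * w) - 2 * (1 - k) * (u * v * w)) +
      (1 + 2 * k) * (1 - k) * (2 * (1 + 3 * k) * p - (1 - k) * p ^ 2) := by
    have := mul_le_mul_of_nonneg_left h1 (sq_nonneg (1 + 3 * k))
    have := mul_le_mul_of_nonneg_left h2 (show 0 ≤ (1 + 2 * k) * (1 - k) by positivity)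
    have := mul_nonneg hp0 h3
    linarith
  have h5 := mul_nonneg (sq_nonneg (1 - k)) h4
  rw [hp] at h5
  linarith

theorem three_mul_arccos_le_sum_cornerAngle {k : ℝ} (hk0 : 0.04 < k) (hk1 : k < 1) (hxk : x ≤ k)
    (hyk : y ≤ k) (hzk : z ≤ k) (hx : k - 0.382 * (1 - k) ≤ x) (hy : k - 0.382 * (1 - k) ≤ y)
    (hz : k - 0.382 * (1 - k) ≤ z) :
    3 * Real.arccos (k / (1 + k)) ≤ cornerAngle x y z + cornerAngle x z y + cornerAngle y z x := by
  have hd : 0 < 1 - k := by linarith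
  have hS : 0 < 1 + x + y + z := by linarith
  have hS0 : 0 < 1 + k + k + k := by linarith
  have hmono := excess_mono (by linarith) hk1 hxk hyk hzk hx hy hz
  have hD2 : 0 < 1 - x ^ 2 - y ^ 2 - z ^ 2 + 2 * x * y * z := by
    have h1 : 0 < (1 - k) ^ 2 * (1 + 2 * k) * (1 + x + y + z) ^ 2 := by positivity
    exact pos_of_mul_pos_left (h1.trans_le hmono) (sq_nonneg _)
  have hD02 : 0 < 1 - k ^ 2 - k ^ 2 - k ^ 2 + 2 * k * k * k := by
    have : 0 < (1 - k) ^ 2 * (1 + 2 * k) := by positivity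
    linarith
  have hx2 : x ^ 2 < 1 := by nlinarith
  have hy2 : y ^ 2 < 1 := by nlinarith
  have hz2 : z ^ 2 < 1 := by nlinarith
  have hk2 : k ^ 2 < 1 := by nlinarith
  rw [sum_cornerAngle hx2 hy2 hz2 (Real.sqrt_pos.2 hD2) (Real.sq_sqrt hD2.le) hS]
  have hk := sum_cornerAngle hk2 hk2 hk2 (Real.sqrt_pos.2 hD02) (Real.sq_sqrt hD02.le) hS0
  have hcor : cornerAngle k k k = Real.arccos (k / (1 + k)) := by
    rw [cornerAngle, Real.mul_self_sqrt (by linarith)]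
    congr 1
    rw [show 1 - k ^ 2 = (1 - k) * (1 + k) by ring, show k - k * k = (1 - k) * k by ring,
      mul_div_mul_left _ _ hd.ne']
  rw [hcor] at hk
  have hle : √(1 - k ^ 2 - k ^ 2 - k ^ 2 + 2 * k * k * k) / (1 + k + k + k) ≤
      √(1 - x ^ 2 - y ^ 2 - z ^ 2 + 2 * x * y * z) / (1 + x + y + z) := by
    rw [div_le_div_iff₀ hS0 hS]
    refine (sq_le_sq₀ (by positivity) (by positivity)).1 ?_
    rw [mul_pow, mul_pow, Real.sq_sqrt hD02.le, Real.sq_sqrt hD2.le]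
    linarith
  have := Real.arctan_mono hle
  linarith

end Trigonometry

theorem arccos_lt_of_cos_lt {u θ : ℝ} (h0 : 0 < θ) (hπ : θ ≤ π) (h : Real.cos θ < u) :
    Real.arccos u < θ := by
  rcases le_or_gt u 1 with hu | hu
  · rw [← Real.arccos_cos h0.le hπ]
    exact Real.arccos_lt_arccos (Real.neg_one_le_cos _) h hu
  · rwa [Real.arccos_eq_zero.2 hu.le]

theorem cos_le_of_arccos_le {u θ : ℝ} (hπ : θ < π) (h : Real.arccos u ≤ θ) : Real.cos θ ≤ u := by
  rcases le_or_gt u 1 with hu | hu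
  · rcases le_or_gt (-1) u with hu' | hu'
    · rw [← Real.cos_arccos hu' hu]
      exact Real.cos_le_cos_of_nonneg_of_le_pi (Real.arccos_nonneg _) hπ.le h
    · rw [Real.arccos_eq_pi.2 hu'.le] at h
      linarith
  · exact (Real.cos_le_one θ).trans hu.le

theorem cos_two_pi_div_five : Real.cos (2 * π / 5) = 1 - 2 * Real.sin (π / 5) ^ 2 := by
  have := Real.cos_two_mul (π / 5)
  have h2 := Real.sin_sq_add_cos_sq (π / 5)
  rw [show 2 * π / 5 = 2 * (π / 5) by ring, this]
  linarith

theorem sin_pi_div_five_sq : Real.sin (π / 5) ^ 2 = (5 - √5) / 8 := by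
  have h := Real.sin_sq_add_cos_sq (π / 5)
  rw [Real.cos_pi_div_five] at h
  have h5 : √5 ^ 2 = 5 := Real.sq_sqrt (by norm_num)
  linarith

theorem sin_pi_div_five_sq_le : 4 * Real.sin (π / 5) ^ 2 ≤ 1.382 := by
  have : (2.236 : ℝ) ≤ √5 := Real.le_sqrt_of_sq_le (by norm_num)
  rw [sin_pi_div_five_sq]
  linarith

/-- All angles are less than `2π/5` once the cosines of the sides are close enough. -/
theorem cornerAngle_lt {k x y z : ℝ} (hk0 : 0 < k) (hk1 : k < 1) (hxk : x ≤ k) (hyk : y ≤ k)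
    (hx : 1 - x < 2 * Real.sin (π / 5) ^ 2 * (1 - k ^ 2))
    (hy : 1 - y < 2 * Real.sin (π / 5) ^ 2 * (1 - k ^ 2))
    (hz : 1 - z < 2 * Real.sin (π / 5) ^ 2 * (1 - k ^ 2)) : cornerAngle x y z < 2 * π / 5 := by
  refine arccos_lt_of_cos_lt (by positivity) (by linarith [Real.pi_pos]) ?_
  rw [cos_two_pi_div_five]
  have hσ := sin_pi_div_five_sq_le
  have hσ0 := sq_nonneg (Real.sin (π / 5))
  set σ := Real.sin (π / 5) ^ 2
  have hd : 0 < 1 - k := by linarith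
  have hkk : k ^ 2 < k := by nlinarith
  have hx0 : 0 < x := by nlinarith [sq_nonneg k]
  have hy0 : 0 < y := by nlinarith [sq_nonneg k]
  have hx2 : 0 < 1 - x ^ 2 := by nlinarith
  have hy2 : 0 < 1 - y ^ 2 := by nlinarith
  have ha := Real.sqrt_pos.2 hx2
  have hb := Real.sqrt_pos.2 hy2
  have ha2 := Real.sq_sqrt hx2.le
  have hb2 := Real.sq_sqrt hy2.le
  rw [lt_div_iff₀ (by positivity)]
  set a := √(1 - x ^ 2)
  set b := √(1 - y ^ 2)
  have hab : a * b ≤ 1 - (x ^ 2 + y ^ 2) / 2 := by nlinarith [sq_nonneg (a - b)]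
  have hc : 0 ≤ 1 - 2 * σ := by linarith
  have h1 := mul_le_mul_of_nonneg_left hab hc
  have hp : k - x ≤ 2 * σ * k := by nlinarith
  have h2 : (k - x) * (k - y) ≤ 2 * σ * k * (k - y) :=
    mul_le_mul_of_nonneg_right hp (by linarith)
  have h3 := mul_nonneg hc (add_nonneg (sq_nonneg (k - x)) (sq_nonneg (k - y)))
  have h4 : 0 ≤ σ * k * (k - x) := by
    have : 0 ≤ k - x := by linarith
    positivity
  nlinarith

theorem pos_of_sin_lt {k x y z θ : ℝ} (hk1 : k < 1) (hxk : x ≤ k) (hyk : y ≤ k) (hzk : z ≤ k)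
    (hx : k - 0.382 * (1 - k) ≤ x) (hy : k - 0.382 * (1 - k) ≤ y) (h0 : 0 ≤ θ)
    (hθ : θ < 2 * π / 5) (h : cornerAngle x y z ≤ θ) : 0.04 < k := by
  have hu := cos_le_of_arccos_le (by linarith [Real.pi_pos]) h
  have hcos := Real.cos_lt_cos_of_nonneg_of_le_pi h0 (by linarith [Real.pi_pos]) hθ
  have hσ := sin_pi_div_five_sq_le
  rw [cos_two_pi_div_five] at hcos
  have hu' : 0.309 < (z - x * y) / (√(1 - x ^ 2) * √(1 - y ^ 2)) := by linarith
  by_contra! hk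
  rcases le_or_gt k 0 with hk0 | hk0
  · have : (z - x * y) / (√(1 - x ^ 2) * √(1 - y ^ 2)) ≤ 0 :=
      div_nonpos_of_nonpos_of_nonneg (by nlinarith) (by positivity)
    linarith
  · have hx2 : 0.85 ≤ 1 - x ^ 2 := by nlinarith
    have hy2 : 0.85 ≤ 1 - y ^ 2 := by nlinarith
    have ha : 0.9 ≤ √(1 - x ^ 2) := Real.le_sqrt_of_sq_le (by linarith)
    have hb : 0.9 ≤ √(1 - y ^ 2) := Real.le_sqrt_of_sq_le (by linarith)
    have hab : 0.81 ≤ √(1 - x ^ 2) * √(1 - y ^ 2) := by nlinarith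
    rw [lt_div_iff₀ (by linarith)] at hu'
    nlinarith

namespace InscribedTriPoly

variable {m : ℕ} {P : InscribedTriPoly m}

theorem isFaceDim_segment_of_mem_faces {a b c : E3} (ht : {a, b, c} ∈ P.faces) (hab : a ≠ b)
    (hac : a ≠ c) (hbc : b ≠ c) : IsFaceDim P.body (segment ℝ a b) 1 :=
  isFaceDim_segment_of_triangle (by simpa using (mem_faces.1 ht).2.2)
    (affineIndependent_of_mem_faces ht hab hac hbc)

theorem exists_face_sum_angle_le (hm : 0 < m) {A : E3 → Finset E3 → ℝ}
    (hA : ∀ v ∈ P.V, ∑ t ∈ P.star v, A v t = 2 * π) (hV : 2 * P.V.card = m + 4) :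
    ∃ t ∈ P.faces, ∑ v ∈ t, A v t ≤ 6 * (π / 6 * ((m : ℝ) + 4) / m) := by
  classical
  refine Finset.exists_le_of_sum_le (Finset.card_pos.1 (by rwa [P.faces_card])) ?_
  have h1 : ∑ t ∈ P.faces, ∑ v ∈ t, A v t = ∑ v ∈ P.V, ∑ t ∈ P.star v, A v t := by
    refine Finset.sum_comm' fun t v => ?_
    rw [mem_star]
    exact ⟨fun h => ⟨⟨h.1, h.2⟩, (mem_faces.1 h.1).1 h.2⟩, fun h => h.1⟩
  rw [h1, Finset.sum_congr rfl hA, Finset.sum_const, Finset.sum_const, P.faces_card,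
    nsmul_eq_mul, nsmul_eq_mul]
  have hV' : 2 * (P.V.card : ℝ) = m + 4 := by exact_mod_cast hV
  have hm' : (0 : ℝ) < m := by exact_mod_cast hm
  have : (P.V.card : ℝ) * (2 * π) = π * (m + 4) := by rw [← hV']; ring
  rw [this]
  field_simp
  rfl

theorem exists_card_star_le (hV : 2 * P.V.card = m + 4) :
    ∃ v ∈ P.V, (P.star v).card ≤ 5 := by
  by_contra! h
  have h1 := Finset.card_nsmul_le_sum P.V (fun v => (P.star v).card) 6 fun v hv => h v hv
  rw [sum_card_star, smul_eq_mul] at h1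
  omega

/-- An inscribed polyhedron containing the centre has a relatively long edge. -/
theorem exists_edge_of_mem_interior (h0 : (0 : E3) ∈ interior P.body) {k ω : ℝ} (hk1 : k < 1)
    (hk : ∀ x ∈ P.V, ∀ y ∈ P.V, x ≠ y → ⟪x, y⟫ ≤ k) (hω : ω = π / 6 * ((m : ℝ) + 4) / m) :
    ∃ p q : E3, p ≠ q ∧ IsFaceDim P.body (segment ℝ p q) 1 ∧
      (1 - k) * Real.sin (π / 5) ^ 2 ≤ (1 - ⟪p, q⟫) * Real.sin ω ^ 2 := by
  by_contra! hedge
  have hV := two_mul_card h0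
  have hV4 := four_le_card_of_affineSpan_eq_top P.full_dim
  have hm4 : 4 ≤ m := by omega
  have hm : (4 : ℝ) ≤ m := by exact_mod_cast hm4
  have hπ := Real.pi_pos
  have hω1 : π / 6 < ω := by
    rw [hω, lt_div_iff₀ (by linarith)]; nlinarith
  have hω2 : ω ≤ π / 3 := by
    rw [hω, div_le_iff₀ (by linarith)]; nlinarith
  have hpair : ∀ a b c, {a, b, c} ∈ P.faces → a ≠ b → a ≠ c → b ≠ c →
      ⟪a, b⟫ ≤ k ∧ (1 - ⟪a, b⟫) * Real.sin ω ^ 2 < (1 - k) * Real.sin (π / 5) ^ 2 := by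
    intro a b c ht hab hac hbc
    have hsub := (mem_faces.1 ht).1
    exact ⟨hk a (hsub (by simp)) b (hsub (by simp)) hab,
      hedge a b hab (isFaceDim_segment_of_mem_faces ht hab hac hbc)⟩
  have hall : ∀ a b c, {a, b, c} ∈ P.faces → a ≠ b → a ≠ c → b ≠ c →
      (⟪a, b⟫ ≤ k ∧ (1 - ⟪a, b⟫) * Real.sin ω ^ 2 < (1 - k) * Real.sin (π / 5) ^ 2) ∧
      (⟪a, c⟫ ≤ k ∧ (1 - ⟪a, c⟫) * Real.sin ω ^ 2 < (1 - k) * Real.sin (π / 5) ^ 2) ∧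
      (⟪b, c⟫ ≤ k ∧ (1 - ⟪b, c⟫) * Real.sin ω ^ 2 < (1 - k) * Real.sin (π / 5) ^ 2) := by
    intro a b c ht hab hac hbc
    refine ⟨hpair a b c ht hab hac hbc, hpair a c b ?_ hac hab hbc.symm,
      hpair b c a ?_ hbc hab.symm hac.symm⟩
    · rwa [Finset.pair_comm c b]
    · rwa [Finset.pair_comm c a, Finset.insert_comm b a]
  have hsin1 : 1 / 2 < Real.sin ω := by
    rw [← Real.sin_pi_div_six]
    exact Real.sin_lt_sin_of_lt_of_le_pi_div_two (by linarith) (by linarith) hω1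
  have hsinsq : 1 / 4 < Real.sin ω ^ 2 := by nlinarith
  have hσ := sin_pi_div_five_sq_le
  have hσ0 : 0 < Real.sin (π / 5) :=
    Real.sin_pos_of_pos_of_lt_pi (by linarith) (by linarith)
  obtain ⟨A, hA, hA2⟩ := exists_angle h0
  obtain ⟨t, ht, hsum⟩ := exists_face_sum_angle_le (by omega) hA2 hV
  rw [← hω] at hsum
  have hkω : 0.04 < k ∧ Real.cos (2 * ω) ≤ k / (1 + k) := by
    obtain ⟨a, b, c, hab, hac, hbc, rfl⟩ := card_eq_three_of_mem_faces ht
    have e1 : ({b, a, c} : Finset E3) = {a, b, c} := Finset.insert_comm _ _ _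
    have e2 : ({c, a, b} : Finset E3) = {a, b, c} := by
      rw [Finset.insert_comm, Finset.pair_comm]
    rw [Finset.sum_insert (by simp [hab, hac]), Finset.sum_pair hbc,
      hA a b c hab hac hbc ht, ← e1, hA b a c hab.symm hbc hac (e1 ▸ ht), e1, ← e2,
      hA c a b hac.symm hbc.symm hab (e2 ▸ ht), real_inner_comm a b, real_inner_comm a c,
      real_inner_comm b c] at hsum
    obtain ⟨⟨hx, hx'⟩, ⟨hy, hy'⟩, ⟨hz, hz'⟩⟩ := hall a b c ht hab hac hbc
    set x := ⟪a, b⟫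
    set y := ⟪a, c⟫
    set z := ⟪b, c⟫
    have hlow : ∀ x, x ≤ k → (1 - x) * Real.sin ω ^ 2 < (1 - k) * Real.sin (π / 5) ^ 2 →
        k - 0.382 * (1 - k) ≤ x := fun x h1 h2 => by nlinarith
    have hx1 := hlow x hx hx'
    have hy1 := hlow y hy hy'
    have hz1 := hlow z hz hz'
    have hω5 : ω < π / 5 := by
      by_contra! h
      have h1 := Real.sin_le_sin_of_le_of_le_pi_div_two (by linarith) (by linarith) h
      have h2 : Real.sin (π / 5) ^ 2 ≤ Real.sin ω ^ 2 := pow_le_pow_left₀ hσ0.le h1 2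
      nlinarith
    have hk04 : 0.04 < k := by
      rcases le_or_gt (cornerAngle x y z) (2 * ω) with h | h
      · exact pos_of_sin_lt hk1 hx hy hz hx1 hy1 (by linarith) (by linarith) h
      rcases le_or_gt (cornerAngle x z y) (2 * ω) with h' | h'
      · exact pos_of_sin_lt hk1 hx hz hy hx1 hz1 (by linarith) (by linarith) h'
      · exact pos_of_sin_lt hk1 hy hz hx hy1 hz1 (θ := 2 * ω) (by linarith) (by linarith)
          (by linarith)
    refine ⟨hk04, cos_le_of_arccos_le (by linarith) ?_⟩
    have := three_mul_arccos_le_sum_cornerAngle hk04 hk1 hx hy hz hx1 hy1 hz1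
    linarith
  obtain ⟨hk0, hcos⟩ := hkω
  have hbound : ∀ x, (1 - x) * Real.sin ω ^ 2 < (1 - k) * Real.sin (π / 5) ^ 2 →
      1 - x < 2 * Real.sin (π / 5) ^ 2 * (1 - k ^ 2) := fun x hx => by
    have h1 : 1 ≤ 2 * Real.sin ω ^ 2 * (1 + k) := by
      rw [Real.cos_two_mul, le_div_iff₀ (by linarith)] at hcos
      have := Real.sin_sq_add_cos_sq ω
      nlinarith
    have h2 : (1 - x) * Real.sin ω ^ 2 <
        2 * Real.sin (π / 5) ^ 2 * (1 - k ^ 2) * Real.sin ω ^ 2 := by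
      refine hx.trans_le ?_
      have := mul_le_mul_of_nonneg_left h1
        (show 0 ≤ (1 - k) * Real.sin (π / 5) ^ 2 from mul_nonneg (by linarith) (sq_nonneg _))
      linarith
    exact lt_of_mul_lt_mul_right h2 (sq_nonneg _)
  obtain ⟨v, hv, hdeg⟩ := exists_card_star_le hV
  have hlt : ∑ t ∈ P.star v, A v t < ∑ t ∈ P.star v, 2 * π / 5 := by
    refine Finset.sum_lt_sum_of_nonempty (star_nonempty h0 hv) fun t ht => ?_
    obtain ⟨htf, hvt⟩ := mem_star.1 ht
    obtain ⟨b, c, hvb, hvc, hbc, rfl⟩ := exists_eq_insert_of_mem htf hvt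
    rw [hA v b c hvb hvc hbc htf]
    obtain ⟨⟨hx, hx'⟩, ⟨hy, hy'⟩, ⟨hz, hz'⟩⟩ := hall v b c htf hvb hvc hbc
    exact cornerAngle_lt (by linarith) hk1 hx hy (hbound _ hx') (hbound _ hy') (hbound _ hz')
  rw [hA2 v hv, Finset.sum_const, nsmul_eq_mul] at hlt
  have hdeg' : ((P.star v).card : ℝ) ≤ 5 := by exact_mod_cast hdeg
  nlinarith

end InscribedTriPoly

theorem mem_of_isFaceDim_segment {V : Finset E3} {p q : E3}
    (h : IsFaceDim (convexHull ℝ (V : Set E3)) (segment ℝ p q) 1) : p ∈ V ∧ q ∈ V :=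
  ⟨isFaceDim_one_endpoint h, isFaceDim_one_endpoint (q := p) (segment_symm ℝ p q ▸ h)⟩

theorem eta_nonneg (V : Finset E3) : 0 ≤ eta V :=
  div_nonneg (Real.sSup_nonneg fun _ ⟨_, _, _, _, hd⟩ => hd ▸ dist_nonneg)
    (Real.sInf_nonneg fun _ ⟨_, _, _, _, hd⟩ => hd ▸ dist_nonneg)

theorem bddAbove_edgeLengths (V : Finset E3) : BddAbove (edgeLengths V) := by
  obtain ⟨C, hC⟩ := (Metric.isBounded_iff.1 V.finite_toSet.isBounded)
  refine ⟨C, ?_⟩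
  rintro _ ⟨p, q, -, h, rfl⟩
  exact hC (mem_of_isFaceDim_segment h).1 (mem_of_isFaceDim_segment h).2

namespace InscribedTriPoly

variable {m : ℕ} (P : InscribedTriPoly m)

/-- The shortest edge realizes the least distance between vertices. -/
theorem exists_shortest_edge : ∃ p ∈ P.V, ∃ q ∈ P.V, p ≠ q ∧ sInf (edgeLengths P.V) = dist p q ∧
    ∀ u ∈ P.V, ∀ v ∈ P.V, u ≠ v → dist p q ≤ dist u v := by
  obtain ⟨p, hp, q, hq, hpq, hmin⟩ := exists_closest_pair (V := P.V)
    (by have := four_le_card_of_affineSpan_eq_top P.full_dim; omega)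
  refine ⟨p, hp, q, hq, hpq, IsLeast.csInf_eq ⟨⟨p, q, hpq,
    isFaceDim_segment_of_closest P.on_sphere hp hq hpq hmin, rfl⟩, ?_⟩, hmin⟩
  rintro _ ⟨u, v, huv, h, rfl⟩
  exact hmin u (mem_of_isFaceDim_segment h).1 v (mem_of_isFaceDim_segment h).2 huv

theorem le_eta (hm : 0 < m) :
    Real.sin (π / 5) / Real.sin (π / 6 * ((m : ℝ) + 4) / m) ≤ eta P.V := by
  set ω := π / 6 * ((m : ℝ) + 4) / m with hω
  have hπ := Real.pi_pos
  have hm1 : (1 : ℝ) ≤ m := by exact_mod_cast hm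
  have hω1 : π / 6 < ω := by rw [hω, lt_div_iff₀ (by linarith)]; nlinarith
  have hω2 : ω ≤ 5 * π / 6 := by rw [hω, div_le_iff₀ (by linarith)]; nlinarith
  have hsin : 1 / 2 ≤ Real.sin ω := by
    rw [← Real.sin_pi_div_six]
    rcases le_or_gt ω (π / 2) with h | h
    · exact Real.sin_le_sin_of_le_of_le_pi_div_two (by linarith) h hω1.le
    · rw [← Real.sin_pi_sub ω]
      exact Real.sin_le_sin_of_le_of_le_pi_div_two (by linarith) (by linarith) (by linarith)
  obtain ⟨u, hu, v, hv, huv, hinf, hmin⟩ := P.exists_shortest_edge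
  have hs : 0 < dist u v := dist_pos.2 huv
  obtain ⟨p, q, hpq, hface, hle⟩ : ∃ p q : E3, p ≠ q ∧
      IsFaceDim (convexHull ℝ (P.V : Set E3)) (segment ℝ p q) 1 ∧
      (Real.sin (π / 5) * dist u v) ^ 2 ≤ (dist p q * Real.sin ω) ^ 2 := by
    by_cases h0 : (0 : E3) ∈ interior P.body
    · obtain ⟨p, q, hpq, hface, hle⟩ := exists_edge_of_mem_interior h0
        (k := 1 - dist u v ^ 2 / 2) (by have := pow_pos hs 2; linarith) (fun x hx y hy hxy => by
          rw [inner_eq_one_sub_dist_sq (P.on_sphere x hx) (P.on_sphere y hy)]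
          have := pow_le_pow_left₀ hs.le (hmin x hx y hy hxy) 2
          linarith) hω
      refine ⟨p, q, hpq, hface, ?_⟩
      obtain ⟨hp, hq⟩ := mem_of_isFaceDim_segment hface
      rw [inner_eq_one_sub_dist_sq (P.on_sphere p hp) (P.on_sphere q hq)] at hle
      rw [mul_pow, mul_pow]
      linarith
    · obtain ⟨p, q, hpq, hface, a, ha, b, hb, hab, hle⟩ := P.exists_long_edge h0
      refine ⟨p, q, hpq, hface, ?_⟩
      have h1 := pow_le_pow_left₀ hs.le (hmin a ha b hb hab) 2
      have h2 : (1 / 2) ^ 2 ≤ Real.sin ω ^ 2 := pow_le_pow_left₀ (by norm_num) hsin 2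
      have h3 := sin_pi_div_five_sq_le
      have h4 := mul_le_mul_of_nonneg_left h2 (sq_nonneg (dist p q))
      have h5 := mul_le_mul_of_nonneg_right h3 (sq_nonneg (dist u v))
      have h6 := sq_nonneg (dist u v)
      rw [mul_pow, mul_pow]
      norm_num at h4
      linarith
  have hle' := abs_le_of_sq_le_sq hle (by positivity)
  calc Real.sin (π / 5) / Real.sin ω ≤ dist p q / dist u v := by
        rw [div_le_div_iff₀ (by linarith) hs]
        exact (le_abs_self _).trans (by simpa using hle')
    _ ≤ eta P.V := by
        rw [eta, hinf]
        gcongr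
        exact le_csSup (bddAbove_edgeLengths P.V) ⟨p, q, hpq, hface, rfl⟩

end InscribedTriPoly

theorem sin_div_sin_le_e {m : ℕ} (hP : Nonempty (InscribedTriPoly m)) :
    Real.sin (π / 5) / Real.sin (π / 6 * ((m : ℝ) + 4) / m) ≤ e m := by
  obtain ⟨P⟩ := hP
  refine le_csInf ⟨_, P, rfl⟩ ?_
  rintro _ ⟨Q, rfl⟩
  rcases Nat.eq_zero_or_pos m with rfl | hm
  · simpa using eta_nonneg Q.V
  · exact Q.le_eta hm

theorem tendsto_sin_div_sin :
    Tendsto (fun m : ℕ => Real.sin (π / 5) / Real.sin (π / 6 * ((m : ℝ) + 4) / m)) atTop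
      (nhds (2 * Real.sin (π / 5))) := by
  have h1 : Tendsto (fun m : ℕ => π / 6 * ((m : ℝ) + 4) / m) atTop (nhds (π / 6)) := by
    have h2 : Tendsto (fun m : ℕ => π / 6 + π / 6 * (4 / (m : ℝ))) atTop
        (nhds (π / 6 + π / 6 * 0)) :=
      tendsto_const_nhds.add ((tendsto_const_div_atTop_nhds_zero_nat 4).const_mul _)
    rw [mul_zero, add_zero] at h2
    refine h2.congr' ?_
    filter_upwards [eventually_gt_atTop 0] with m hm
    have : (m : ℝ) ≠ 0 := by exact_mod_cast hm.ne'
    field_simp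
  have h2 := (Real.continuous_sin.tendsto (π / 6)).comp h1
  rw [Real.sin_pi_div_six] at h2
  rw [show 2 * Real.sin (π / 5) = Real.sin (π / 5) / (1 / 2) by ring]
  exact tendsto_const_nhds.div h2 (by norm_num)

theorem e_le_eta {m : ℕ} (P : InscribedTriPoly m) : e m ≤ eta P.V := by
  refine csInf_le ⟨0, ?_⟩ ⟨P, rfl⟩
  rintro _ ⟨Q, rfl⟩
  exact eta_nonneg _

theorem le_liminf_e
    (h : ∀ N : ℕ, ∃ m ≥ N, ∃ P : InscribedTriPoly m, eta P.V ≤ 2) :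
    2 * Real.sin (π / 5) ≤
      Filter.liminf e (Filter.atTop ⊓ Filter.principal {m : ℕ | Nonempty (InscribedTriPoly m)}) := by
  set F := atTop ⊓ 𝓟 {m : ℕ | Nonempty (InscribedTriPoly m)}
  have hfreq : ∃ᶠ m in F, e m ≤ 2 := by
    rw [frequently_inf_principal, frequently_atTop]
    intro N
    obtain ⟨m, hm, P, hP⟩ := h N
    exact ⟨m, hm, ⟨P⟩, (e_le_eta P).trans hP⟩
  have hcob : F.IsCoboundedUnder (· ≥ ·) e := IsCoboundedUnder.of_frequently_le hfreq
  refine le_of_forall_lt fun a ha => ?_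
  obtain ⟨b, hab, hb⟩ := exists_between ha
  refine hab.trans_le (le_liminf_of_le hcob ?_)
  rw [eventually_inf_principal]
  filter_upwards [tendsto_sin_div_sin.eventually (lt_mem_nhds hb)] with m hm hP
  exact hm.le.trans (sin_div_sin_le_e hP)

theorem exists_norm_eq_one_inner_eq_zero (x : E3) : ∃ u : E3, ‖u‖ = 1 ∧ ⟪x, u⟫ = 0 := by
  have h : (ℝ ∙ x)ᗮ ≠ ⊥ := by
    intro h
    have h1 := Submodule.finrank_add_finrank_orthogonal (ℝ ∙ x)
    have h2 : Module.finrank ℝ (ℝ ∙ x) ≤ 1 := by simpa using finrank_span_le_card (R := ℝ) {x}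
    rw [h, finrank_bot, finrank_euclideanSpace_fin] at h1
    omega
  obtain ⟨v, hv, hv0⟩ := Submodule.exists_mem_ne_zero_of_ne_bot h
  refine ⟨‖v‖⁻¹ • v, norm_smul_inv_norm hv0, ?_⟩
  rw [inner_smul_right, Submodule.mem_orthogonal_singleton_iff_inner_right.1 hv, mul_zero]

/-- A proper affine subspace has dense complement in the sphere. -/
theorem dense_compl_affineSubspace_sphere {A : AffineSubspace ℝ E3} (hA : A ≠ ⊤) :
    Dense {y : Metric.sphere (0 : E3) 1 | (y : E3) ∉ A} := by
  rw [dense_iff_inter_open]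
  rintro U hU ⟨x, hxU⟩
  by_contra hne
  obtain ⟨O, hO, rfl⟩ := isOpen_induced_iff.1 hU
  have hsub : ∀ y ∈ O, ‖y‖ = 1 → y ∈ A := fun y hy hy1 => by
    by_contra hyA
    exact hne ⟨⟨y, by simpa using hy1⟩, hy, hyA⟩
  obtain ⟨x, hx⟩ := x
  replace hx : ‖x‖ = 1 := by simpa using hx
  replace hxU : x ∈ O := hxU
  have hxx : ⟪x, x⟫ = 1 := by rw [real_inner_self_eq_norm_sq, hx, one_pow]
  have key : ∀ u : E3, ‖u‖ = 1 → ⟪x, u⟫ = 0 → u ∈ A.direction ∧ x ∈ A.direction := by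
    intro u hu hxu
    have hnorm : ∀ θ : ℝ, ‖Real.cos θ • x + Real.sin θ • u‖ = 1 := fun θ => by
      have h := norm_add_sq_real (Real.cos θ • x) (Real.sin θ • u)
      rw [norm_smul, norm_smul, hx, hu, real_inner_smul_left, real_inner_smul_right, hxu,
        mul_one, mul_one, Real.norm_eq_abs, Real.norm_eq_abs, sq_abs, sq_abs] at h
      have h' : ‖Real.cos θ • x + Real.sin θ • u‖ ^ 2 = 1 := by
        rw [h]; linarith [Real.sin_sq_add_cos_sq θ]
      exact (pow_eq_one_iff_of_nonneg (norm_nonneg _) two_ne_zero).1 h'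
    have hmem : ∀ᶠ θ : ℝ in nhds 0, Real.cos θ • x + Real.sin θ • u ∈ O := by
      have hc : Continuous fun θ : ℝ => Real.cos θ • x + Real.sin θ • u := by fun_prop
      exact hc.continuousAt.eventually (hO.mem_nhds (by simpa using hxU))
    have hneg : ∀ᶠ θ : ℝ in nhds 0, Real.cos (-θ) • x + Real.sin (-θ) • u ∈ O :=
      (continuous_neg.tendsto' (0 : ℝ) 0 neg_zero).eventually hmem
    obtain ⟨θ, ⟨h1, h2⟩, h3, h4⟩ := (((hmem.and hneg).filter_mono nhdsWithin_le_nhds).and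
      (Ioo_mem_nhdsGT Real.pi_pos)).exists
    have hs := Real.sin_pos_of_pos_of_lt_pi h3 h4
    have hc : Real.cos θ < 1 := by nlinarith [Real.sin_sq_add_cos_sq θ, Real.cos_le_one θ]
    have hxA := hsub x hxU hx
    have m1 := AffineSubspace.vsub_mem_direction (hsub _ h1 (hnorm θ)) hxA
    have m2 := AffineSubspace.vsub_mem_direction (hsub _ h2 (hnorm (-θ))) hxA
    rw [Real.cos_neg, Real.sin_neg] at m2
    constructor
    · have m3 := A.direction.smul_mem (2 * Real.sin θ)⁻¹ (A.direction.sub_mem m1 m2)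
      convert m3 using 1
      have : 2 * Real.sin θ ≠ 0 := by positivity
      rw [vsub_eq_sub, vsub_eq_sub, eq_inv_smul_iff₀ this]
      module
    · have m3 := A.direction.smul_mem (2 * (Real.cos θ - 1))⁻¹ (A.direction.add_mem m1 m2)
      convert m3 using 1
      have : (2 * (Real.cos θ - 1)) ≠ 0 := by linarith
      rw [vsub_eq_sub, vsub_eq_sub, eq_inv_smul_iff₀ this]
      module
  obtain ⟨u₀, hu₀, hxu₀⟩ := exists_norm_eq_one_inner_eq_zero x
  have hxd := (key u₀ hu₀ hxu₀).2
  refine hA ((AffineSubspace.direction_eq_top_iff_of_nonempty ⟨x, hsub x hxU hx⟩).1 ?_)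
  refine eq_top_iff.2 fun v _ => ?_
  have hw : v - ⟪x, v⟫ • x ∈ A.direction := by
    by_cases hw0 : v - ⟪x, v⟫ • x = 0
    · rw [hw0]; exact A.direction.zero_mem
    · refine (A.direction.smul_mem_iff (inv_ne_zero (norm_ne_zero_iff.2 hw0))).1
        (key _ (norm_smul_inv_norm hw0) ?_).1
      rw [inner_smul_right, inner_sub_right, inner_smul_right, hxx]
      simp
  simpa using A.direction.add_mem hw (A.direction.smul_mem ⟪x, v⟫ hxd)

/-- Every subset of a proper affine subspace lies on a plane. -/
theorem exists_inner_eq_of_ne_top {s : Set E3} (hs : Module.finrank ℝ (vectorSpan ℝ s) < 3) :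
    ∃ n : E3, n ≠ 0 ∧ ∃ c : ℝ, ∀ x ∈ s, ⟪n, x⟫ = c := by
  have h : (vectorSpan ℝ s)ᗮ ≠ ⊥ := by
    intro h
    have h1 := Submodule.finrank_add_finrank_orthogonal (vectorSpan ℝ s)
    rw [h, finrank_bot, finrank_euclideanSpace_fin] at h1
    omega
  obtain ⟨n, hn, hn0⟩ := Submodule.exists_mem_ne_zero_of_ne_bot h
  rcases s.eq_empty_or_nonempty with rfl | ⟨y, hy⟩
  · exact ⟨n, hn0, 0, by simp⟩
  · refine ⟨n, hn0, ⟪n, y⟫, fun x hx => ?_⟩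
    have := Submodule.inner_left_of_mem_orthogonal (vsub_mem_vectorSpan ℝ hx hy) hn
    rwa [vsub_eq_sub, inner_sub_right, sub_eq_zero] at this

/-- No plane contains more than three points of `W`. -/
def InGeneralPosition (W : Finset E3) : Prop :=
  ∀ n : E3, n ≠ 0 → ∀ c : ℝ, ∀ t ⊆ W, (∀ x ∈ t, ⟪n, x⟫ = c) → t.card ≤ 3

theorem InGeneralPosition.insert [DecidableEq E3] {W : Finset E3} (hW : InGeneralPosition W)
    (hs : ∀ v ∈ W, ‖v‖ = 1) {x : E3}
    (hx : ∀ t ∈ W.powersetCard 3, x ∉ affineSpan ℝ (t : Set E3)) :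
    InGeneralPosition (insert x W) := by
  intro n hn c t ht htc
  by_contra! hcard
  have hxt : x ∈ t := by
    by_contra hxt
    exact hcard.not_ge (hW n hn c t ((Finset.subset_insert_iff_of_notMem hxt).1 ht) htc)
  obtain ⟨r, hr, hr3⟩ := Finset.exists_subset_card_eq (s := t.erase x) (n := 3)
    (by rw [Finset.card_erase_of_mem hxt]; omega)
  have hrW : r ⊆ W := fun y hy => (Finset.mem_insert.1 (ht (Finset.mem_of_mem_erase
    (hr hy)))).resolve_left (Finset.ne_of_mem_erase (hr hy))
  refine hx r (Finset.mem_powersetCard.2 ⟨hrW, hr3⟩) ?_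
  obtain ⟨a, b, d, hab, had, hbd, rfl⟩ := Finset.card_eq_three.1 hr3
  have hfin := finrank_vectorSpan_triple (affineIndependent_of_norm_eq_one
    (hs a (hrW (by simp))) (hs b (hrW (by simp))) (hs d (hrW (by simp))) hab had hbd)
  have hc : ∀ y ∈ ({a, b, d} : Set E3), ⟪n, y⟫ = c := fun y hy =>
    htc y (Finset.mem_of_mem_erase (hr (by simpa using hy)))
  have hle : vectorSpan ℝ {a, b, d} ≤ (ℝ ∙ n)ᗮ := by
    rw [vectorSpan_def, Submodule.span_le]
    rintro _ ⟨y, hy, z, hz, rfl⟩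
    refine Submodule.mem_orthogonal_singleton_iff_inner_right.2 ?_
    change ⟪n, y - z⟫ = 0
    rw [inner_sub_right, hc y hy, hc z hz, sub_self]
  have heq := Submodule.eq_of_le_of_finrank_eq hle (by
    have := Submodule.finrank_add_finrank_orthogonal (ℝ ∙ n)
    rw [finrank_span_singleton hn, finrank_euclideanSpace_fin] at this
    omega)
  have hxa : x -ᵥ a ∈ vectorSpan ℝ {a, b, d} := by
    rw [heq]
    refine Submodule.mem_orthogonal_singleton_iff_inner_right.2 ?_
    rw [vsub_eq_sub, inner_sub_right, htc x hxt, hc a (by simp), sub_self]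
  rw [← direction_affineSpan] at hxa
  push_cast
  exact (AffineSubspace.vsub_right_mem_direction_iff_mem
    (subset_affineSpan ℝ _ (by simp)) x).1 hxa

/-- The cardinality of a separated subset of the sphere is bounded. -/
theorem exists_card_le_of_separated {s : ℝ} (hs : 0 < s) : ∃ B : ℕ, ∀ W : Finset E3,
    (∀ v ∈ W, ‖v‖ = 1) → (∀ u ∈ W, ∀ v ∈ W, u ≠ v → s ≤ dist u v) → W.card ≤ B := by
  obtain ⟨T, -, hT, hcov⟩ := Metric.finite_approx_of_totallyBounded
    (isCompact_sphere (0 : E3) 1).totallyBounded (s / 2) (by linarith)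
  refine ⟨hT.toFinset.card, fun W hW hsep => ?_⟩
  have h : ∀ v ∈ W, ∃ t ∈ hT.toFinset, dist v t < s / 2 := fun v hv => by
    obtain ⟨t, ht, hvt⟩ := Set.mem_iUnion₂.1 (hcov (a := v) (by simpa using hW v hv))
    exact ⟨t, by simpa using ht, hvt⟩
  choose! f hf hfd using h
  refine Finset.card_le_card_of_injOn f hf fun u hu v hv huv => ?_
  by_contra hne
  have h1 := hfd u hu
  have h2 := hfd v hv
  rw [huv] at h1
  linarith [hsep u hu v hv hne, dist_triangle_right u v (f v)]

/-- The sphere has a separated net in general position. -/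
theorem exists_net {s : ℝ} (hs : 0 < s) : ∃ W : Finset E3, (∀ v ∈ W, ‖v‖ = 1) ∧
    (∀ u ∈ W, ∀ v ∈ W, u ≠ v → s ≤ dist u v) ∧ InGeneralPosition W ∧
    ∀ y : E3, ‖y‖ = 1 → ∃ w ∈ W, dist y w ≤ s := by
  classical
  let K : Set ℕ := {k | ∃ W : Finset E3, W.card = k ∧ (∀ v ∈ W, ‖v‖ = 1) ∧
    (∀ u ∈ W, ∀ v ∈ W, u ≠ v → s ≤ dist u v) ∧ InGeneralPosition W}
  obtain ⟨B, hB⟩ := exists_card_le_of_separated hs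
  have hK : BddAbove K := ⟨B, by
    rintro _ ⟨W, rfl, h1, h2, -⟩
    exact hB W h1 h2⟩
  have hne : K.Nonempty := ⟨0, ∅, by simp, by simp, by simp, fun n _ c t ht _ => by
    simp [Finset.subset_empty.1 ht]⟩
  obtain ⟨W, hcard, hW, hsep, hgp⟩ := Nat.sSup_mem hne hK
  refine ⟨W, hW, hsep, hgp, ?_⟩
  by_contra! hy
  obtain ⟨y, hy1, hy⟩ := hy
  have hdense : Dense (⋂ t ∈ W.powersetCard 3,
      {y : Metric.sphere (0 : E3) 1 | (y : E3) ∉ affineSpan ℝ (t : Set E3)}) := by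
    refine dense_biInter_of_isOpen (S := ((W.powersetCard 3 : Finset _) : Set (Finset E3)))
      (fun t _ => ?_) (Finset.countable_toSet _) fun t ht => ?_
    · exact (AffineSubspace.closed_of_finiteDimensional _).isOpen_compl.preimage
        continuous_subtype_val
    · refine dense_compl_affineSubspace_sphere fun htop => ?_
      have := four_le_card_of_affineSpan_eq_top htop
      have := (Finset.mem_powersetCard.1 ht).2
      omega
  have hopen : IsOpen (⋂ w ∈ W, {y : Metric.sphere (0 : E3) 1 | s < dist (y : E3) w}) :=
    isOpen_biInter_finset fun w _ => isOpen_lt continuous_const (by fun_prop)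
  obtain ⟨⟨x, hx⟩, hx1, hx2⟩ := hdense.inter_open_nonempty _ hopen
    ⟨⟨y, by simpa using hy1⟩, by simpa using hy⟩
  simp only [Set.mem_iInter, Set.mem_ofPred_eq] at hx1 hx2
  have hxW : x ∉ W := fun h => by linarith [hx1 x h, dist_self x]
  have hmem : (insert x W).card ∈ K := by
    refine ⟨insert x W, rfl, ?_, ?_, hgp.insert hW hx2⟩
    · simpa using ⟨by simpa using hx, hW⟩
    · intro u hu v hv huv
      rcases Finset.mem_insert.1 hu with rfl | hu' <;>
        rcases Finset.mem_insert.1 hv with rfl | hv'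
      · exact absurd rfl huv
      · exact (hx1 v hv').le
      · exact dist_comm u v ▸ (hx1 u hu').le
      · exact hsep u hu' v hv' huv
  have := le_csSup hK hmem
  rw [Finset.card_insert_of_notMem hxW] at this
  omega

theorem exists_card_le_of_net (N : ℕ) : ∃ s : ℝ, 0 < s ∧ s ≤ 1 / 2 ∧ ∀ W : Finset E3,
    (∀ y : E3, ‖y‖ = 1 → ∃ w ∈ W, dist y w ≤ s) → N ≤ W.card := by
  have hinf : (Metric.sphere (0 : E3) 1).Infinite := by
    have hrank : 1 < Module.rank ℝ E3 := by
      rw [← Module.finrank_eq_rank, finrank_euclideanSpace_fin]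
      norm_num
    refine (isPreconnected_sphere hrank 0 1).infinite_of_nontrivial ?_
    obtain ⟨u, hu, -⟩ := exists_norm_eq_one_inner_eq_zero 0
    refine ⟨u, by simpa using hu, -u, by simpa using hu, fun h => ?_⟩
    have hu0 : u = 0 := by
      refine (smul_eq_zero.1 (?_ : (2 : ℝ) • u = 0)).resolve_left two_ne_zero
      rw [two_smul]
      nth_rw 2 [h]
      exact add_neg_cancel u
    rw [hu0, norm_zero] at hu
    exact zero_ne_one hu
  obtain ⟨T, hT, hTN⟩ := hinf.exists_subset_card_eq (N + 2)
  obtain ⟨p, hp, q, hq, hpq, hmin⟩ := exists_closest_pair (V := T) (by omega)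
  have hd := dist_pos.2 hpq
  refine ⟨min (dist p q / 3) (1 / 2), by positivity, min_le_right _ _, fun W hW => ?_⟩
  have h : ∀ y ∈ T, ∃ w ∈ W, dist y w ≤ dist p q / 3 := fun y hy => by
    obtain ⟨w, hw, hyw⟩ := hW y (by simpa using hT hy)
    exact ⟨w, hw, hyw.trans (min_le_left _ _)⟩
  choose! f hf hfd using h
  refine (show N ≤ T.card by omega).trans
    (Finset.card_le_card_of_injOn f hf fun u hu v hv huv => ?_)
  by_contra hne
  have h1 := hfd u hu
  have h2 := hfd v hv
  rw [huv] at h1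
  linarith [hmin u hu v hv hne, dist_triangle_right u v (f v)]

theorem mem_extremePoints_of_norm_eq_one {V : Finset E3} (hV : ∀ v ∈ V, ‖v‖ = 1) {v : E3}
    (hv : v ∈ V) : v ∈ Set.extremePoints ℝ (convexHull ℝ (V : Set E3)) := by
  have hle : ∀ x ∈ convexHull ℝ (V : Set E3), ‖x‖ ≤ 1 := fun x hx => by
    have := convexHull_min (s := (V : Set E3)) (t := Metric.closedBall 0 1)
      (fun y hy => by simpa using (hV y hy).le) (convex_closedBall 0 1) hx
    simpa using this
  refine ⟨subset_convexHull ℝ _ hv, fun x hx y hy hvxy => ?_⟩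
  have hxy : x = y := by
    by_contra hxy
    have := openSegment_subset_ball_of_ne (z := (0 : E3)) (r := 1) (by simpa using hle x hx)
      (by simpa using hle y hy) hxy hvxy
    simp [hV v hv] at this
  rw [hxy, openSegment_same] at hvxy
  rw [hxy, hvxy]

namespace InGeneralPosition

variable {V : Finset E3}

theorem affineSpan_eq_top (hgp : InGeneralPosition V) (hcard : 4 ≤ V.card) :
    affineSpan ℝ (V : Set E3) = ⊤ := by
  have hne : (V : Set E3).Nonempty := Finset.card_pos.1 (by omega)
  refine (AffineSubspace.affineSpan_eq_top_iff_vectorSpan_eq_top_of_nonempty ℝ _ _ hne).2 ?_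
  by_contra htop
  have hlt := Submodule.finrank_lt (lt_top_iff_ne_top.2 htop).ne
  rw [finrank_euclideanSpace_fin] at hlt
  obtain ⟨n, hn, c, hc⟩ := exists_inner_eq_of_ne_top hlt
  have := hgp n hn c V subset_rfl hc
  omega

theorem faces_triangles (hgp : InGeneralPosition V) (hV : ∀ v ∈ V, ‖v‖ = 1) {F : Set E3}
    (hF : IsFaceDim (convexHull ℝ (V : Set E3)) F 2) :
    ∃ a b c : E3, a ∈ V ∧ b ∈ V ∧ c ∈ V ∧ AffineIndependent ℝ ![a, b, c] ∧
      F = convexHull ℝ ({a, b, c} : Set E3) := by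
  classical
  obtain ⟨-, hc, hext, hdim⟩ := hF
  have hFV := hext.eq_convexHull_filter hc
  set t := V.filter (· ∈ F) with ht
  have hdim' := hdim
  rw [hFV, vectorSpan_convexHull] at hdim'
  have hle : t.card ≤ 3 := by
    obtain ⟨n, hn, c, hnc⟩ := exists_inner_eq_of_ne_top (hdim'.trans_lt (by norm_num))
    exact hgp n hn c t (Finset.filter_subset _ _) hnc
  have hge : 3 ≤ t.card := by
    by_contra! hlt
    have hne : t.Nonempty := by
      rw [Finset.nonempty_iff_ne_empty]
      rintro h
      rw [h] at hdim'
      rw [Finset.coe_empty, vectorSpan_empty, finrank_bot] at hdim'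
      omega
    have := finrank_vectorSpan_image_finset_le ℝ (id : E3 → E3) t (n := t.card - 1)
      (by have := hne.card_pos; omega)
    rw [Finset.image_id, hdim'] at this
    omega
  obtain ⟨a, b, c, hab, hac, hbc, habc⟩ := Finset.card_eq_three.1 (le_antisymm hle hge)
  have hmem : ∀ x ∈ ({a, b, c} : Finset E3), x ∈ V := fun x hx =>
    Finset.filter_subset _ _ (habc ▸ hx)
  have ha := hmem a (by simp)
  have hb := hmem b (by simp)
  have hc := hmem c (by simp)
  refine ⟨a, b, c, ha, hb, hc,
    affineIndependent_of_norm_eq_one (hV a ha) (hV b hb) (hV c hc) hab hac hbc, ?_⟩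
  rw [hFV, habc]
  push_cast
  rfl

end InGeneralPosition

/-- If the vertices form an `s`-net of the sphere, then the edges have length at most `2s`. -/
theorem dist_le_of_isFaceDim_segment {V : Finset E3} (hV : ∀ v ∈ V, ‖v‖ = 1)
    (htop : affineSpan ℝ (V : Set E3) = ⊤) {s : ℝ}
    (hnet : ∀ y : E3, ‖y‖ = 1 → ∃ w ∈ V, dist y w ≤ s) {p q : E3}
    (h : IsFaceDim (convexHull ℝ (V : Set E3)) (segment ℝ p q) 1) : dist p q ≤ 2 * s := by
  have hmid : midpoint ℝ p q ∉ interior (convexHull ℝ (V : Set E3)) :=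
    h.2.2.1.notMem_interior (h.2.2.2.trans_lt (by norm_num)) (midpoint_mem_segment p q)
  obtain ⟨f, hf0, hf⟩ := geometric_hahn_banach_of_nonempty_interior_point (convex_convexHull ℝ _)
    hmid (interior_convexHull_nonempty htop)
  have hp := (mem_of_isFaceDim_segment h).1
  have hq := (mem_of_isFaceDim_segment h).2
  have hfm : f (midpoint ℝ p q) = (f p + f q) / 2 := by
    rw [midpoint_eq_smul_add, map_smul, map_add, smul_eq_mul, invOf_eq_inv]
    ring
  have hfp := hf p (subset_convexHull ℝ _ hp)
  have hfq := hf q (subset_convexHull ℝ _ hq)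
  set n := (InnerProductSpace.toDual ℝ E3).symm f
  have hn : ∀ x, ⟪n, x⟫ = f x := fun x => InnerProductSpace.toDual_symm_apply
  have hn0 : n ≠ 0 := by simpa [n] using hf0
  have hn1 : ‖‖n‖⁻¹ • n‖ = 1 := norm_smul_inv_norm hn0
  obtain ⟨w, hw, hnw⟩ := hnet _ hn1
  have hclose : ∀ u ∈ V, f w ≤ f u → dist (‖n‖⁻¹ • n) u ≤ s := fun u hu hwu => by
    have h1 := inner_eq_one_sub_dist_sq hn1 (hV w hw)
    have h2 := inner_eq_one_sub_dist_sq hn1 (hV u hu)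
    rw [real_inner_smul_left, hn] at h1 h2
    have h3 := mul_le_mul_of_nonneg_left hwu (inv_nonneg.2 (norm_nonneg n))
    exact (abs_le_of_sq_le_sq' (by linarith) dist_nonneg).2.trans hnw
  have hfw := hf w (subset_convexHull ℝ _ hw)
  linarith [hclose p hp (by linarith), hclose q hq (by linarith),
    dist_triangle_left p q (‖n‖⁻¹ • n)]

theorem exists_inscribedTriPoly (N : ℕ) : ∃ m ≥ N, ∃ P : InscribedTriPoly m, eta P.V ≤ 2 := by
  obtain ⟨s, hs, hs1, hN⟩ := exists_card_le_of_net (N + 4)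
  obtain ⟨W, hW, hsep, hgp, hnet⟩ := exists_net hs
  have hcard := hN W hnet
  have htop := hgp.affineSpan_eq_top (by omega)
  let P : InscribedTriPoly {F : Set E3 | IsFaceDim (convexHull ℝ (W : Set E3)) F 2}.ncard :=
    { V := W
      on_sphere := hW
      is_vertex := fun v hv => mem_extremePoints_of_norm_eq_one hW hv
      full_dim := htop
      faces_triangles := fun F hF => hgp.faces_triangles hW hF
      card_faces := rfl }
  have h0 : (0 : E3) ∈ interior P.body := by
    by_contra h0
    obtain ⟨n, d, hn, hd, hle, -⟩ := exists_support_of_zero_notMem_interior htop h0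
    obtain ⟨w, hw, hnw⟩ := hnet (-n) (by rwa [norm_neg])
    have h1 := hle w (subset_convexHull ℝ _ hw)
    have h2 := inner_eq_one_sub_dist_sq (by rwa [norm_neg]) (hW w hw) (a := -n)
    rw [inner_neg_left] at h2
    have h3 := pow_le_pow_left₀ dist_nonneg (hnw.trans hs1) 2
    linarith
  refine ⟨_, ?_, P, ?_⟩
  · have h1 := P.two_mul_card h0
    have h2 : N + 4 ≤ P.V.card := hcard
    omega
  · obtain ⟨p, hp, q, hq, hpq, hinf, -⟩ := P.exists_shortest_edge
    have hpq' : s ≤ dist p q := hsep p hp q hq hpq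
    rw [eta, hinf, div_le_iff₀ (by linarith)]
    refine Real.sSup_le ?_ (by positivity)
    rintro _ ⟨u, v, -, huv, rfl⟩
    exact (dist_le_of_isFaceDim_segment hW htop hnet huv).trans (by linarith)

/-- `e_m ≥ sin 36° / sin(30°(m+4)/m)` for every `m` for which inscribed polyhedra with `m`
triangular faces exist, and consequently `liminf_{m→∞} e_m ≥ 2 sin 36°`. -/
theorem e_lower_bound :
    (∀ m : ℕ, Nonempty (InscribedTriPoly m) →
      Real.sin (π / 5) / Real.sin (π / 6 * ((m : ℝ) + 4) / m) ≤ e m) ∧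
    2 * Real.sin (π / 5) ≤
      Filter.liminf e (Filter.atTop ⊓ Filter.principal {m : ℕ | Nonempty (InscribedTriPoly m)}) := by
  exact ⟨fun _ hP => sin_div_sin_le_e hP, le_liminf_e exists_inscribedTriPoly⟩
end
end

section
/- Let r > 0 and let P₁′, …, P_k′, with k ≥ 12, be points of a closed half-sphere of radius r in ℝ³ (i.e., each P_i′ satisfies ‖P_i′‖ = r and ⟨P_i′, u⟩ ≥ 0 for a fixed unit vector u). Then min_{i≠j} ‖P_i′ − P_j′‖ ≤ ((22 + 48√6)/145)·r < 0.9626·r. (In the paper the constant is printed as (24√6+11)/145; numerically the bound is (22+48√6)/145 = 2(24√6+11)/290 = 0.96264… .) -/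
open scoped Real RealInnerProductSpace

open MeasureTheory Set InnerProductGeometry

/-- The open spherical sector of the unit ball of `ℝ³` with axis `v` and angular radius
`arccos c`. -/
def sphericalSector (v : EuclideanSpace ℝ (Fin 3)) (c : ℝ) : Set (EuclideanSpace ℝ (Fin 3)) :=
  {x | ‖x‖ < 1 ∧ c * ‖x‖ < ⟪v, x⟫}

theorem isOpen_sphericalSector (v : EuclideanSpace ℝ (Fin 3)) (c : ℝ) :
    IsOpen (sphericalSector v c) := by
  refine IsOpen.and ?_ ?_ <;> exact isOpen_lt (by fun_prop) (by fun_prop)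

theorem sphericalSector_subset_ball (v : EuclideanSpace ℝ (Fin 3)) (c : ℝ) :
    sphericalSector v c ⊆ Metric.ball 0 1 := fun _ hx => by simpa using hx.1

theorem angle_lt_of_mem_sphericalSector {v x : EuclideanSpace ℝ (Fin 3)} {c : ℝ} (hv : ‖v‖ = 1)
    (hc : -1 ≤ c) (hx : x ∈ sphericalSector v c) : angle v x < Real.arccos c := by
  have hx0 : 0 < ‖x‖ := by
    rw [norm_pos_iff]
    rintro rfl
    simpa using hx.2
  have hlt : c < ⟪v, x⟫ / (‖v‖ * ‖x‖) := by
    rw [hv, one_mul, lt_div_iff₀ hx0]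
    exact hx.2
  exact Real.arccos_lt_arccos hc hlt
    (abs_le.1 (abs_real_inner_div_norm_mul_norm_le_one v x)).2

theorem disjoint_sphericalSector {v w : EuclideanSpace ℝ (Fin 3)} {c d : ℝ} (hv : ‖v‖ = 1)
    (hw : ‖w‖ = 1) (hc : -1 ≤ c) (hd : -1 ≤ d)
    (h : Real.arccos c + Real.arccos d ≤ angle v w) :
    Disjoint (sphericalSector v c) (sphericalSector w d) := by
  rw [Set.disjoint_left]
  intro x hxv hxw
  have h₁ := angle_lt_of_mem_sphericalSector hv hc hxv
  have h₂ := angle_lt_of_mem_sphericalSector hw hd hxw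
  have h₃ := angle_le_angle_add_angle v x w
  rw [angle_comm x w] at h₃
  linarith

theorem volume_setOf_sq_add_sq_lt {R : ℝ} (hR : 0 ≤ R) :
    volume {w : Fin 2 → ℝ | w 0 ^ 2 + w 1 ^ 2 < R} = ENNReal.ofReal (π * R) := by
  have h := (PiLp.volume_preserving_toLp (Fin 2)).measure_preimage
    (s := Metric.ball (0 : EuclideanSpace ℝ (Fin 2)) √R) Metric.isOpen_ball.nullMeasurableSet
  rw [EuclideanSpace.volume_ball_fin_two] at h
  convert h using 1
  · congr 1
    ext w
    simp [EuclideanSpace.norm_eq, Fin.sum_univ_two, Real.sqrt_lt_sqrt_iff, add_nonneg, sq_nonneg]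
  · rw [← ENNReal.ofReal_pow (Real.sqrt_nonneg R), Real.sq_sqrt hR, ← ENNReal.ofReal_mul hR,
      mul_comm]

theorem volume_sphericalSector_eq_lintegral {v : EuclideanSpace ℝ (Fin 3)} (hv : ‖v‖ = 1) (c : ℝ) :
    volume (sphericalSector v c) = ∫⁻ z : ℝ, volume {w : Fin 2 → ℝ |
      √(z ^ 2 + (w 0 ^ 2 + w 1 ^ 2)) < 1 ∧ c * √(z ^ 2 + (w 0 ^ 2 + w 1 ^ 2)) < z} := by
  obtain ⟨b, hb⟩ := Orthonormal.exists_orthonormalBasis_extension_of_card_eq (𝕜 := ℝ)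
    (ι := Fin 3) (by simp) (v := fun _ => v) (s := {0})
    (by
      rw [orthonormal_iff_ite]
      rintro ⟨i, rfl⟩ ⟨j, rfl⟩
      simp [hv])
  have hb0 : b 0 = v := hb 0 rfl
  have he : MeasurePreserving (fun x : EuclideanSpace ℝ (Fin 3) =>
      MeasurableEquiv.piFinSuccAbove (fun _ : Fin 3 => ℝ) 0 (WithLp.ofLp (b.repr x))) :=
    (volume_preserving_piFinSuccAbove (fun _ : Fin 3 => ℝ) 0).comp
      ((PiLp.volume_preserving_ofLp (Fin 3)).comp b.repr.measurePreserving)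
  set T : Set (ℝ × (Fin 2 → ℝ)) := {p | √(p.1 ^ 2 + (p.2 0 ^ 2 + p.2 1 ^ 2)) < 1 ∧
    c * √(p.1 ^ 2 + (p.2 0 ^ 2 + p.2 1 ^ 2)) < p.1}
  have hTm : MeasurableSet T := by
    refine (IsOpen.and ?_ ?_).measurableSet <;> exact isOpen_lt (by fun_prop) (by fun_prop)
  have hpre := he.measure_preimage hTm.nullMeasurableSet
  rw [Measure.volume_eq_prod, Measure.prod_apply hTm] at hpre
  refine Eq.trans (congrArg _ ?_) hpre
  ext x
  have hn : ‖x‖ = √(b.repr x 0 ^ 2 + (b.repr x 1 ^ 2 + b.repr x 2 ^ 2)) := by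
    rw [← b.repr.norm_map x, EuclideanSpace.norm_eq, Fin.sum_univ_three]
    simp [add_assoc]
  have hi : ⟪v, x⟫ = b.repr x 0 := by rw [b.repr_apply_apply, hb0]
  simp only [sphericalSector, mem_ofPred_eq, hn, hi]
  rfl

theorem le_volume_sphericalSector {v : EuclideanSpace ℝ (Fin 3)} (hv : ‖v‖ = 1) {c : ℝ}
    (hc : 0 < c) (hc1 : c < 1) :
    ENNReal.ofReal (2 * π / 3 * (1 - c)) ≤ volume (sphericalSector v c) := by
  have hc2 : 0 ≤ 1 / c ^ 2 - 1 := by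
    rw [sub_nonneg, le_div_iff₀ (by positivity)]
    nlinarith
  set f : ℝ → ENNReal := fun z => volume {w : Fin 2 → ℝ |
    √(z ^ 2 + (w 0 ^ 2 + w 1 ^ 2)) < 1 ∧ c * √(z ^ 2 + (w 0 ^ 2 + w 1 ^ 2)) < z}
  have h₁ : ENNReal.ofReal (π * (c * (1 - c ^ 2) / 3)) ≤ ∫⁻ z in Ioc 0 c, f z := by
    have h_integral : ∫ z in Ioc 0 c, π * (z ^ 2 * (1 / c ^ 2 - 1)) = π * (c * (1 - c ^ 2) / 3) := by
      rw [← intervalIntegral.integral_of_le hc.le, intervalIntegral.integral_const_mul,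
        intervalIntegral.integral_mul_const, integral_pow]
      field_simp
      ring
    rw [← h_integral, ofReal_integral_eq_lintegral_ofReal]
    · refine setLIntegral_mono' measurableSet_Ioc fun z hz => ?_
      rw [← volume_setOf_sq_add_sq_lt (by positivity)]
      refine measure_mono fun w hw => ?_
      have hw' : z ^ 2 + (w 0 ^ 2 + w 1 ^ 2) < (z / c) ^ 2 := by
        have : w 0 ^ 2 + w 1 ^ 2 < z ^ 2 * (1 / c ^ 2 - 1) := hw
        rw [div_pow, div_eq_mul_one_div]
        linarith
      have hz0 : 0 < z := hz.1
      have hs := (Real.sqrt_lt' (div_pos hz0 hc)).2 hw'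
      refine ⟨hs.trans_le ((div_le_one hc).2 hz.2), ?_⟩
      rwa [lt_div_iff₀ hc, mul_comm] at hs
    · exact (Continuous.integrableOn_Ioc (by fun_prop))
    · exact Filter.Eventually.of_forall fun z => by dsimp; positivity
  have h₂ : ENNReal.ofReal (π * (2 / 3 - c + c ^ 3 / 3)) ≤ ∫⁻ z in Ioc c 1, f z := by
    have h_integral : ∫ z in Ioc c 1, π * (1 - z ^ 2) = π * (2 / 3 - c + c ^ 3 / 3) := by
      rw [← intervalIntegral.integral_of_le hc1.le, intervalIntegral.integral_const_mul,
        intervalIntegral.integral_sub (by simp) (by simp), integral_pow]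
      simp
      ring
    have hsq : ∀ z ∈ Ioc c 1, 0 ≤ 1 - z ^ 2 := fun z hz => by
      have := hz.1
      nlinarith [hz.2]
    rw [← h_integral, ofReal_integral_eq_lintegral_ofReal]
    · refine setLIntegral_mono' measurableSet_Ioc fun z hz => ?_
      rw [← volume_setOf_sq_add_sq_lt (hsq z hz)]
      refine measure_mono fun w hw => ?_
      have hw' : z ^ 2 + (w 0 ^ 2 + w 1 ^ 2) < 1 ^ 2 := by
        have : w 0 ^ 2 + w 1 ^ 2 < 1 - z ^ 2 := hw
        linarith
      have hs := (Real.sqrt_lt' one_pos).2 hw'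
      exact ⟨hs, (mul_lt_of_lt_one_right hc hs).trans hz.1⟩
    · exact (Continuous.integrableOn_Ioc (by fun_prop))
    · refine (ae_restrict_iff' measurableSet_Ioc).2 (Filter.Eventually.of_forall fun z hz => ?_)
      exact mul_nonneg Real.pi_pos.le (hsq z hz)
  calc ENNReal.ofReal (2 * π / 3 * (1 - c))
      = ENNReal.ofReal (π * (c * (1 - c ^ 2) / 3) + π * (2 / 3 - c + c ^ 3 / 3)) := by
        congr 1
        ring
    _ ≤ ENNReal.ofReal (π * (c * (1 - c ^ 2) / 3)) +
          ENNReal.ofReal (π * (2 / 3 - c + c ^ 3 / 3)) := ENNReal.ofReal_add_le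
    _ ≤ (∫⁻ z in Ioc 0 c, f z) + ∫⁻ z in Ioc c 1, f z := add_le_add h₁ h₂
    _ = ∫⁻ z in Ioc 0 c ∪ Ioc c 1, f z :=
        (lintegral_union measurableSet_Ioc (Ioc_disjoint_Ioc_of_le le_rfl)).symm
    _ ≤ ∫⁻ z, f z := setLIntegral_le_lintegral _ _
    _ = volume (sphericalSector v c) := (volume_sphericalSector_eq_lintegral hv c).symm

/-- The area bound for packings of spherical caps of angular radii `arccos (c i)`. -/
theorem sum_one_sub_le_two_of_disjoint_sphericalSector {ι : Type*} [Fintype ι]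
    {v : ι → EuclideanSpace ℝ (Fin 3)} {c : ι → ℝ} (hv : ∀ i, ‖v i‖ = 1) (hc : ∀ i, 0 < c i)
    (hc1 : ∀ i, c i < 1)
    (hd : Pairwise fun i j => Disjoint (sphericalSector (v i) (c i)) (sphericalSector (v j) (c j))) :
    ∑ i, (1 - c i) ≤ 2 := by
  have hle : ENNReal.ofReal (∑ i, 2 * π / 3 * (1 - c i)) ≤ ENNReal.ofReal (π * 4 / 3) :=
    calc ENNReal.ofReal (∑ i, 2 * π / 3 * (1 - c i))
        = ∑ i, ENNReal.ofReal (2 * π / 3 * (1 - c i)) :=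
          ENNReal.ofReal_sum_of_nonneg fun i _ =>
            mul_nonneg (by positivity) (sub_nonneg.2 (hc1 i).le)
      _ ≤ ∑ i, volume (sphericalSector (v i) (c i)) :=
          Finset.sum_le_sum fun i _ => le_volume_sphericalSector (hv i) (hc i) (hc1 i)
      _ = volume (⋃ i, sphericalSector (v i) (c i)) := by
          rw [measure_iUnion hd fun i => (isOpen_sphericalSector _ _).measurableSet, tsum_fintype]
      _ ≤ volume (Metric.ball (0 : EuclideanSpace ℝ (Fin 3)) 1) :=
          measure_mono (iUnion_subset fun i => sphericalSector_subset_ball _ _)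
      _ = ENNReal.ofReal (π * 4 / 3) := by simp [EuclideanSpace.volume_ball_fin_three]
  rw [ENNReal.ofReal_le_ofReal_iff (by positivity), ← Finset.mul_sum] at hle
  have hπ := Real.pi_pos
  by_contra! h
  nlinarith

/-- Points of a closed unit half-sphere at mutual distances at least `2 * s` give disjoint caps of
angular radius `arcsin s`, all disjoint from the cap of angular radius `π / 2 - arcsin s` about the
opposite pole. -/
theorem card_mul_add_le_two_of_le_dist {ι : Type*} [Fintype ι] {u : EuclideanSpace ℝ (Fin 3)}
    (hu : ‖u‖ = 1) {Q : ι → EuclideanSpace ℝ (Fin 3)} (hQ : ∀ i, ‖Q i‖ = 1)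
    (hQu : ∀ i, 0 ≤ ⟪Q i, u⟫) {s : ℝ} (hs : 0 < s) (hs1 : s < 1)
    (hd : Pairwise fun i j => 2 * s ≤ dist (Q i) (Q j)) :
    Fintype.card ι * (1 - √(1 - s ^ 2)) + (1 - s) ≤ 2 := by
  have hs2 : 0 < 1 - s ^ 2 := by nlinarith
  have hc : 0 < √(1 - s ^ 2) := Real.sqrt_pos.2 hs2
  have hc1 : √(1 - s ^ 2) < 1 := by
    rw [Real.sqrt_lt' one_pos]
    nlinarith
  have harc : Real.arccos √(1 - s ^ 2) = Real.arcsin s := (Real.arcsin_eq_arccos hs.le).symm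
  have hpair : ∀ i j, i ≠ j → Real.arcsin s + Real.arcsin s ≤ angle (Q i) (Q j) := by
    intro i j hij
    have hinner : ⟪Q i, Q j⟫ ≤ 1 - 2 * s ^ 2 := by
      have h : 2 * s ≤ dist (Q i) (Q j) := hd hij
      have hsub := norm_sub_sq_real (Q i) (Q j)
      rw [dist_eq_norm] at h
      rw [hQ, hQ] at hsub
      nlinarith
    have hcos : Real.cos (angle (Q i) (Q j)) ≤ Real.cos (2 * Real.arcsin s) := by
      rw [Real.cos_two_mul, Real.cos_arcsin, Real.sq_sqrt hs2.le, cos_angle, hQ, hQ]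
      linarith
    rw [← two_mul]
    by_contra! hlt
    have := Real.cos_lt_cos_of_nonneg_of_le_pi (angle_nonneg (Q i) (Q j))
      (by linarith [Real.arcsin_le_pi_div_two s]) hlt
    linarith
  have hpole : ∀ i, Real.arcsin s + Real.arccos s ≤ angle (Q i) (-u) := by
    intro i
    rw [Real.arccos_eq_pi_div_two_sub_arcsin, add_sub_cancel, angle_neg_right]
    have : angle (Q i) u ≤ π / 2 := by
      exact Real.arccos_le_pi_div_two.2 (div_nonneg (hQu i) (by positivity))
    linarith
  have hsum := sum_one_sub_le_two_of_disjoint_sphericalSector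
    (v := fun o : Option ι => o.elim (-u) Q) (c := fun o : Option ι => o.elim s fun _ => √(1 - s ^ 2))
    (by rintro (_ | i) <;> simp [hu, hQ])
    (by rintro (_ | i) <;> simp only [Option.elim] <;> assumption)
    (by rintro (_ | i) <;> simp only [Option.elim] <;> assumption)
    (by
      have hside : ∀ i, Disjoint (sphericalSector (Q i) √(1 - s ^ 2)) (sphericalSector (-u) s) :=
        fun i => disjoint_sphericalSector (hQ i) (by simpa using hu) (by linarith) (by linarith)
          (by rw [harc]; exact hpole i)
      rintro (_ | i) (_ | j) hij
      · exact absurd rfl hij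
      · exact (hside j).symm
      · exact hside i
      · refine disjoint_sphericalSector (hQ i) (hQ j) ?_ ?_ ?_ <;> simp only [Option.elim]
        · linarith
        · linarith
        · rw [harc]
          exact hpair i j fun h => hij (congrArg some h))
  rw [Fintype.sum_option] at hsum
  simp only [Option.elim, Finset.sum_const, Finset.card_univ, nsmul_eq_mul] at hsum
  linarith

/-- Hemisphere lemma: if `P₁', …, P_k'`, `k ≥ 12`, are points on a closed half-sphere of
radius `r` in `ℝ³`, then `min_{i≠j} ‖P_i' − P_j'‖ ≤ ((22 + 48√6)/145) r < 0.9626 r`. -/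
theorem hemisphere_min_dist (r : ℝ) (hr : 0 < r) (k : ℕ) (hk : 12 ≤ k)
    (u : EuclideanSpace ℝ (Fin 3)) (hu : ‖u‖ = 1)
    (P : Fin k → EuclideanSpace ℝ (Fin 3))
    (hPr : ∀ i, ‖P i‖ = r) (hPu : ∀ i, 0 ≤ ⟪P i, u⟫) :
    sInf {d : ℝ | ∃ i j : Fin k, i ≠ j ∧ d = dist (P i) (P j)} ≤
      (22 + 48 * Real.sqrt 6) / 145 * r ∧
    (22 + 48 * Real.sqrt 6) / 145 * r < 0.9626 * r := by
  have h6 : √6 ^ 2 = 6 := Real.sq_sqrt (by norm_num)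
  have h6pos : 0 < √6 := by positivity
  have hconst : (22 + 48 * √6) / 145 < 0.9626 := by nlinarith
  refine ⟨?_, mul_lt_mul_of_pos_right hconst hr⟩
  set m := sInf {d : ℝ | ∃ i j : Fin k, i ≠ j ∧ d = dist (P i) (P j)}
  have hmle : ∀ i j, i ≠ j → m ≤ dist (P i) (P j) := fun i j hij =>
    csInf_le ⟨0, by rintro d ⟨i, j, -, rfl⟩; exact dist_nonneg⟩ ⟨i, j, hij, rfl⟩
  by_contra! hlt
  rw [← lt_div_iff₀ hr] at hlt
  obtain ⟨s, hs₀, hs⟩ : ∃ s, (22 + 48 * √6) / 290 < s ∧ s < min (m / r / 2) 1 :=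
    exists_between (lt_min (by linarith) (by linarith))
  rw [lt_min_iff] at hs
  have hspos : 0 < s := lt_trans (by positivity) hs₀
  have hkey := card_mul_add_le_two_of_le_dist hu (Q := fun i => r⁻¹ • P i)
    (fun i => by rw [norm_smul, hPr, Real.norm_of_nonneg (by positivity), inv_mul_cancel₀ hr.ne'])
    (fun i => by rw [real_inner_smul_left]; exact mul_nonneg (by positivity) (hPu i))
    hspos hs.2
    (fun i j hij => by
      change 2 * s ≤ dist (r⁻¹ • P i) (r⁻¹ • P j)
      rw [dist_smul₀, Real.norm_of_nonneg (by positivity), ← div_eq_inv_mul]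
      have := div_le_div_of_nonneg_right (hmle i j hij) hr.le
      linarith [hs.1])
  have hs2 : 0 ≤ 1 - s ^ 2 := by nlinarith [hs.2]
  have hcsq := Real.sq_sqrt hs2
  have hc0 := Real.sqrt_nonneg (1 - s ^ 2)
  have hc1 : √(1 - s ^ 2) ≤ 1 := Real.sqrt_le_one.2 (by nlinarith)
  rw [Fintype.card_fin] at hkey
  have hk' : (12 : ℝ) ≤ k := by exact_mod_cast hk
  have h12 : 11 - s ≤ 12 * √(1 - s ^ 2) := by
    nlinarith [mul_le_mul_of_nonneg_right hk' (sub_nonneg.2 hc1)]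
  have hquad : 145 * s ^ 2 - 22 * s - 23 ≤ 0 := by
    nlinarith [mul_self_le_mul_self (by linarith [hs.2]) h12]
  nlinarith
end

section
/- Let r > 0 and let δ be a real number with 0 ≤ δ ≤ 2r. If 12·(r − √(r² − δ²/4)) ≤ r + δ/2, then δ ≤ ((22 + 48√6)/145)·r. -/
/-- The algebraic step of the hemisphere packing lemma: if `0 ≤ δ ≤ 2r` and
`12 (r − √(r² − δ²/4)) ≤ r + δ/2`, then `δ ≤ ((22 + 48√6)/145) r`. -/
theorem hemisphere_packing_algebra (r δ : ℝ) (hr : 0 < r) (hδ0 : 0 ≤ δ) (hδ2 : δ ≤ 2 * r)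
    (h : 12 * (r - Real.sqrt (r ^ 2 - δ ^ 2 / 4)) ≤ r + δ / 2) :
    δ ≤ (22 + 48 * Real.sqrt 6) / 145 * r := by
  have hs : 0 ≤ r ^ 2 - δ ^ 2 / 4 := by nlinarith
  have hlin : 11 * r - δ / 2 ≤ 12 * √(r ^ 2 - δ ^ 2 / 4) := by linarith
  have hsq : (11 * r - δ / 2) ^ 2 ≤ 144 * (r ^ 2 - δ ^ 2 / 4) := by
    have := pow_le_pow_left₀ (by linarith) hlin 2
    rw [mul_pow, Real.sq_sqrt hs] at this
    linarith
  have hroot : 145 * δ - 22 * r ≤ 48 * √6 * r := by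
    refine abs_le_of_sq_le_sq' ?_ (by positivity) |>.2
    rw [mul_pow, mul_pow, Real.sq_sqrt (by norm_num)]
    linarith
  linarith
end

section
/- Let V be a finite set of at least two points on a sphere in ℝ³ (all points of V at the same distance R > 0 from a common centre O), and let p, q ∈ V be two distinct points realizing the minimum of the pairwise Euclidean distances over all pairs of distinct points of V. Then the closed segment [p,q] is a face of the convex polytope conv(V); that is, [p,q] is an extreme subset of conv(V) (equivalently, p and q are joined by an edge of the polytope, and no point of conv(V \ {p,q}) lies in the open segment's supporting structure: whenever a point of [p,q] is a convex combination x = t·y + (1−t)·z with y, z ∈ conv(V) and 0 < t < 1, then y, z ∈ [p,q]). -/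
/-- If a linear functional is at most `c` on `s`, then the points of `convexHull ℝ s` at which it
equals `c` are convex combinations of the points of `s` at which it equals `c`. -/
theorem mem_convexHull_of_linearMap_eq {E : Type*} [AddCommGroup E] [Module ℝ E] {s t : Set E}
    (f : E →ₗ[ℝ] ℝ) {c : ℝ} (ht : ∀ v ∈ t, f v = c) (hs : ∀ v ∈ s, v ∉ t → f v < c) {x : E}
    (hx : x ∈ convexHull ℝ s) : f x ≤ c ∧ (f x = c → x ∈ convexHull ℝ t) := by
  have hconv : Convex ℝ {x : E | f x ≤ c ∧ (f x = c → x ∈ convexHull ℝ t)} := by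
    rw [convex_iff_forall_pos]
    rintro y ⟨hy, hy'⟩ z ⟨hz, hz'⟩ a b ha hb hab
    have hc : c = a * c + b * c := by rw [← add_mul, hab, one_mul]
    have hay : a * f y ≤ a * c := by gcongr
    have hbz : b * f z ≤ b * c := by gcongr
    simp only [Set.mem_ofPred_eq, map_add, map_smul, smul_eq_mul]
    refine ⟨by linarith, fun h ↦ ?_⟩
    have hyc : f y = c := mul_left_cancel₀ ha.ne' (by linarith)
    have hzc : f z = c := mul_left_cancel₀ hb.ne' (by linarith)
    exact convex_convexHull ℝ t (hy' hyc) (hz' hzc) ha.le hb.le hab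
  refine convexHull_min (fun v hv ↦ ?_) hconv hx
  by_cases hvt : v ∈ t
  · exact ⟨(ht v hvt).le, fun _ ↦ subset_convexHull ℝ t hvt⟩
  · exact ⟨(hs v hv hvt).le, fun h ↦ absurd h (hs v hv hvt).ne⟩

/-- If a linear functional attains its maximum over `s` exactly on `t ⊆ s`, then `convexHull ℝ t`
is an extreme subset of `convexHull ℝ s`. -/
theorem isExtreme_convexHull_of_linearMap {E : Type*} [AddCommGroup E] [Module ℝ E] {s t : Set E}
    (f : E →ₗ[ℝ] ℝ) {c : ℝ} (hts : t ⊆ s) (ht : ∀ v ∈ t, f v = c)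
    (hs : ∀ v ∈ s, v ∉ t → f v < c) : IsExtreme ℝ (convexHull ℝ s) (convexHull ℝ t) := by
  refine ⟨convexHull_mono hts, ?_⟩
  rintro x hx y hy z hz ⟨a, b, ha, hb, hab, rfl⟩
  obtain ⟨hxc, hx'⟩ := mem_convexHull_of_linearMap_eq f ht hs hx
  obtain ⟨hyc, -⟩ := mem_convexHull_of_linearMap_eq f ht hs hy
  have hzc : f (a • x + b • y) = c :=
    convexHull_min (t := {x | f x = c}) ht (convex_hyperplane f.isLinear c) hz
  simp only [map_add, map_smul, smul_eq_mul] at hzc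
  have hc : c = a * c + b * c := by rw [← add_mul, hab, one_mul]
  have hby : b * f y ≤ b * c := by gcongr
  have hax : a * f x ≤ a * c := by gcongr
  exact hx' (mul_left_cancel₀ ha.ne' (by linarith))


/-- A segment joining two vertices at minimal mutual distance of a finite point set on a
sphere is a face (an extreme subset) of the convex hull of the set. -/
theorem minimal_segment_isExtreme (V : Finset (EuclideanSpace ℝ (Fin 3)))
    (O : EuclideanSpace ℝ (Fin 3)) (R : ℝ) (hR : 0 < R)
    (hV : ∀ v ∈ V, dist v O = R) (hcard : 2 ≤ V.card)
    (p q : EuclideanSpace ℝ (Fin 3)) (hp : p ∈ V) (hq : q ∈ V) (hpq : p ≠ q)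
    (hmin : ∀ x ∈ V, ∀ y ∈ V, x ≠ y → dist p q ≤ dist x y) :
    IsExtreme ℝ (convexHull ℝ (V : Set (EuclideanSpace ℝ (Fin 3)))) (segment ℝ p q) := by
  have hinner : ∀ x ∈ V, ∀ y ∈ V, 2 * inner ℝ (x - O) (y - O) = 2 * R ^ 2 - dist x y ^ 2 := by
    intro x hx y hy
    have h := norm_sub_sq_real (x - O) (y - O)
    rw [sub_sub_sub_cancel_right, ← dist_eq_norm, ← dist_eq_norm, ← dist_eq_norm, hV x hx,
      hV y hy] at h
    linarith
  have hd : 0 < dist p q := dist_pos.2 hpq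
  have hval : ∀ v ∈ V, innerₗ _ ((p - O) + (q - O)) v =
      innerₗ _ ((p - O) + (q - O)) O + (2 * R ^ 2 - (dist p v ^ 2 + dist q v ^ 2) / 2) := by
    intro v hv
    have h : innerₗ _ ((p - O) + (q - O)) (v - O) =
        inner ℝ (p - O) (v - O) + inner ℝ (q - O) (v - O) := by
      rw [innerₗ_apply_apply, inner_add_left]
    rw [map_sub] at h
    linarith [hinner p hp v hv, hinner q hq v hv]
  rw [← convexHull_pair]
  refine isExtreme_convexHull_of_linearMap (innerₗ _ ((p - O) + (q - O)))
    (c := innerₗ _ ((p - O) + (q - O)) O + (2 * R ^ 2 - dist p q ^ 2 / 2)) ?_ ?_ ?_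
  · simp [Set.insert_subset_iff, hp, hq]
  · rintro v (rfl | rfl)
    · rw [hval v hp, dist_self, dist_comm q v]
      ring
    · rw [hval v hq, dist_self]
      ring
  · intro v hv hvt
    simp only [Set.mem_insert_iff, Set.mem_singleton_iff, not_or] at hvt
    have h₁ := pow_le_pow_left₀ hd.le (hmin p hp v hv (Ne.symm hvt.1)) 2
    have h₂ := pow_le_pow_left₀ hd.le (hmin q hq v hv (Ne.symm hvt.2)) 2
    rw [hval v hv]
    linarith [pow_pos hd 2]
end

section
/- Let T be a triangle whose three vertices lie on a circle of radius r > 0 centred at O in a Euclidean plane, and suppose the closed triangle T (the convex hull of its vertices) contains the centre O. Then T has a side of Euclidean length at least 2r/√3. -/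
open scoped RealInnerProductSpace in
/-- If two points `A`, `B` at distance `r` from `O` are at distance less than `2r/√3`,
then the inner product of `B - O` and `A - O` exceeds `r² / 3`. -/
theorem sq_div_three_lt_inner_of_dist_lt {E : Type*} [NormedAddCommGroup E]
    [InnerProductSpace ℝ E] {r : ℝ} {O A B : E} (hA : dist A O = r) (hB : dist B O = r)
    (h : dist A B < 2 * r / Real.sqrt 3) : r ^ 2 / 3 < ⟪B - O, A - O⟫ := by
  have hsq : dist A B ^ 2 < (2 * r / Real.sqrt 3) ^ 2 :=
    pow_lt_pow_left₀ h dist_nonneg two_ne_zero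
  rw [div_pow, Real.sq_sqrt (by norm_num : (0 : ℝ) ≤ 3), dist_comm, dist_eq_norm,
    ← sub_sub_sub_cancel_right B A O, norm_sub_sq_real, ← dist_eq_norm, ← dist_eq_norm,
    hA, hB] at hsq
  linarith

/-- A triangle inscribed in a circle of radius `r` that contains the centre of the circle
has a side of length at least `2r/√3`. -/
theorem triangle_containing_center_long_side
    (r : ℝ) (hr : 0 < r) (O A B C : EuclideanSpace ℝ (Fin 2))
    (hA : dist A O = r) (hB : dist B O = r) (hC : dist C O = r)
    (hind : AffineIndependent ℝ ![A, B, C])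
    (hO : O ∈ convexHull ℝ ({A, B, C} : Set (EuclideanSpace ℝ (Fin 2)))) :
    2 * r / Real.sqrt 3 ≤ dist A B ∨ 2 * r / Real.sqrt 3 ≤ dist B C ∨
      2 * r / Real.sqrt 3 ≤ dist C A := by
  by_contra! h
  obtain ⟨hAB, -, hCA⟩ := h
  rw [convexHull_insert (Set.insert_nonempty _ _), convexHull_pair, mem_convexJoin] at hO
  obtain ⟨A, rfl, _, ⟨c, d, hc, hd, hcd, rfl⟩, a, b, ha, hb, hab, hO⟩ := hO
  have hB' := sq_div_three_lt_inner_of_dist_lt hA hB hAB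
  have hC' := sq_div_three_lt_inner_of_dist_lt hA hC (dist_comm C _ ▸ hCA)
  have hsum : a • (A - O) + (b * c) • (B - O) + (b * d) • (C - O) = 0 := by
    obtain rfl : a = 1 - b := by linarith
    obtain rfl : c = 1 - d := by linarith
    rw [← sub_eq_zero] at hO
    rw [← hO]
    module
  have hinner := congrArg (fun x => inner ℝ x (A - O)) hsum
  simp only [inner_add_left, real_inner_smul_left, inner_zero_left,
    real_inner_self_eq_norm_sq, ← dist_eq_norm, hA] at hinner
  have hr2 : 0 < r ^ 2 := by positivity
  have h1 := mul_le_mul_of_nonneg_left hB'.le (mul_nonneg hb hc)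
  have h2 := mul_le_mul_of_nonneg_left hC'.le (mul_nonneg hb hd)
  have h3 : a * (r ^ 2 / 3) ≤ a * r ^ 2 := mul_le_mul_of_nonneg_left (by linarith) ha
  have h4 : a * (r ^ 2 / 3) + b * c * (r ^ 2 / 3) + b * d * (r ^ 2 / 3) = r ^ 2 / 3 := by
    linear_combination (r ^ 2 / 3) * hab + (b * (r ^ 2 / 3)) * hcd
  linarith
end

section
/- Fix a ∈ (0, π/2) and γ ∈ (0, π). Then the function b ↦ arccos(cos a · cos b + sin a · sin b · cos γ) is strictly monotone increasing on the interval [a, π/2]. (By the spherical law of cosines, this says that in a spherical triangle with fixed angle γ between sides a and b, the opposite side c is a strictly increasing function of b on [a, π/2]; in particular, decreasing b to b = a decreases c.) -/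
open scoped Real

/-- In a spherical triangle with fixed angle `γ ∈ (0,π)` between sides `a ∈ (0, π/2)` and
`b`, the opposite side `c = arccos(cos a cos b + sin a sin b cos γ)` is a strictly
increasing function of `b` on `[a, π/2]`. -/
theorem spherical_side_strictMono (a γ : ℝ) (ha : a ∈ Set.Ioo 0 (π / 2))
    (hγ : γ ∈ Set.Ioo 0 π) :
    StrictMonoOn
      (fun b : ℝ => Real.arccos (Real.cos a * Real.cos b + Real.sin a * Real.sin b * Real.cos γ))
      (Set.Icc a (π / 2)) := by
  obtain ⟨ha0, ha1⟩ := ha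
  obtain ⟨hγ0, hγ1⟩ := hγ
  have hsa : 0 < Real.sin a := Real.sin_pos_of_pos_of_lt_pi ha0 (by linarith)
  have hcosγ : Real.cos γ < 1 := by
    simpa using Real.cos_lt_cos_of_nonneg_of_le_pi le_rfl hγ1.le hγ0
  have mem_Icc : ∀ b ∈ Set.Icc a (π / 2),
      Real.cos a * Real.cos b + Real.sin a * Real.sin b * Real.cos γ ∈ Set.Icc (-1) 1 := by
    rintro b ⟨hab, hb⟩
    have hsb : 0 ≤ Real.sin b := Real.sin_nonneg_of_nonneg_of_le_pi (by linarith) (by linarith)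
    have hs := mul_nonneg hsa.le hsb
    have hsub := Real.cos_le_one (a - b)
    have hadd := Real.neg_one_le_cos (a + b)
    rw [Real.cos_sub] at hsub
    rw [Real.cos_add] at hadd
    constructor
    · nlinarith [Real.neg_one_le_cos γ]
    · nlinarith
  intro x hx y hy hxy
  refine Real.strictAntiOn_arccos (mem_Icc y hy) (mem_Icc x hx) ?_
  have hsin : Real.sin x < Real.sin y :=
    Real.sin_lt_sin_of_lt_of_le_pi_div_two (by linarith [hx.1]) hy.2 hxy
  have hcos : Real.cos (y - a) < Real.cos (x - a) :=
    Real.cos_lt_cos_of_nonneg_of_le_pi (by linarith [hx.1]) (by linarith [hy.2]) (by linarith)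
  rw [Real.cos_sub, Real.cos_sub] at hcos
  nlinarith [mul_pos (mul_pos hsa (sub_pos.2 hsin)) (sub_pos.2 hcosγ)]
end

section
/- Let 0 < d < √2, set s = sin(36°) = sin(π/5), and define μ = 2s·√(1 − d²/4) and f(η) = 2s·√((1 + √(1 − (η·d/(2s))²))/2) for 0 ≤ η ≤ 2s/d. Then: (i) μ·d/(2s) ≤ 1, so f(μ) is defined; (ii) f(μ) = μ; (iii) f is antitone (non-increasing) on [0, 2s/d]; and consequently (iv) for every η with 0 ≤ η < μ one has f(η) ≥ μ > η, i.e., η < μ implies η < f(η). -/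
open scoped Real

/-- Fixed point argument: with `s = sin 36°`, `μ = 2s√(1 − d²/4)` and
`f(η) = 2s·√((1 + √(1 − (ηd/(2s))²))/2)` for `0 < d < √2`, one has `μd/(2s) ≤ 1`,
`f(μ) = μ`, `f` is antitone on `[0, 2s/d]`, and `η < μ` implies `μ ≤ f(η)` and `η < f(η)`. -/
theorem fixed_point_argument (d s μ : ℝ) (f : ℝ → ℝ) (hd0 : 0 < d) (hd2 : d < Real.sqrt 2)
    (hs : s = Real.sin (π / 5))
    (hμ : μ = 2 * s * Real.sqrt (1 - d ^ 2 / 4))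
    (hf : ∀ η : ℝ, f η = 2 * s * Real.sqrt ((1 + Real.sqrt (1 - (η * d / (2 * s)) ^ 2)) / 2)) :
    μ * d / (2 * s) ≤ 1 ∧
    f μ = μ ∧
    AntitoneOn f (Set.Icc 0 (2 * s / d)) ∧
    ∀ η : ℝ, 0 ≤ η → η < μ → μ ≤ f η ∧ η < f η := by
  have hs0 : 0 < s := by
    rw [hs]
    exact Real.sin_pos_of_pos_of_lt_pi (by positivity) (by linarith [Real.pi_pos])
  have hd : d ^ 2 < 2 := (Real.lt_sqrt hd0.le).mp hd2
  have hr : Real.sqrt (1 - d ^ 2 / 4) ^ 2 = 1 - d ^ 2 / 4 := Real.sq_sqrt (by linarith)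
  have hratio : μ * d / (2 * s) = Real.sqrt (1 - d ^ 2 / 4) * d := by
    rw [hμ]
    field_simp
  have hle : μ * d / (2 * s) ≤ 1 := by
    rw [hratio]
    nlinarith [sq_nonneg (Real.sqrt (1 - d ^ 2 / 4) - d)]
  have hμ0 : 0 ≤ μ := by
    rw [hμ]
    positivity
  have hfix : f μ = μ := by
    have hsq : 1 - (Real.sqrt (1 - d ^ 2 / 4) * d) ^ 2 = (1 - d ^ 2 / 2) ^ 2 := by
      rw [mul_pow, hr]
      ring
    rw [hf, hratio, hsq, Real.sqrt_sq (by linarith), hμ]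
    congr 2
    ring
  have hanti : AntitoneOn f (Set.Icc 0 (2 * s / d)) := by
    intro a ha b _ hab
    have ha0 : 0 ≤ a := ha.1
    rw [hf, hf]
    gcongr
  have hμmem : μ ∈ Set.Icc 0 (2 * s / d) := by
    refine ⟨hμ0, ?_⟩
    rw [le_div_iff₀ hd0]
    rwa [div_le_one (by positivity)] at hle
  refine ⟨hle, hfix, hanti, fun η hη hημ => ?_⟩
  have hμf : μ ≤ f η := by
    simpa only [hfix] using hanti ⟨hη, hημ.le.trans hμmem.2⟩ hμmem hημ.le
  exact ⟨hμf, hημ.trans_le hμf⟩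
end

section
/- Let c = arccos(cot(36°)/√3) (≈ 37.37° in degrees, where 36° = π/5) and let λ = (1/2)·√( cos²(36°)/(1 − sin²c · sin²(36°))² + sin²(36°) ). Then λ < 1 and sin(λ·c) < sin(36°)·sin c. (Numerically λ = 0.5488…, sin(λc)/sin c = 0.5773… < sin 36° = 0.5878… .) -/
open scoped Real

/-- With `c = arccos(cot 36°/√3)` and
`λ = (1/2)√(cos² 36°/(1 − sin²c sin² 36°)² + sin² 36°)`,
one has `λ < 1` and `sin(λc) < sin 36° · sin c`. -/
theorem lambda_lt_one_and_sin_ineq (c l : ℝ)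
    (hc : c = Real.arccos (Real.cos (π / 5) / Real.sin (π / 5) / Real.sqrt 3))
    (hl : l = (1 / 2) * Real.sqrt (Real.cos (π / 5) ^ 2 /
        (1 - Real.sin c ^ 2 * Real.sin (π / 5) ^ 2) ^ 2 + Real.sin (π / 5) ^ 2)) :
    l < 1 ∧ Real.sin (l * c) < Real.sin (π / 5) * Real.sin c := by
  have hS : 0 < Real.sin (π / 5) :=
    Real.sin_pos_of_pos_of_lt_pi (by positivity) (by linarith [Real.pi_pos])
  have hSC := Real.sin_sq_add_cos_sq (π / 5)
  have hClo : 0.809 < Real.cos (π / 5) := by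
    rw [Real.cos_pi_div_five]
    have : 2.236 < √5 := Real.lt_sqrt_of_sq_lt (by norm_num)
    linarith
  have hChi : Real.cos (π / 5) < 0.80902 := by
    rw [Real.cos_pi_div_five]
    have : √5 < 2.23607 := (Real.sqrt_lt' (by norm_num)).2 (by norm_num)
    linarith
  set S := Real.sin (π / 5)
  set C := Real.cos (π / 5)
  have hC2lo : 0.65448 < C ^ 2 := by nlinarith
  have hC2hi : C ^ 2 < 0.65452 := by nlinarith
  have hq0 : 0 ≤ C / S / √3 := by positivity
  have hq2 : (C / S / √3) ^ 2 = C ^ 2 / (3 * S ^ 2) := by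
    rw [div_pow, div_pow, Real.sq_sqrt (by norm_num), div_div, mul_comm]
  have hq2lo : 0.6312 < C ^ 2 / (3 * S ^ 2) := by
    rw [lt_div_iff₀ (by positivity)]; linarith
  have hq2hi : C ^ 2 / (3 * S ^ 2) < 0.632 := by
    rw [div_lt_iff₀ (by positivity)]; linarith
  have hcos : Real.cos c = C / S / √3 := by
    rw [hc]
    exact Real.cos_arccos (by linarith) (by nlinarith)
  have hc0 : 0 ≤ c := hc ▸ Real.arccos_nonneg _
  have hcpi : c ≤ π := hc ▸ Real.arccos_le_pi _
  have hsinc : 0 ≤ Real.sin c := Real.sin_nonneg_of_nonneg_of_le_pi hc0 hcpi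
  have hprod : Real.sin c ^ 2 * S ^ 2 = 1 - 4 / 3 * C ^ 2 := by
    rw [Real.sin_sq, hcos, hq2]
    field_simp
    linarith
  have hcub : c < 0.66 := by
    by_contra! h
    have h1 : Real.cos c ≤ Real.cos 0.66 :=
      Real.cos_le_cos_of_nonneg_of_le_pi (by norm_num) hcpi h
    have h2 := (abs_le.1 (Real.cos_bound (x := 0.66) (by norm_num [abs_le]))).2
    rw [abs_of_pos (by norm_num)] at h2
    have h3 : Real.cos c ≤ 0.7925 := by norm_num at h1 h2 ⊢; linarith
    rw [hcos] at h3
    nlinarith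
  have hlub : l < 0.549 := by
    have hsqrt : √(C ^ 2 / (1 - Real.sin c ^ 2 * S ^ 2) ^ 2 + S ^ 2) < 1.098 := by
      rw [Real.sqrt_lt' (by norm_num), hprod]
      have h : C ^ 2 / (1 - (1 - 4 / 3 * C ^ 2)) ^ 2 = 9 / (16 * C ^ 2) := by
        field_simp
        ring
      have h' : 9 / (16 * C ^ 2) < 0.8598 := by
        rw [div_lt_iff₀ (by positivity)]; linarith
      rw [h]
      linarith
    rw [hl]
    linarith
  have hl0 : 0 ≤ l := hl ▸ by positivity
  refine ⟨by linarith, ?_⟩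
  have hx : l * c ≤ 0.3624 := by nlinarith
  have hx0 : 0 ≤ l * c := mul_nonneg hl0 hc0
  have h1 : Real.sin (l * c) ≤ Real.sin 0.3624 :=
    Real.sin_le_sin_of_le_of_le_pi_div_two (by linarith [Real.pi_pos])
      (by linarith [Real.pi_gt_three]) hx
  have h2 := (abs_le.1 (Real.sin_bound (x := 0.3624) (by norm_num [abs_le]))).2
  rw [abs_of_pos (by norm_num)] at h2
  have h3 : Real.sin (l * c) < 0.356 := by norm_num at h1 h2 ⊢; linarith
  have h4 : 0.356 < S * Real.sin c := by
    refine lt_of_pow_lt_pow_left₀ 2 (by positivity) ?_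
    rw [mul_pow, mul_comm, hprod]
    linarith
  exact h3.trans h4
end
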